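/- Let m = p + q and let X_1, ..., X_p be real analytic vector fields and F_1, ..., F_q real analytic functions on an open neighborhood U of 0 in ℝ^m such that: [X_i, X_j] = 0 for all i, j; DF_j(x)(X_i(x)) = 0 for all i, j and x ∈ U; the vectors X_1(x), ..., X_p(x) are linearly independent for x in a dense subset of U; and the differentials DF_1(x), ..., DF_q(x) are linearly independent for x in a dense subset of U. Assume 0 is a nondegenerate fixed point, i.e.: X_i(0) = 0 for all i; each real matrix A_i := DX_i(0) is semisimple (diagonalizable over ℂ); the vectors A_1 x, ..., A_p x are linearly independent for x in a dense subset of ℝ^m; and, denoting for each j by G_j the lowest-degree nonzero homogeneous term of the Taylor expansion of F_j at 0, the differentials DG_1(x), ..., DG_q(x) are linearly independent for x in a dense subset of ℝ^m. Then there exist an open neighborhood V ⊆ U of 0, a real analytic diffeomorphism φ from V onto an open neighborhood W of 0 in ℝ^m with φ(0) = 0, and real analytic functions f_{ij} (1 ≤ i, j ≤ p) on W with det(f_{ij}(y)) ≠ 0 for every y ∈ W, such that Df_{ij}(y)(A_k y) = 0 for all i, j, k and all y ∈ W, and such that Dφ(x)(X_i(x)) = Σ_{j=1}^p f_{ij}(φ(x))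 · A_j φ(x) for every x ∈ V and every i = 1, ..., p. -/

import Mathlib

open scoped BigOperators

/-- A real square matrix is semisimple iff it is diagonalizable over ℂ. -/
def IsSemisimpleMatrixR {m : ℕ} (A : Matrix (Fin m) (Fin m) ℝ) : Prop :=
  ∃ P : Matrix (Fin m) (Fin m) ℂ, IsUnit P ∧ ∃ d : Fin m → ℂ,
    A.map (algebraMap ℝ ℂ) = P * Matrix.diagonal d * P⁻¹

open scoped BigOperators
namespace GeoLin
noncomputable section
open MvPowerSeries
open scoped ENNReal NNReal

abbrev PS (m : ℕ) := MvPowerSeries (Fin m) ℂ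

variable {m : ℕ}

def mon (z : Fin m → ℂ) (α : Fin m →₀ ℕ) : ℂ := ∏ s, z s ^ α s

def nrm (ρ : ℝ≥0) (f : PS m) : ℝ≥0∞ :=
  ∑' α : Fin m →₀ ℕ, ‖coeff α f‖ₑ * (ρ : ℝ≥0∞) ^ α.degree

def Conv (f : PS m) : Prop := ∃ ρ : ℝ≥0, 0 < ρ ∧ nrm ρ f ≠ ⊤

def ev (f : PS m) (z : Fin m → ℂ) : ℂ := ∑' α, coeff α f * mon z α

def mpow (g : Fin m → PS m) (d : Fin m →₀ ℕ) : PS m := ∏ s, g s ^ d s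

def comp (f : PS m) (g : Fin m → PS m) : PS m :=
  fun α => ∑' d : Fin m →₀ ℕ, coeff d f * coeff α (mpow g d)

theorem coeff_comp (f : PS m) (g : Fin m → PS m) (α) :
    coeff α (comp f g) = ∑' d : Fin m →₀ ℕ, coeff d f * coeff α (mpow g d) := rfl

theorem mon_add (z : Fin m → ℂ) (α β : Fin m →₀ ℕ) : mon z (α + β) = mon z α * mon z β := by
  simp [mon, pow_add, Finset.prod_mul_distrib]

theorem mon_zero (z : Fin m → ℂ) : mon z 0 = 1 := by simp [mon]

theorem mon_single (z : Fin m → ℂ) (s : Fin m) : mon z (Finsupp.single s 1) = z s := by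
  unfold mon
  rw [Finset.prod_eq_single s]
  · simp
  · intro b _ hb; simp [hb.symm]
  · simp

theorem enorm_mon_le {ρ : ℝ≥0} {z : Fin m → ℂ} (hz : ∀ s, ‖z s‖ₑ ≤ ρ) (α : Fin m →₀ ℕ) :
    ‖mon z α‖ₑ ≤ (ρ : ℝ≥0∞) ^ α.degree := by
  rw [Finsupp.degree_eq_sum, ← Finset.prod_pow_eq_pow_sum]
  unfold mon
  have : ‖∏ s, z s ^ α s‖ₑ = ∏ s, ‖z s‖ₑ ^ α s := by
    simp only [enorm_eq_nnnorm, nnnorm_prod, nnnorm_pow]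
    push_cast; rfl
  rw [this]
  exact Finset.prod_le_prod' fun s _ => pow_le_pow_left₀ (zero_le) (hz s) _

theorem nrm_zero (ρ : ℝ≥0) : nrm ρ (0 : PS m) = 0 := by simp [nrm]

theorem nrm_add (ρ : ℝ≥0) (f g : PS m) : nrm ρ (f + g) ≤ nrm ρ f + nrm ρ g := by
  unfold nrm
  rw [← ENNReal.tsum_add]
  refine ENNReal.tsum_le_tsum fun α => ?_
  rw [← add_mul, map_add]
  gcongr
  exact enorm_add_le _ _

theorem nrm_sum {ι : Type*} (ρ : ℝ≥0) (S : Finset ι) (f : ι → PS m) :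
    nrm ρ (∑ i ∈ S, f i) ≤ ∑ i ∈ S, nrm ρ (f i) := by
  classical
  induction S using Finset.induction_on with
  | empty => simp [nrm_zero]
  | insert a S ha ih =>
    rw [Finset.sum_insert ha, Finset.sum_insert ha]
    exact (nrm_add _ _ _).trans (by gcongr)

theorem nrm_neg (ρ : ℝ≥0) (f : PS m) : nrm ρ (-f) = nrm ρ f := by simp [nrm]

theorem nrm_sub (ρ : ℝ≥0) (f g : PS m) : nrm ρ (f - g) ≤ nrm ρ f + nrm ρ g := by
  rw [sub_eq_add_neg, ← nrm_neg ρ g]; exact nrm_add _ _ _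

theorem nrm_mono {ρ ρ' : ℝ≥0} (h : ρ ≤ ρ') (f : PS m) : nrm ρ f ≤ nrm ρ' f := by
  unfold nrm
  refine ENNReal.tsum_le_tsum fun α => ?_
  gcongr

theorem nrm_mul (ρ : ℝ≥0) (f g : PS m) : nrm ρ (f * g) ≤ nrm ρ f * nrm ρ g := by
  classical
  have h1 : nrm ρ f * nrm ρ g = ∑' n : Fin m →₀ ℕ, ∑ kl ∈ Finset.HasAntidiagonal.antidiagonal n,
      (‖coeff kl.1 f‖ₑ * (ρ : ℝ≥0∞) ^ kl.1.degree) *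
        (‖coeff kl.2 g‖ₑ * (ρ : ℝ≥0∞) ^ kl.2.degree) := by
    unfold nrm
    rw [← ENNReal.tsum_mul_right]
    simp_rw [← ENNReal.tsum_mul_left]
    rw [← ENNReal.tsum_prod (f := fun a b => (‖coeff a f‖ₑ * (ρ : ℝ≥0∞) ^ a.degree) *
        (‖coeff b g‖ₑ * (ρ : ℝ≥0∞) ^ b.degree)),
      ← (Finset.HasAntidiagonal.sigmaAntidiagonalEquivProd (A := Fin m →₀ ℕ)).tsum_eq, ENNReal.tsum_sigma']
    refine tsum_congr fun n => ?_
    rw [tsum_fintype]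
    exact Finset.sum_coe_sort (Finset.HasAntidiagonal.antidiagonal n)
      (fun kl : (Fin m →₀ ℕ) × (Fin m →₀ ℕ) => (‖coeff kl.1 f‖ₑ * (ρ : ℝ≥0∞) ^ kl.1.degree) *
        (‖coeff kl.2 g‖ₑ * (ρ : ℝ≥0∞) ^ kl.2.degree))
  rw [h1]
  unfold nrm
  refine ENNReal.tsum_le_tsum fun n => ?_
  rw [coeff_mul]
  have : ∀ kl ∈ Finset.HasAntidiagonal.antidiagonal n, (‖coeff kl.1 f‖ₑ * (ρ : ℝ≥0∞) ^ kl.1.degree) *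
        (‖coeff kl.2 g‖ₑ * (ρ : ℝ≥0∞) ^ kl.2.degree) =
        ‖coeff kl.1 f * coeff kl.2 g‖ₑ * (ρ : ℝ≥0∞) ^ n.degree := by
    intro kl hkl
    rw [← Finset.HasAntidiagonal.mem_antidiagonal.1 hkl, map_add, pow_add, enorm_mul]
    ring
  rw [Finset.sum_congr rfl this, ← Finset.sum_mul]
  gcongr
  exact enorm_sum_le _ _

theorem nrm_monomial (ρ : ℝ≥0) (α : Fin m →₀ ℕ) (c : ℂ) :
    nrm ρ (monomial α c) = ‖c‖ₑ * (ρ : ℝ≥0∞) ^ α.degree := by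
  classical
  unfold nrm
  rw [tsum_eq_single α]
  · simp
  · intro b hb
    rw [coeff_monomial_ne hb]; simp

theorem nrm_X (ρ : ℝ≥0) (s : Fin m) : nrm ρ (X s : PS m) = ρ := by
  rw [X, nrm_monomial]; simp

theorem nrm_C (ρ : ℝ≥0) (c : ℂ) : nrm ρ (C c : PS m) = ‖c‖ₑ := by
  rw [← monomial_zero_eq_C_apply, nrm_monomial]; simp

theorem nrm_one (ρ : ℝ≥0) : nrm ρ (1 : PS m) = 1 := by
  rw [← map_one (C (σ := Fin m) (R := ℂ)), nrm_C]; simp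

theorem nrm_C_mul (ρ : ℝ≥0) (c : ℂ) (f : PS m) : nrm ρ (C c * f) = ‖c‖ₑ * nrm ρ f := by
  unfold nrm
  rw [← ENNReal.tsum_mul_left]
  simp [enorm_mul, mul_assoc]

theorem nrm_pow_le {ρ ρ' : ℝ≥0} {f : PS m} (h : nrm ρ f ≤ ρ') (n : ℕ) :
    nrm ρ (f ^ n) ≤ (ρ' : ℝ≥0∞) ^ n := by
  induction n with
  | zero => simp [nrm_one]
  | succ n ih =>
    rw [pow_succ, pow_succ]
    exact (nrm_mul _ _ _).trans (by gcongr)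

theorem nrm_prod_le {ι : Type*} (ρ : ℝ≥0) (S : Finset ι) (f : ι → PS m) (c : ι → ℝ≥0∞)
    (h : ∀ i ∈ S, nrm ρ (f i) ≤ c i) : nrm ρ (∏ i ∈ S, f i) ≤ ∏ i ∈ S, c i := by
  classical
  induction S using Finset.induction_on with
  | empty => simp [nrm_one]
  | insert a S ha ih =>
    rw [Finset.prod_insert ha, Finset.prod_insert ha]
    exact (nrm_mul _ _ _).trans (mul_le_mul' (h a (by simp)) (ih fun i hi => h i (by simp [hi])))

theorem nrm_mpow {ρ ρ' : ℝ≥0} {g : Fin m → PS m} (h : ∀ s, nrm ρ (g s) ≤ ρ') (d : Fin m →₀ ℕ) :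
    nrm ρ (mpow g d) ≤ (ρ' : ℝ≥0∞) ^ d.degree := by
  rw [Finsupp.degree_eq_sum, ← Finset.prod_pow_eq_pow_sum]
  exact nrm_prod_le _ _ _ _ fun s _ => nrm_pow_le (h s) _

theorem tsum_comp_le {ρ ρ' : ℝ≥0} (f : PS m) {g : Fin m → PS m} (h : ∀ s, nrm ρ (g s) ≤ ρ') :
    ∑' α : Fin m →₀ ℕ, ∑' d : Fin m →₀ ℕ, ‖coeff d f * coeff α (mpow g d)‖ₑ *
      (ρ : ℝ≥0∞) ^ α.degree ≤ nrm ρ' f := by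
  rw [ENNReal.tsum_comm]
  unfold nrm
  refine ENNReal.tsum_le_tsum fun d => ?_
  simp_rw [enorm_mul, mul_assoc]
  rw [ENNReal.tsum_mul_left]
  gcongr
  exact nrm_mpow h d

theorem nrm_comp {ρ ρ' : ℝ≥0} (f : PS m) {g : Fin m → PS m} (h : ∀ s, nrm ρ (g s) ≤ ρ') :
    nrm ρ (comp f g) ≤ nrm ρ' f := by
  refine le_trans ?_ (tsum_comp_le f h)
  refine ENNReal.tsum_le_tsum fun α => ?_
  rw [ENNReal.tsum_mul_right, coeff_comp]
  gcongr
  exact enorm_tsum_le_tsum_enorm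

/-! evaluation -/

theorem tsum_ev_le {ρ : ℝ≥0} (f : PS m) {z : Fin m → ℂ} (hz : ∀ s, ‖z s‖ₑ ≤ ρ) :
    ∑' α, ‖coeff α f * mon z α‖ₑ ≤ nrm ρ f := by
  refine ENNReal.tsum_le_tsum fun α => ?_
  rw [enorm_mul]
  gcongr
  exact enorm_mon_le hz α

theorem summable_ev {ρ : ℝ≥0} {f : PS m} (hf : nrm ρ f ≠ ⊤) {z : Fin m → ℂ}
    (hz : ∀ s, ‖z s‖ₑ ≤ ρ) : Summable fun α => ‖coeff α f * mon z α‖ :=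
  tsum_enorm_ne_top_iff_summable_norm.1 (ne_top_of_le_ne_top hf (tsum_ev_le f hz))

theorem enorm_ev_le {ρ : ℝ≥0} (f : PS m) {z : Fin m → ℂ} (hz : ∀ s, ‖z s‖ₑ ≤ ρ) :
    ‖ev f z‖ₑ ≤ nrm ρ f := enorm_tsum_le_tsum_enorm.trans (tsum_ev_le f hz)

theorem ev_add {ρ : ℝ≥0} {f g : PS m} (hf : nrm ρ f ≠ ⊤) (hg : nrm ρ g ≠ ⊤) {z : Fin m → ℂ}
    (hz : ∀ s, ‖z s‖ₑ ≤ ρ) : ev (f + g) z = ev f z + ev g z := by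
  unfold ev
  rw [← (summable_ev hf hz).of_norm.tsum_add (summable_ev hg hz).of_norm]
  simp [add_mul]

theorem ev_neg (f : PS m) (z : Fin m → ℂ) : ev (-f) z = -ev f z := by
  simp [ev, tsum_neg]

theorem ev_C_mul (c : ℂ) (f : PS m) (z : Fin m → ℂ) : ev (C c * f) z = c * ev f z := by
  simp [ev, ← tsum_mul_left, mul_assoc]

theorem ev_monomial (α : Fin m →₀ ℕ) (c : ℂ) (z : Fin m → ℂ) :
    ev (monomial α c) z = c * mon z α := by
  classical
  unfold ev
  rw [tsum_eq_single α]
  · simp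
  · intro b hb
    rw [coeff_monomial_ne hb]; simp

theorem ev_X (s : Fin m) (z : Fin m → ℂ) : ev (X s : PS m) z = z s := by
  rw [X, ev_monomial, mon_single, one_mul]

theorem ev_C (c : ℂ) (z : Fin m → ℂ) : ev (C c : PS m) z = c := by
  rw [← monomial_zero_eq_C_apply, ev_monomial, mon_zero, mul_one]

theorem ev_one (z : Fin m → ℂ) : ev (1 : PS m) z = 1 := by
  rw [← map_one (C (σ := Fin m) (R := ℂ)), ev_C]

theorem ev_zero (z : Fin m → ℂ) : ev (0 : PS m) z = 0 := by simp [ev]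

theorem ev_mul {ρ : ℝ≥0} {f g : PS m} (hf : nrm ρ f ≠ ⊤) (hg : nrm ρ g ≠ ⊤) {z : Fin m → ℂ}
    (hz : ∀ s, ‖z s‖ₑ ≤ ρ) : ev (f * g) z = ev f z * ev g z := by
  classical
  unfold ev
  have h1 := summable_ev hf hz
  have h2 := summable_ev hg hz
  have h3 := summable_mul_of_summable_norm h1 h2
  rw [h1.of_norm.tsum_mul_tsum_eq_tsum_sum_antidiagonal h2.of_norm h3]
  refine tsum_congr fun n => ?_
  rw [coeff_mul, Finset.sum_mul]
  refine Finset.sum_congr rfl fun kl hkl => ?_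
  rw [← Finset.HasAntidiagonal.mem_antidiagonal.1 hkl, mon_add]
  ring

theorem nrm_ne_top_mul {ρ : ℝ≥0} {f g : PS m} (hf : nrm ρ f ≠ ⊤) (hg : nrm ρ g ≠ ⊤) :
    nrm ρ (f * g) ≠ ⊤ := ne_top_of_le_ne_top (ENNReal.mul_ne_top hf hg) (nrm_mul _ _ _)

theorem nrm_ne_top_add {ρ : ℝ≥0} {f g : PS m} (hf : nrm ρ f ≠ ⊤) (hg : nrm ρ g ≠ ⊤) :
    nrm ρ (f + g) ≠ ⊤ := ne_top_of_le_ne_top (ENNReal.add_ne_top.2 ⟨hf, hg⟩) (nrm_add _ _ _)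

theorem nrm_ne_top_sum {ι : Type*} {ρ : ℝ≥0} {S : Finset ι} {f : ι → PS m}
    (hf : ∀ i ∈ S, nrm ρ (f i) ≠ ⊤) : nrm ρ (∑ i ∈ S, f i) ≠ ⊤ :=
  ne_top_of_le_ne_top (ENNReal.sum_ne_top.2 hf) (nrm_sum _ _ _)

theorem nrm_ne_top_pow {ρ : ℝ≥0} {f : PS m} (hf : nrm ρ f ≠ ⊤) (n : ℕ) : nrm ρ (f ^ n) ≠ ⊤ := by
  induction n with
  | zero => simp [nrm_one]
  | succ n ih => rw [pow_succ]; exact nrm_ne_top_mul ih hf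

theorem nrm_ne_top_prod {ι : Type*} {ρ : ℝ≥0} {S : Finset ι} {f : ι → PS m}
    (hf : ∀ i ∈ S, nrm ρ (f i) ≠ ⊤) : nrm ρ (∏ i ∈ S, f i) ≠ ⊤ := by
  refine ne_top_of_le_ne_top ?_ (nrm_prod_le ρ S f _ fun i _ => le_rfl)
  exact ENNReal.prod_ne_top hf

theorem ev_pow {ρ : ℝ≥0} {f : PS m} (hf : nrm ρ f ≠ ⊤) {z : Fin m → ℂ}
    (hz : ∀ s, ‖z s‖ₑ ≤ ρ) (n : ℕ) : ev (f ^ n) z = ev f z ^ n := by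
  induction n with
  | zero => simp [ev_one]
  | succ n ih => rw [pow_succ, pow_succ, ev_mul (nrm_ne_top_pow hf n) hf hz, ih]

theorem ev_prod {ι : Type*} {ρ : ℝ≥0} {S : Finset ι} {f : ι → PS m}
    (hf : ∀ i ∈ S, nrm ρ (f i) ≠ ⊤) {z : Fin m → ℂ} (hz : ∀ s, ‖z s‖ₑ ≤ ρ) :
    ev (∏ i ∈ S, f i) z = ∏ i ∈ S, ev (f i) z := by
  classical
  induction S using Finset.induction_on with
  | empty => simp [ev_one]
  | insert a S ha ih =>
    rw [Finset.prod_insert ha, Finset.prod_insert ha, ev_mul (hf a (by simp)) _ hz,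
      ih fun i hi => hf i (by simp [hi])]
    exact nrm_ne_top_prod fun i hi => hf i (by simp [hi])

theorem ev_sum {ι : Type*} {ρ : ℝ≥0} {S : Finset ι} {f : ι → PS m}
    (hf : ∀ i ∈ S, nrm ρ (f i) ≠ ⊤) {z : Fin m → ℂ} (hz : ∀ s, ‖z s‖ₑ ≤ ρ) :
    ev (∑ i ∈ S, f i) z = ∑ i ∈ S, ev (f i) z := by
  classical
  induction S using Finset.induction_on with
  | empty => simp [ev_zero]
  | insert a S ha ih =>
    rw [Finset.sum_insert ha, Finset.sum_insert ha, ev_add (hf a (by simp)) _ hz,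
      ih fun i hi => hf i (by simp [hi])]
    exact nrm_ne_top_sum fun i hi => hf i (by simp [hi])

theorem ev_comp {ρ ρ' : ℝ≥0} {f : PS m} {g : Fin m → PS m} (h : ∀ s, nrm ρ (g s) ≤ ρ')
    (hf : nrm ρ' f ≠ ⊤) {z : Fin m → ℂ} (hz : ∀ s, ‖z s‖ₑ ≤ ρ) :
    ev (comp f g) z = ev f (fun s => ev (g s) z) := by
  have hg : ∀ s, nrm ρ (g s) ≠ ⊤ := fun s => ne_top_of_le_ne_top ENNReal.coe_ne_top (h s)
  unfold ev
  simp_rw [coeff_comp, ← tsum_mul_right]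
  have hs : Summable (Function.uncurry fun (α d : Fin m →₀ ℕ) =>
      coeff d f * coeff α (mpow g d) * mon z α) := by
    apply Summable.of_enorm
    rw [ENNReal.tsum_prod']
    refine ne_top_of_le_ne_top hf (le_trans ?_ (tsum_comp_le f h))
    refine ENNReal.tsum_le_tsum fun α => ENNReal.tsum_le_tsum fun d => ?_
    simp only [Function.uncurry]
    rw [enorm_mul _ (mon z α)]
    gcongr
    exact enorm_mon_le hz α
  rw [← hs.tsum_comm]
  refine tsum_congr fun d => ?_
  simp_rw [mul_assoc]
  rw [tsum_mul_left]
  congr 1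
  change ev (mpow g d) z = _
  unfold mpow mon
  rw [ev_prod (fun s _ => nrm_ne_top_pow (hg s) _) hz]
  exact Finset.prod_congr rfl fun s _ => ev_pow (hg s) hz _

end
end GeoLin

open scoped BigOperators
namespace GeoLin
noncomputable section
open MvPowerSeries
open scoped ENNReal NNReal Topology

variable {m : ℕ}

/-! homogeneous parts and analyticity -/

def degFin (m n : ℕ) : Finset (Fin m →₀ ℕ) := (Finsupp.finite_of_degree_eq (σ := Fin m) n).toFinset

theorem mem_degFin {n : ℕ} {α : Fin m →₀ ℕ} : α ∈ degFin m n ↔ α.degree = n := by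
  simp [degFin]

def hp (n : ℕ) (f : PS m) (z : Fin m → ℂ) : ℂ := ∑ α ∈ degFin m n, coeff α f * mon z α

theorem exists_word {n : ℕ} {α : Fin m →₀ ℕ} (h : α.degree = n) :
    ∃ w : Fin n → Fin m, ∀ z : Fin m → ℂ, ∏ i, z (w i) = mon z α := by
  induction n generalizing α with
  | zero =>
    have : α = 0 := by simpa [Finsupp.degree_eq_zero_iff] using h
    subst this
    exact ⟨Fin.elim0, fun z => by simp [mon_zero]⟩
  | succ n ih =>
    have hne : α ≠ 0 := by rintro rfl; simp at h
    obtain ⟨s, hs⟩ := Finsupp.ne_iff.1 hne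
    have hle : Finsupp.single s 1 ≤ α := by
      rw [Finsupp.single_le_iff]; exact Nat.one_le_iff_ne_zero.2 hs
    obtain ⟨β, hβ⟩ := exists_add_of_le hle
    have hd : β.degree = n := by
      rw [hβ, map_add, Finsupp.degree_single] at h; omega
    obtain ⟨w, hw⟩ := ih hd
    refine ⟨Fin.cons s w, fun z => ?_⟩
    rw [Fin.prod_univ_succ]
    simp [hw, hβ, mon_add, mon_single]

theorem exists_mlin (n : ℕ) (α : Fin m →₀ ℕ) :
    ∃ M : ContinuousMultilinearMap ℂ (fun _ : Fin n => (Fin m → ℂ)) ℂ, ‖M‖ ≤ 1 ∧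
      (α.degree = n → ∀ z : Fin m → ℂ, M (fun _ => z) = mon z α) := by
  by_cases h : α.degree = n
  · obtain ⟨w, hw⟩ := exists_word h
    refine ⟨(ContinuousMultilinearMap.mkPiAlgebra ℂ (Fin n) ℂ).compContinuousLinearMap
      (fun i => ContinuousLinearMap.proj (w i)), ?_, fun _ z => by simp [← hw]⟩
    refine ContinuousMultilinearMap.opNorm_le_bound (by norm_num) fun v => ?_
    simp only [ContinuousMultilinearMap.compContinuousLinearMap_apply,
      ContinuousMultilinearMap.mkPiAlgebra_apply, ContinuousLinearMap.proj_apply, one_mul, norm_prod]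
    exact Finset.prod_le_prod (fun _ _ => norm_nonneg _) fun i _ => norm_le_pi_norm _ _
  · exact ⟨0, by simp, fun h' => absurd h' h⟩

def mlin (n : ℕ) (α : Fin m →₀ ℕ) : ContinuousMultilinearMap ℂ (fun _ : Fin n => (Fin m → ℂ)) ℂ :=
  (exists_mlin n α).choose

def fps (f : PS m) : FormalMultilinearSeries ℂ (Fin m → ℂ) ℂ :=
  fun n => ∑ α ∈ degFin m n, coeff α f • mlin n α

theorem fps_apply (f : PS m) (n : ℕ) (z : Fin m → ℂ) : fps f n (fun _ => z) = hp n f z := by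
  unfold fps hp
  rw [_root_.sum_apply]
  refine Finset.sum_congr rfl fun α hα => ?_
  have := (exists_mlin n α).choose_spec.2 (mem_degFin.1 hα) z
  rw [_root_.smul_apply, smul_eq_mul, ← this]
  rfl

theorem enorm_le_of_eball {ρ : ℝ≥0} {z : Fin m → ℂ} (h : z ∈ Metric.eball 0 (ρ : ℝ≥0∞)) (s : Fin m) :
    ‖z s‖ₑ ≤ ρ := by
  have h1 : ‖z‖ₑ < ρ := by rw [← edist_zero_right]; exact Metric.mem_eball.1 h
  have h2 : ‖z s‖ₑ ≤ ‖z‖ₑ := by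
    simp only [enorm_eq_nnnorm]; exact_mod_cast nnnorm_le_pi_nnnorm z s
  exact h2.trans h1.le

theorem hasSum_hp {ρ : ℝ≥0} {f : PS m} (hf : nrm ρ f ≠ ⊤) {z : Fin m → ℂ}
    (hz : ∀ s, ‖z s‖ₑ ≤ ρ) : HasSum (fun n => hp n f z) (ev f z) := by
  have h1 := (summable_ev hf hz).of_norm.hasSum
  have h2 := (Equiv.sigmaFiberEquiv (fun α : Fin m →₀ ℕ => α.degree)).hasSum_iff.2 h1
  refine HasSum.sigma h2 fun n => ?_
  change HasSum (fun c : {α : Fin m →₀ ℕ // α.degree = n} => coeff c.1 f * mon z c.1) _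
  let e : {α : Fin m →₀ ℕ // α.degree = n} ≃ {α // α ∈ degFin m n} :=
    Equiv.subtypeEquivRight fun α => mem_degFin.symm
  rw [← e.symm.hasSum_iff]
  exact Finset.hasSum (degFin m n) (fun α => coeff α f * mon z α)

theorem hasFPS {ρ : ℝ≥0} (hρ : 0 < ρ) {f : PS m} (hf : nrm ρ f ≠ ⊤) :
    HasFPowerSeriesOnBall (ev f) (fps f) 0 ρ := by
  refine ⟨?_, by exact_mod_cast hρ, ?_⟩
  · refine FormalMultilinearSeries.le_radius_of_bound_nnreal _ (nrm ρ f).toNNReal fun n => ?_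
    rw [← ENNReal.coe_le_coe, ENNReal.coe_toNNReal hf]
    have h1 : ‖fps f n‖₊ ≤ ∑ α ∈ degFin m n, ‖coeff α f‖₊ := by
      refine (nnnorm_sum_le _ _).trans (Finset.sum_le_sum fun α _ => ?_)
      rw [nnnorm_smul]
      have : ‖mlin n α‖₊ ≤ 1 := (exists_mlin n α).choose_spec.1
      calc _ ≤ ‖coeff α f‖₊ * 1 := by gcongr
        _ = _ := mul_one _
    calc ((‖fps f n‖₊ * ρ ^ n : ℝ≥0) : ℝ≥0∞) ≤ ((∑ α ∈ degFin m n, ‖coeff α f‖₊) * ρ ^ n : ℝ≥0) := by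
          exact_mod_cast mul_le_mul_left h1 _
      _ = ∑ α ∈ degFin m n, ‖coeff α f‖ₑ * (ρ : ℝ≥0∞) ^ α.degree := by
          push_cast
          rw [Finset.sum_mul]
          refine Finset.sum_congr rfl fun α hα => ?_
          rw [mem_degFin.1 hα]; rfl
      _ ≤ _ := ENNReal.sum_le_tsum _
  · intro z hz
    simp only [fps_apply, zero_add]
    exact hasSum_hp hf (enorm_le_of_eball hz)

theorem Conv.hasFPS {f : PS m} (hf : Conv f) : HasFPowerSeriesAt (ev f) (fps f) 0 := by
  obtain ⟨ρ, hρ, h⟩ := hf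
  exact ⟨ρ, GeoLin.hasFPS hρ h⟩

/-- A real linear map into `ℂ^m` with Zariski dense range. -/
def ZDense (L : (Fin m → ℝ) →L[ℝ] (Fin m → ℂ)) : Prop :=
  ∀ P : MvPolynomial (Fin m) ℂ, (∀ x, MvPolynomial.eval (L x) P = 0) → P = 0

theorem hp_eq_of_fps {f : PS m} (hf : Conv f) (L : (Fin m → ℝ) →L[ℝ] (Fin m → ℂ))
    {F : (Fin m → ℝ) → ℂ} {P : FormalMultilinearSeries ℝ (Fin m → ℝ) ℂ}
    (hF : HasFPowerSeriesAt F P 0) (h : ∀ᶠ x in 𝓝 0, F x = ev f (L x)) (n : ℕ) (x : Fin m → ℝ) :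
    hp n f (L x) = P n (fun _ => x) := by
  have h1 : HasFPowerSeriesAt (ev f) ((fps f).restrictScalars ℝ) (L 0) := by
    rw [map_zero]; exact hf.hasFPS.restrictScalars
  have h2 := h1.compContinuousLinearMap
  have h3 := h2.sub hF
  have h4 : HasFPowerSeriesAt (0 : (Fin m → ℝ) → ℂ) _ 0 := h3.congr (by
    filter_upwards [h] with x hx
    simp [hx])
  have h5 := h4.apply_eq_zero n x
  have h6 : (((fps f).restrictScalars ℝ).compContinuousLinearMap L n) (fun _ => x) = P n fun _ => x := by
    rw [← sub_eq_zero]; exact h5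
  rw [← h6, FormalMultilinearSeries.compContinuousLinearMap_apply, ← fps_apply]
  rfl

theorem coeff_eq_zero_of_hp {f : PS m} {L : (Fin m → ℝ) →L[ℝ] (Fin m → ℂ)} (hL : ZDense L) {n : ℕ}
    (h : ∀ x, hp n f (L x) = 0) {α : Fin m →₀ ℕ} (hα : α.degree = n) : coeff α f = 0 := by
  classical
  have := hL (∑ β ∈ degFin m n, MvPolynomial.monomial β (coeff β f)) (fun x => by
    rw [map_sum, ← h x]
    refine Finset.sum_congr rfl fun β _ => ?_
    rw [MvPolynomial.eval_monomial, Finsupp.prod_fintype _ _ (by simp)]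
    rfl)
  have h2 := congrArg (MvPolynomial.coeff α) this
  rw [MvPolynomial.coeff_sum] at h2
  simpa [MvPolynomial.coeff_monomial, mem_degFin, hα] using h2

theorem ev_inj_zero {f : PS m} (hf : Conv f) {L : (Fin m → ℝ) →L[ℝ] (Fin m → ℂ)} (hL : ZDense L)
    (h : ∀ᶠ x in 𝓝 0, ev f (L x) = 0) : f = 0 := by
  ext α
  refine coeff_eq_zero_of_hp hL (n := α.degree) (fun x => ?_) rfl
  have h0 : HasFPowerSeriesAt (fun _ : Fin m → ℝ => (0 : ℂ))
    (constFormalMultilinearSeries ℝ (Fin m → ℝ) (0 : ℂ)) 0 := hasFPowerSeriesAt_const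
  rw [hp_eq_of_fps hf L h0 (by filter_upwards [h] with x hx using hx.symm)]
  have := constFormalMultilinearSeries_zero (𝕜 := ℝ) (E := Fin m → ℝ) (F := ℂ)
  rw [this]; rfl

/-! closure of Conv -/

theorem Conv.common {f g : PS m} (hf : Conv f) (hg : Conv g) :
    ∃ ρ : ℝ≥0, 0 < ρ ∧ nrm ρ f ≠ ⊤ ∧ nrm ρ g ≠ ⊤ := by
  obtain ⟨a, ha, h1⟩ := hf
  obtain ⟨b, hb, h2⟩ := hg
  exact ⟨min a b, lt_min ha hb, ne_top_of_le_ne_top h1 (nrm_mono (min_le_left _ _) _),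
    ne_top_of_le_ne_top h2 (nrm_mono (min_le_right _ _) _)⟩

theorem Conv.common_fin {ι : Type*} (S : Finset ι) {f : ι → PS m} (hf : ∀ i ∈ S, Conv (f i)) :
    ∃ ρ : ℝ≥0, 0 < ρ ∧ ∀ i ∈ S, nrm ρ (f i) ≠ ⊤ := by
  classical
  induction S using Finset.induction_on with
  | empty => exact ⟨1, one_pos, by simp⟩
  | insert a S ha ih =>
    obtain ⟨ρ, hρ, h⟩ := ih fun i hi => hf i (by simp [hi])
    obtain ⟨ρ', hρ', h'⟩ := hf a (by simp)
    refine ⟨min ρ ρ', lt_min hρ hρ', fun i hi => ?_⟩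
    rcases Finset.mem_insert.1 hi with rfl | hi
    · exact ne_top_of_le_ne_top h' (nrm_mono (min_le_right _ _) _)
    · exact ne_top_of_le_ne_top (h i hi) (nrm_mono (min_le_left _ _) _)

theorem Conv.add {f g : PS m} (hf : Conv f) (hg : Conv g) : Conv (f + g) := by
  obtain ⟨ρ, h, h1, h2⟩ := hf.common hg; exact ⟨ρ, h, nrm_ne_top_add h1 h2⟩

theorem Conv.mul {f g : PS m} (hf : Conv f) (hg : Conv g) : Conv (f * g) := by
  obtain ⟨ρ, h, h1, h2⟩ := hf.common hg; exact ⟨ρ, h, nrm_ne_top_mul h1 h2⟩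

theorem Conv.neg {f : PS m} (hf : Conv f) : Conv (-f) := by
  obtain ⟨ρ, h, h1⟩ := hf; exact ⟨ρ, h, by rwa [nrm_neg]⟩

theorem Conv.sub {f g : PS m} (hf : Conv f) (hg : Conv g) : Conv (f - g) := by
  rw [sub_eq_add_neg]; exact hf.add hg.neg

theorem conv_C (c : ℂ) : Conv (C c : PS m) := ⟨1, one_pos, by rw [nrm_C]; simp⟩
theorem conv_X (s : Fin m) : Conv (X s : PS m) := ⟨1, one_pos, by rw [nrm_X]; simp⟩
theorem conv_zero : Conv (0 : PS m) := ⟨1, one_pos, by rw [nrm_zero]; simp⟩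
theorem conv_one : Conv (1 : PS m) := ⟨1, one_pos, by rw [nrm_one]; simp⟩

theorem Conv.sum {ι : Type*} {S : Finset ι} {f : ι → PS m} (hf : ∀ i ∈ S, Conv (f i)) :
    Conv (∑ i ∈ S, f i) := by
  obtain ⟨ρ, h, h1⟩ := Conv.common_fin S hf; exact ⟨ρ, h, nrm_ne_top_sum h1⟩

theorem eventually_small {ρ : ℝ≥0} (h : 0 < ρ) : ∀ᶠ z : Fin m → ℂ in 𝓝 0, ∀ s, ‖z s‖ₑ ≤ ρ := by
  filter_upwards [Metric.eball_mem_nhds (0 : Fin m → ℂ) (ε := ρ) (by exact_mod_cast h)] with z hz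
  exact enorm_le_of_eball hz

theorem Conv.ev_add {f g : PS m} (hf : Conv f) (hg : Conv g) :
    ∀ᶠ z in 𝓝 0, ev (f + g) z = ev f z + ev g z := by
  obtain ⟨ρ, h, h1, h2⟩ := hf.common hg
  filter_upwards [eventually_small h] with z hz using GeoLin.ev_add h1 h2 hz

theorem Conv.ev_sub {f g : PS m} (hf : Conv f) (hg : Conv g) :
    ∀ᶠ z in 𝓝 0, ev (f - g) z = ev f z - ev g z := by
  filter_upwards [hf.ev_add hg.neg] with z hz
  rw [sub_eq_add_neg, hz, ev_neg, sub_eq_add_neg]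

theorem Conv.ev_mul {f g : PS m} (hf : Conv f) (hg : Conv g) :
    ∀ᶠ z in 𝓝 0, ev (f * g) z = ev f z * ev g z := by
  obtain ⟨ρ, h, h1, h2⟩ := hf.common hg
  filter_upwards [eventually_small h] with z hz using GeoLin.ev_mul h1 h2 hz

theorem Conv.ev_sum {ι : Type*} {S : Finset ι} {f : ι → PS m} (hf : ∀ i ∈ S, Conv (f i)) :
    ∀ᶠ z in 𝓝 0, ev (∑ i ∈ S, f i) z = ∑ i ∈ S, ev (f i) z := by
  obtain ⟨ρ, h, h1⟩ := Conv.common_fin S hf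
  filter_upwards [eventually_small h] with z hz using GeoLin.ev_sum h1 hz

theorem ev_inj {f g : PS m} (hf : Conv f) (hg : Conv g) {L : (Fin m → ℝ) →L[ℝ] (Fin m → ℂ)}
    (hL : ZDense L) (h : ∀ᶠ x in 𝓝 0, ev f (L x) = ev g (L x)) : f = g := by
  rw [← sub_eq_zero]
  refine ev_inj_zero (hf.sub hg) hL ?_
  have hc : Filter.Tendsto L (𝓝 0) (𝓝 0) := by simpa using L.continuous.tendsto 0
  filter_upwards [h, hc.eventually (hf.ev_sub hg)] with x hx hx2
  rw [hx2, hx, sub_self]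

/-! the standard embedding -/

def ofR : (Fin m → ℝ) →L[ℝ] (Fin m → ℂ) :=
  ContinuousLinearMap.pi fun s => Complex.ofRealCLM.comp (ContinuousLinearMap.proj s)

@[simp] theorem ofR_apply (x : Fin m → ℝ) (s : Fin m) : ofR x s = (x s : ℂ) := rfl

theorem zdense_ofR : ZDense (ofR (m := m)) := by
  intro P hP
  refine MvPolynomial.funext_set (fun _ => Set.range ((↑) : ℝ → ℂ))
    (fun _ => Set.infinite_range_of_injective Complex.ofReal_injective) fun z hz => ?_
  rw [map_zero]
  have : ∀ s, ∃ x : ℝ, (x : ℂ) = z s := fun s => hz s (Set.mem_univ _)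
  choose x hx using this
  rw [← hP x]
  congr 1
  congr 1
  funext s
  exact (hx s).symm

theorem ev_inj' {f g : PS m} (hf : Conv f) (hg : Conv g)
    (h : ∀ᶠ z in 𝓝 0, ev f z = ev g z) : f = g := by
  refine ev_inj hf hg zdense_ofR ?_
  have hc : Filter.Tendsto (ofR (m := m)) (𝓝 0) (𝓝 0) := by
    have := (ofR (m := m)).continuous.tendsto 0
    rwa [map_zero] at this
  exact hc.eventually h

end
end GeoLin

open scoped BigOperators
namespace GeoLin
noncomputable section
open MvPowerSeries
open scoped ENNReal NNReal Topology

variable {m : ℕ}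

/-! order of vanishing -/

def vanish (n : ℕ) (f : PS m) : Prop := ∀ α : Fin m →₀ ℕ, α.degree < n → coeff α f = 0

theorem vanish_zero_ord (f : PS m) : vanish 0 f := fun _ h => absurd h (by simp)
theorem vanish.zero (n : ℕ) : vanish n (0 : PS m) := fun _ _ => by simp
theorem vanish.mono {n k : ℕ} {f : PS m} (h : vanish n f) (hk : k ≤ n) : vanish k f :=
  fun α hα => h α (lt_of_lt_of_le hα hk)
theorem vanish.add {n : ℕ} {f g : PS m} (hf : vanish n f) (hg : vanish n g) : vanish n (f + g) :=
  fun α hα => by rw [map_add, hf α hα, hg α hα, add_zero]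
theorem vanish.neg {n : ℕ} {f : PS m} (hf : vanish n f) : vanish n (-f) :=
  fun α hα => by rw [map_neg, hf α hα, neg_zero]
theorem vanish.sub {n : ℕ} {f g : PS m} (hf : vanish n f) (hg : vanish n g) : vanish n (f - g) := by
  rw [sub_eq_add_neg]; exact hf.add hg.neg
theorem vanish.sum {ι : Type*} {n : ℕ} {S : Finset ι} {f : ι → PS m} (hf : ∀ i ∈ S, vanish n (f i)) :
    vanish n (∑ i ∈ S, f i) := fun α hα => by
  rw [map_sum]; exact Finset.sum_eq_zero fun i hi => hf i hi α hα
theorem vanish.mul {n k : ℕ} {f g : PS m} (hf : vanish n f) (hg : vanish k g) :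
    vanish (n + k) (f * g) := fun α hα => by
  classical
  rw [coeff_mul]
  refine Finset.sum_eq_zero fun p hp => ?_
  have h := congrArg Finsupp.degree (Finset.HasAntidiagonal.mem_antidiagonal.1 hp)
  rw [map_add] at h
  by_cases h1 : p.1.degree < n
  · rw [hf _ h1, zero_mul]
  · rw [hg p.2 (by omega), mul_zero]
theorem vanish.mul_left {n : ℕ} {f : PS m} (g : PS m) (hf : vanish n f) : vanish n (g * f) := by
  simpa using (vanish_zero_ord g).mul hf
theorem vanish.mul_right {n : ℕ} {f : PS m} (g : PS m) (hf : vanish n f) : vanish n (f * g) := by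
  simpa using hf.mul (vanish_zero_ord g)
theorem vanish_X (s : Fin m) : vanish 1 (X s : PS m) := fun α hα => by
  classical
  rw [coeff_X, if_neg]
  rintro rfl
  simp at hα

/-- `a` and `b` vanish to order `k` and agree to relative order `N`. -/
def Rel (N k : ℕ) (a b : PS m) : Prop := vanish k a ∧ vanish k b ∧ vanish (N + k) (a - b)

theorem Rel.mul {N k l : ℕ} {a b a' b' : PS m} (h : Rel N k a b) (h' : Rel N l a' b') :
    Rel N (k + l) (a * a') (b * b') := by
  refine ⟨h.1.mul h'.1, h.2.1.mul h'.2.1, ?_⟩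
  have : a * a' - b * b' = (a - b) * a' + b * (a' - b') := by ring
  rw [this]
  refine vanish.add ((h.2.2.mul h'.1).mono (by omega)) ((h.2.1.mul h'.2.2).mono (by omega))

theorem Rel.refl_one (N : ℕ) : Rel N 0 (1 : PS m) 1 :=
  ⟨vanish_zero_ord _, vanish_zero_ord _, by rw [sub_self]; exact vanish.zero _⟩

theorem Rel.pow {N k : ℕ} {a b : PS m} (h : Rel N k a b) (n : ℕ) : Rel N (n * k) (a ^ n) (b ^ n) := by
  induction n with
  | zero => simpa using Rel.refl_one N
  | succ n ih => rw [pow_succ, pow_succ, Nat.succ_mul]; exact ih.mul h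

theorem Rel.prod {ι : Type*} {N : ℕ} {S : Finset ι} {k : ι → ℕ} {a b : ι → PS m}
    (h : ∀ i ∈ S, Rel N (k i) (a i) (b i)) :
    Rel N (∑ i ∈ S, k i) (∏ i ∈ S, a i) (∏ i ∈ S, b i) := by
  classical
  induction S using Finset.induction_on with
  | empty => simpa using Rel.refl_one N
  | insert i S hi ih =>
    rw [Finset.prod_insert hi, Finset.prod_insert hi, Finset.sum_insert hi]
    exact (h i (by simp)).mul (ih fun j hj => h j (by simp [hj]))

theorem Rel.mpow {N : ℕ} {a b : Fin m → PS m} (h : ∀ s, Rel N 1 (a s) (b s)) (d : Fin m →₀ ℕ) :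
    Rel N d.degree (mpow a d) (mpow b d) := by
  rw [Finsupp.degree_eq_sum]
  refine Rel.prod fun s _ => ?_
  simpa using (h s).pow (d s)

theorem mpow_X (d : Fin m →₀ ℕ) : mpow (fun s => (X s : PS m)) d = monomial d 1 := by
  classical
  unfold mpow
  rw [monomial_one_eq, Finsupp.prod_fintype _ _ (by simp)]

theorem vanish_mpow {a : Fin m → PS m} (h : ∀ s, vanish 1 (a s)) (d : Fin m →₀ ℕ) :
    vanish d.degree (mpow a d) :=
  (Rel.mpow (N := 0) (fun s => ⟨h s, h s, by rw [sub_self]; exact vanish.zero _⟩) d).1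

theorem comp_congr {f : PS m} {a b : Fin m → PS m} {N n : ℕ} (hf : vanish n f)
    (h : ∀ s, Rel N 1 (a s) (b s)) : vanish (N + n) (comp f a - comp f b) := by
  intro α hα
  rw [map_sub, sub_eq_zero, coeff_comp, coeff_comp]
  refine tsum_congr fun d => ?_
  by_cases hd : d.degree < n
  · rw [hf d hd, zero_mul, zero_mul]
  · congr 1
    rw [← sub_eq_zero, ← map_sub]
    exact (Rel.mpow h d).2.2 α (by omega)

theorem comp_vanish {f : PS m} {a : Fin m → PS m} {n : ℕ} (hf : vanish n f)
    (h : ∀ s, vanish 1 (a s)) : vanish n (comp f a) := by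
  intro α hα
  rw [coeff_comp]
  convert tsum_zero with d
  by_cases hd : d.degree < n
  · rw [hf d hd, zero_mul]
  · rw [vanish_mpow h d α (by omega), mul_zero]

theorem comp_id (f : PS m) : comp f (fun s => X s) = f := by
  classical
  ext α
  rw [coeff_comp]
  simp_rw [mpow_X]
  rw [tsum_eq_single α]
  · simp
  · intro d hd; rw [coeff_monomial_ne hd.symm, mul_zero]

theorem comp_sub_vanish {f : PS m} {ξ : Fin m → PS m} {n : ℕ} (hf : vanish n f)
    (h : ∀ s, vanish 2 (ξ s)) : vanish (n + 1) (comp f (fun s => X s + ξ s) - f) := by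
  have := comp_congr (N := 1) (b := fun s => X s) (a := fun s => X s + ξ s) hf (fun s =>
    ⟨(vanish_X s).add ((h s).mono (by norm_num)), vanish_X s, by simpa using h s⟩)
  rw [comp_id] at this
  rwa [add_comm]

/-! scaling -/

theorem nrm_scale {n : ℕ} {f : PS m} (hf : vanish n f) {t : ℝ≥0} (ht : t ≤ 1) (ρ : ℝ≥0) :
    nrm (t * ρ) f ≤ (t : ℝ≥0∞) ^ n * nrm ρ f := by
  unfold nrm
  rw [← ENNReal.tsum_mul_left]
  refine ENNReal.tsum_le_tsum fun α => ?_
  by_cases h : α.degree < n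
  · rw [hf α h]; simp
  · push_cast
    rw [mul_pow, ← mul_assoc, ← mul_assoc, mul_comm _ ‖_‖ₑ]
    refine mul_le_mul_left (mul_le_mul_right ?_ _) _
    exact pow_le_pow_of_le_one (zero_le) (by exact_mod_cast ht) (not_lt.1 h)

theorem nrm_small {f : PS m} (hf : Conv f) (hv : vanish 1 f) {ε : ℝ≥0} (hε : 0 < ε) :
    ∃ ρ₀ : ℝ≥0, 0 < ρ₀ ∧ ∀ ρ ≤ ρ₀, nrm ρ f ≤ ε := by
  obtain ⟨ρ, hρ, h⟩ := hf
  set c := (nrm ρ f).toNNReal with hc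
  have hc' : nrm ρ f = c := (ENNReal.coe_toNNReal h).symm
  set t : ℝ≥0 := min 1 (ε / (c + 1))
  have ht : 0 < t := lt_min one_pos (div_pos hε (by positivity))
  refine ⟨t * ρ, mul_pos ht hρ, fun ρ' hρ' => (nrm_mono hρ' f).trans ?_⟩
  refine (nrm_scale hv (min_le_left _ _) ρ).trans ?_
  rw [hc', pow_one]
  have : t * c ≤ ε := by
    calc t * c ≤ ε / (c + 1) * (c + 1) := by
          gcongr
          · exact min_le_right _ _
          · exact le_self_add
      _ = ε := by field_simp
  exact_mod_cast this

theorem nrm_small_fin {ι : Type*} [Fintype ι] {f : ι → PS m} (hf : ∀ i, Conv (f i))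
    (hv : ∀ i, vanish 1 (f i)) {ε : ℝ≥0} (hε : 0 < ε) :
    ∃ ρ₀ : ℝ≥0, 0 < ρ₀ ∧ ∀ ρ ≤ ρ₀, ∀ i, nrm ρ (f i) ≤ ε := by
  choose r hr h using fun i => nrm_small (hf i) (hv i) hε
  by_cases hι : Nonempty ι
  · obtain ⟨i0, -, h0⟩ := Finset.exists_min_image Finset.univ r Finset.univ_nonempty
    exact ⟨r i0, hr i0, fun ρ hρ i => h i ρ (hρ.trans (h0 i (Finset.mem_univ _)))⟩
  · exact ⟨1, one_pos, fun ρ _ i => (hι ⟨i⟩).elim⟩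

theorem Conv.comp {f : PS m} {g : Fin m → PS m} (hf : Conv f) (hg : ∀ s, Conv (g s))
    (hv : ∀ s, vanish 1 (g s)) : Conv (comp f g) := by
  obtain ⟨ρ', hρ', h⟩ := hf
  obtain ⟨ρ, hρ, h2⟩ := nrm_small_fin hg hv hρ'
  exact ⟨ρ, hρ, ne_top_of_le_ne_top h (nrm_comp f (h2 ρ le_rfl))⟩

theorem Conv.ev_comp {f : PS m} {g : Fin m → PS m} (hf : Conv f) (hg : ∀ s, Conv (g s))
    (hv : ∀ s, vanish 1 (g s)) :
    ∀ᶠ z in 𝓝 0, ev (GeoLin.comp f g) z = ev f (fun s => ev (g s) z) := by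
  obtain ⟨ρ', hρ', h⟩ := hf
  obtain ⟨ρ, hρ, h2⟩ := nrm_small_fin hg hv hρ'
  filter_upwards [eventually_small hρ] with z hz
  exact GeoLin.ev_comp (h2 ρ le_rfl) h hz

theorem ev_at_zero (f : PS m) : ev f 0 = coeff 0 f := by
  unfold ev
  rw [tsum_eq_single 0, mon_zero, mul_one]
  intro d hd
  obtain ⟨s, hs⟩ := Finsupp.ne_iff.1 hd
  have : mon (0 : Fin m → ℂ) d = 0 :=
    Finset.prod_eq_zero (Finset.mem_univ s) (zero_pow hs)
  rw [this, mul_zero]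

theorem Conv.analyticAt {f : PS m} (hf : Conv f) : AnalyticAt ℂ (ev f) 0 := ⟨_, hf.hasFPS⟩

theorem Conv.tendsto_zero {g : Fin m → PS m} (hg : ∀ s, Conv (g s)) (hv : ∀ s, vanish 1 (g s)) :
    Filter.Tendsto (fun z s => ev (g s) z) (𝓝 0) (𝓝 0) := by
  rw [tendsto_pi_nhds]
  intro s
  have := (hg s).analyticAt.continuousAt.tendsto
  rw [ev_at_zero, hv s 0 (by simp)] at this
  exact this

/-! partial derivatives -/

abbrev pd (r : Fin m) (f : PS m) : PS m := pderiv ℂ r f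

theorem pd_aux (n : ℕ) : ((n : ℝ≥0∞) + 1) ≤ 2 ^ (n + 1) := by
  have : n + 1 ≤ 2 ^ (n + 1) := Nat.lt_two_pow_self.le
  exact_mod_cast this

theorem nrm_pd (r : Fin m) (f : PS m) (ρ : ℝ≥0) :
    (ρ : ℝ≥0∞) * nrm (ρ / 2) (pd r f) ≤ 2 * nrm ρ f := by
  have h1 : 2 * ∑' β : Fin m →₀ ℕ, ‖coeff (β + Finsupp.single r 1) f‖ₑ *
      (ρ : ℝ≥0∞) ^ (β + Finsupp.single r 1).degree ≤ 2 * nrm ρ f := by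
    gcongr
    exact ENNReal.tsum_comp_le_tsum_of_injective (f := fun β : Fin m →₀ ℕ => β + Finsupp.single r 1)
      (add_left_injective _) (fun α => ‖coeff α f‖ₑ * (ρ : ℝ≥0∞) ^ α.degree)
  refine le_trans ?_ h1
  unfold nrm
  rw [← ENNReal.tsum_mul_left, ← ENNReal.tsum_mul_left]
  refine ENNReal.tsum_le_tsum fun β => ?_
  rw [coeff_pderiv, enorm_mul, map_add, Finsupp.degree_single, pow_succ]
  have h2 : ‖((β r : ℂ) + 1)‖ₑ ≤ 2 ^ (β.degree + 1) := by
    have : ‖((β r : ℂ) + 1)‖ₑ = (β r : ℝ≥0∞) + 1 := by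
      have : ((β r : ℂ) + 1) = ((β r + 1 : ℕ) : ℂ) := by push_cast; rfl
      rw [this, enorm_eq_nnnorm]
      have h5 : ‖((β r + 1 : ℕ) : ℂ)‖₊ = ((β r + 1 : ℕ) : ℝ≥0) := by
        ext; rw [coe_nnnorm, Complex.norm_natCast]; simp
      rw [h5]; push_cast; rfl
    rw [this]
    refine le_trans ?_ (pd_aux _)
    gcongr
    exact Finsupp.le_degree r β
  have h3 : ((ρ / 2 : ℝ≥0) : ℝ≥0∞) ^ β.degree * 2 ^ β.degree = (ρ : ℝ≥0∞) ^ β.degree := by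
    rw [← mul_pow]; congr 1
    have : (ρ / 2 : ℝ≥0) * 2 = ρ := by field_simp
    exact_mod_cast this
  calc _ ≤ (ρ : ℝ≥0∞) * (‖coeff (β + Finsupp.single r 1) f‖ₑ * 2 ^ (β.degree + 1) *
        ((ρ / 2 : ℝ≥0) : ℝ≥0∞) ^ β.degree) := by gcongr
    _ = 2 * (‖coeff (β + Finsupp.single r 1) f‖ₑ *
        ((((ρ / 2 : ℝ≥0) : ℝ≥0∞) ^ β.degree * 2 ^ β.degree) * ρ)) := by rw [pow_succ]; ring
    _ = _ := by rw [h3]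

theorem nrm_pd_ne_top {f : PS m} {ρ : ℝ≥0} (hρ : 0 < ρ) (hf : nrm ρ f ≠ ⊤) (r : Fin m) :
    nrm (ρ / 2) (pd r f) ≠ ⊤ := by
  intro h
  have := nrm_pd r f ρ
  rw [h, ENNReal.mul_top (by exact_mod_cast hρ.ne')] at this
  exact ENNReal.mul_ne_top (by simp) hf (top_le_iff.1 this)

theorem Conv.pd {f : PS m} (hf : Conv f) (r : Fin m) : Conv (pd r f) := by
  obtain ⟨ρ, hρ, h⟩ := hf
  exact ⟨ρ / 2, by positivity, nrm_pd_ne_top hρ h r⟩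

theorem hasFDerivAt_mon (α : Fin m →₀ ℕ) (z : Fin m → ℂ) :
    HasFDerivAt (fun z => mon z α) (∑ r, ((α r : ℂ) * mon z (α - Finsupp.single r 1)) •
      (ContinuousLinearMap.proj r : (Fin m → ℂ) →L[ℂ] ℂ)) z := by
  classical
  unfold mon
  have h := HasFDerivAt.finsetProd (u := Finset.univ) (x := z) (g := fun s (z : Fin m → ℂ) => z s ^ α s)
    (g' := fun s => ((α s : ℂ) * z s ^ (α s - 1)) • (ContinuousLinearMap.proj s : (Fin m → ℂ) →L[ℂ] ℂ))
    (fun s _ => by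
      have := (ContinuousLinearMap.proj (R := ℂ) (φ := fun _ : Fin m => ℂ) s).hasFDerivAt (x := z)
      simpa using this.pow (α s))
  refine h.congr_fderiv ?_
  refine Finset.sum_congr rfl fun r _ => ?_
  symm
  rw [smul_smul]
  congr 1
  rw [← Finset.mul_prod_erase _ _ (Finset.mem_univ r)]
  have : ∏ s ∈ Finset.univ.erase r, z s ^ ((α - Finsupp.single r 1 : Fin m →₀ ℕ) s) =
      ∏ s ∈ Finset.univ.erase r, z s ^ α s := by
    refine Finset.prod_congr rfl fun s hs => ?_
    have : s ≠ r := Finset.ne_of_mem_erase hs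
    simp [this.symm]
  rw [this]
  simp
  ring

theorem reindex_hasSum {ι : Type*} [AddCommMonoid ι] [TopologicalSpace ι] (r : Fin m)
    (h : (Fin m →₀ ℕ) → ι) (h0 : ∀ α, α r = 0 → h α = 0) (a : ι) :
    HasSum (fun β => h (β + Finsupp.single r 1)) a ↔ HasSum h a := by
  refine (add_left_injective (Finsupp.single r 1)).hasSum_iff (f := h) (a := a) fun α hα => ?_
  refine h0 α ?_
  by_contra hne
  refine hα ⟨α - Finsupp.single r 1, ?_⟩
  refine tsub_add_cancel_of_le ?_
  rw [Finsupp.single_le_iff]; omega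

theorem hasFDerivAt_ev {f : PS m} {ρ : ℝ≥0} (hρ : 0 < ρ) (hf : nrm ρ f ≠ ⊤) {z : Fin m → ℂ}
    (hz : z ∈ Metric.eball (0 : Fin m → ℂ) (ρ / 2 : ℝ≥0)) :
    HasFDerivAt (ev f) (∑ r, ev (pd r f) z • (ContinuousLinearMap.proj r : (Fin m → ℂ) →L[ℂ] ℂ)) z := by
  have hρ2 : 0 < ρ / 2 := by positivity
  set B := Metric.eball (0 : Fin m → ℂ) (ρ / 2 : ℝ≥0)
  have hB : B = Metric.ball (0 : Fin m → ℂ) (ρ / 2 : ℝ≥0) := Metric.eball_coe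
  let u : Fin m → (Fin m →₀ ℕ) → ℝ := fun r α => ‖coeff α f‖ * (α r : ℝ) *
    ((ρ / 2 : ℝ≥0) : ℝ) ^ (α - Finsupp.single r 1).degree
  have hu : ∀ r, Summable (u r) := by
    intro r
    have h1 : Summable fun β => u r (β + Finsupp.single r 1) := by
      have h2 := nrm_pd_ne_top hρ hf r
      unfold nrm at h2
      have h3 : Summable fun β : Fin m →₀ ℕ => ‖coeff β (pd r f) * ((ρ / 2 : ℝ≥0) : ℂ) ^ β.degree‖ := by
        rw [← tsum_enorm_ne_top_iff_summable_norm]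
        convert h2 using 4 with β
        rw [enorm_mul]
        congr 1
        rw [enorm_pow]
        congr 1
        rw [enorm_eq_nnnorm]
        congr 1
        ext; simp
      convert h3 using 2 with β
      simp only [u]
      rw [coeff_pderiv, norm_mul, norm_mul]
      simp
      left; left
      have : ((β r : ℂ) + 1) = ((β r + 1 : ℕ) : ℂ) := by push_cast; rfl
      rw [this, Complex.norm_natCast]; push_cast; rfl
    obtain ⟨a, ha⟩ := h1
    exact ⟨a, (reindex_hasSum r (u r) (fun α hα => by simp [u, hα]) a).1 ha⟩
  have hd : ∀ (α : Fin m →₀ ℕ) (x : Fin m → ℂ), x ∈ B → HasFDerivAt (fun z => coeff α f * mon z α)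
      (∑ r, (coeff α f * (α r : ℂ) * mon x (α - Finsupp.single r 1)) •
      (ContinuousLinearMap.proj r : (Fin m → ℂ) →L[ℂ] ℂ)) x := by
    intro α x _
    refine ((hasFDerivAt_mon α x).const_mul (coeff α f)).congr_fderiv ?_
    rw [Finset.smul_sum]
    refine Finset.sum_congr rfl fun r _ => ?_
    rw [smul_smul, mul_assoc]
  have hbd : ∀ (α : Fin m →₀ ℕ) (r : Fin m) (x : Fin m → ℂ), x ∈ B →
      ‖coeff α f * (α r : ℂ) * mon x (α - Finsupp.single r 1)‖ ≤ u r α := by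
    intro α r x hx
    rw [norm_mul, norm_mul, Complex.norm_natCast]
    simp only [u]
    gcongr
    have := enorm_mon_le (enorm_le_of_eball hx) (α - Finsupp.single r 1)
    rw [enorm_eq_nnnorm] at this
    exact_mod_cast this
  have key := hasFDerivAt_tsum_of_isPreconnected (𝕜 := ℂ) (u := fun α => ∑ r, u r α)
    (summable_sum fun r _ => hu r) (s := B) (Metric.isOpen_eball)
    (hB ▸ (convex_ball _ _).isPreconnected) hd
    (fun α x hx => by
      refine (norm_sum_le _ _).trans (Finset.sum_le_sum fun r _ => ?_)
      rw [norm_smul]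
      have : ‖(ContinuousLinearMap.proj r : (Fin m → ℂ) →L[ℂ] ℂ)‖ ≤ 1 :=
        ContinuousLinearMap.opNorm_le_bound _ (by norm_num) fun v => by
          simpa using norm_le_pi_norm v r
      calc _ ≤ u r α * 1 := mul_le_mul (hbd α r x hx) this (norm_nonneg _)
              ((norm_nonneg _).trans (hbd α r x hx))
        _ = _ := mul_one _)
    (x₀ := 0) (Metric.mem_eball_self (by exact_mod_cast hρ2))
    (summable_ev hf (by simp)).of_norm hz
  refine key.congr_fderiv ?_
  have h4 : ∀ r, HasSum (fun α : Fin m →₀ ℕ => (coeff α f * (α r : ℂ) * mon z (α - Finsupp.single r 1)))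
      (ev (pd r f) z) := by
    intro r
    rw [← reindex_hasSum r _ (fun α hα => by simp [hα])]
    have h5 := (summable_ev (nrm_pd_ne_top hρ hf r) (enorm_le_of_eball hz)).of_norm.hasSum
    refine HasSum.congr_fun h5 ?_
    intro β
    rw [coeff_pderiv]
    simp
  refine HasSum.tsum_eq (hasSum_sum fun r _ => ?_)
  exact (h4 r).smul_const _

theorem Conv.hasFDerivAt {f : PS m} (hf : Conv f) : ∀ᶠ z in 𝓝 0, HasFDerivAt (ev f)
    (∑ r, ev (GeoLin.pd r f) z • (ContinuousLinearMap.proj r : (Fin m → ℂ) →L[ℂ] ℂ)) z := by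
  obtain ⟨ρ, hρ, h⟩ := hf
  have : 0 < ρ / 2 := by positivity
  filter_upwards [Metric.eball_mem_nhds (0 : Fin m → ℂ) (ε := (ρ / 2 : ℝ≥0))
    (by exact_mod_cast this)] with z hz
  exact hasFDerivAt_ev hρ h hz

end
end GeoLin

open scoped BigOperators
namespace GeoLin
noncomputable section
open MvPowerSeries
open scoped ENNReal NNReal Topology

variable {m : ℕ}

/-! weights and the Euler type operator -/

def wt (μ : Fin m → ℂ) (α : Fin m →₀ ℕ) : ℂ := ∑ s, (α s : ℂ) * μ s

theorem wt_add (μ : Fin m → ℂ) (α β : Fin m →₀ ℕ) : wt μ (α + β) = wt μ α + wt μ β := by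
  simp [wt, add_mul, Finset.sum_add_distrib]

theorem wt_zero (μ : Fin m → ℂ) : wt μ 0 = 0 := by simp [wt]

theorem wt_single (μ : Fin m → ℂ) (s : Fin m) : wt μ (Finsupp.single s 1) = μ s := by
  classical
  unfold wt
  rw [Finset.sum_eq_single s]
  · simp
  · intro b _ hb; simp [hb.symm]
  · simp

def Lop (μ : Fin m → ℂ) (f : PS m) : PS m := ∑ s, C (μ s) * (X s * pd s f)

theorem coeff_X_mul_pd (s : Fin m) (f : PS m) (α : Fin m →₀ ℕ) :
    coeff α (X s * pd s f) = (α s : ℂ) * coeff α f := by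
  classical
  by_cases h : α s = 0
  · rw [h]
    rw [X, coeff_monomial_mul, if_neg]
    · simp
    · rw [Finsupp.single_le_iff]; omega
  · have hle : Finsupp.single s 1 ≤ α := by rw [Finsupp.single_le_iff]; omega
    obtain ⟨β, rfl⟩ := exists_add_of_le hle
    rw [X, coeff_monomial_mul, if_pos hle, add_tsub_cancel_left, coeff_pderiv, one_mul, add_comm β]
    simp
    ring

theorem coeff_Lop (μ : Fin m → ℂ) (f : PS m) (α : Fin m →₀ ℕ) :
    coeff α (Lop μ f) = wt μ α * coeff α f := by
  unfold Lop wt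
  rw [map_sum, Finset.sum_mul]
  refine Finset.sum_congr rfl fun s _ => ?_
  rw [coeff_C_mul, coeff_X_mul_pd]; ring

theorem Lop_add (μ : Fin m → ℂ) (f g : PS m) : Lop μ (f + g) = Lop μ f + Lop μ g := by
  ext α; simp only [coeff_Lop, map_add, mul_add]

theorem Lop_sub (μ : Fin m → ℂ) (f g : PS m) : Lop μ (f - g) = Lop μ f - Lop μ g := by
  ext α; simp only [coeff_Lop, map_sub, mul_sub]

theorem Lop_sum {ι : Type*} (μ : Fin m → ℂ) (S : Finset ι) (f : ι → PS m) :
    Lop μ (∑ i ∈ S, f i) = ∑ i ∈ S, Lop μ (f i) := by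
  ext α; simp only [coeff_Lop, map_sum, Finset.mul_sum]

theorem Lop_mul (μ : Fin m → ℂ) (f g : PS m) : Lop μ (f * g) = Lop μ f * g + f * Lop μ g := by
  unfold Lop
  rw [Finset.sum_mul, Finset.mul_sum, ← Finset.sum_add_distrib]
  refine Finset.sum_congr rfl fun s _ => ?_
  simp only [pd, Derivation.leibniz, smul_eq_mul]
  ring

theorem Lop_comm (μ ν : Fin m → ℂ) (f : PS m) : Lop μ (Lop ν f) = Lop ν (Lop μ f) := by
  ext α; simp only [coeff_Lop]; ring

theorem Lop_X (μ : Fin m → ℂ) (s : Fin m) : Lop μ (X s) = C (μ s) * X s := by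
  classical
  ext α
  rw [coeff_Lop, coeff_C_mul, coeff_X]
  split_ifs with h
  · rw [h, wt_single]
  · simp

theorem vanish.Lop {n : ℕ} {f : PS m} (μ : Fin m → ℂ) (h : vanish n f) : vanish n (Lop μ f) :=
  fun α hα => by rw [coeff_Lop, h α hα, mul_zero]

theorem vanish.pd {n : ℕ} {f : PS m} (r : Fin m) (h : vanish (n + 1) f) : vanish n (pd r f) :=
  fun α hα => by rw [coeff_pderiv, h _ (by rw [map_add, Finsupp.degree_single]; omega), zero_mul]

theorem Conv.Lop {f : PS m} (μ : Fin m → ℂ) (h : Conv f) : Conv (Lop μ f) :=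
  Conv.sum fun s _ => (conv_C _).mul ((conv_X s).mul (h.pd s))

theorem Conv.ev_Lop {f : PS m} (μ : Fin m → ℂ) (h : Conv f) :
    ∀ᶠ z in 𝓝 0, fderiv ℂ (ev f) z (fun s => μ s * z s) = ev (GeoLin.Lop μ f) z := by
  have h1 := Conv.ev_sum (S := Finset.univ) (f := fun s => C (μ s) * (X s * GeoLin.pd s f))
    (fun s _ => (conv_C _).mul ((conv_X s).mul (h.pd s)))
  have h2 : ∀ᶠ z in 𝓝 (0 : Fin m → ℂ), ∀ s, ev (X s * GeoLin.pd s f) z = ev (X s) z * ev (GeoLin.pd s f) z :=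
    Filter.eventually_all.2 fun s => (conv_X s).ev_mul (h.pd s)
  filter_upwards [h1, h2, h.hasFDerivAt] with z hz1 hz2 hz3
  unfold GeoLin.Lop
  rw [hz1, hz3.fderiv, _root_.sum_apply]
  refine Finset.sum_congr rfl fun s _ => ?_
  rw [ev_C_mul, hz2, ev_X]
  simp
  ring

/-! algebra of composition -/

section
variable {F G : PS m} {ψ : Fin m → PS m}

theorem comp_add (hF : Conv F) (hG : Conv G) (hψ : ∀ s, Conv (ψ s)) (hv : ∀ s, vanish 1 (ψ s)) :
    comp (F + G) ψ = comp F ψ + comp G ψ := by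
  refine ev_inj' ((hF.add hG).comp hψ hv) ((hF.comp hψ hv).add (hG.comp hψ hv)) ?_
  filter_upwards [(hF.add hG).ev_comp hψ hv, (hF.comp hψ hv).ev_add (hG.comp hψ hv),
    hF.ev_comp hψ hv, hG.ev_comp hψ hv, (Conv.tendsto_zero hψ hv).eventually (hF.ev_add hG)]
    with z h1 h2 h3 h4 h5
  rw [h1, h2, h3, h4, h5]

theorem comp_mul (hF : Conv F) (hG : Conv G) (hψ : ∀ s, Conv (ψ s)) (hv : ∀ s, vanish 1 (ψ s)) :
    comp (F * G) ψ = comp F ψ * comp G ψ := by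
  refine ev_inj' ((hF.mul hG).comp hψ hv) ((hF.comp hψ hv).mul (hG.comp hψ hv)) ?_
  filter_upwards [(hF.mul hG).ev_comp hψ hv, (hF.comp hψ hv).ev_mul (hG.comp hψ hv),
    hF.ev_comp hψ hv, hG.ev_comp hψ hv, (Conv.tendsto_zero hψ hv).eventually (hF.ev_mul hG)]
    with z h1 h2 h3 h4 h5
  rw [h1, h2, h3, h4, h5]

theorem comp_zero : comp (0 : PS m) ψ = 0 := by
  ext α; rw [coeff_comp]; simp

theorem comp_sum {ι : Type*} {S : Finset ι} {f : ι → PS m} (hf : ∀ i, Conv (f i))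
    (hψ : ∀ s, Conv (ψ s)) (hv : ∀ s, vanish 1 (ψ s)) :
    comp (∑ i ∈ S, f i) ψ = ∑ i ∈ S, comp (f i) ψ := by
  classical
  induction S using Finset.induction_on with
  | empty => simp [comp_zero]
  | insert a S ha ih =>
    rw [Finset.sum_insert ha, Finset.sum_insert ha, comp_add (hf a) (Conv.sum fun i _ => hf i) hψ hv, ih]

theorem comp_monomial (d : Fin m →₀ ℕ) (c : ℂ) : comp (monomial d c) ψ = C c * mpow ψ d := by
  classical
  ext α
  rw [coeff_comp, tsum_eq_single d]
  · simp
  · intro b hb; rw [coeff_monomial_ne hb, zero_mul]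

theorem mpow_single (s : Fin m) : mpow ψ (Finsupp.single s 1) = ψ s := by
  classical
  unfold mpow
  rw [Finset.prod_eq_single s]
  · simp
  · intro b _ hb; simp [hb.symm]
  · simp

theorem comp_C_mul (c : ℂ) : comp (C c * F) ψ = C c * comp F ψ := by
  ext α; rw [coeff_comp, coeff_C_mul, coeff_comp, ← tsum_mul_left]
  simp [mul_assoc]

theorem comp_X (s : Fin m) : comp (X s) ψ = ψ s := by
  rw [X, comp_monomial, mpow_single, map_one, one_mul]

theorem chain_pd (hF : Conv F) (hψ : ∀ s, Conv (ψ s)) (hv : ∀ s, vanish 1 (ψ s)) (r : Fin m) :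
    pd r (comp F ψ) = ∑ s, comp (pd s F) ψ * pd r (ψ s) := by
  have hc : ∀ s, Conv (comp (pd s F) ψ * pd r (ψ s)) := fun s =>
    ((hF.pd s).comp hψ hv).mul ((hψ s).pd r)
  refine ev_inj' ((hF.comp hψ hv).pd r) (Conv.sum fun s _ => hc s) ?_
  have e1 : ∀ᶠ z in 𝓝 (0 : Fin m → ℂ), ∀ s, ev (comp (pd s F) ψ * pd r (ψ s)) z =
      ev (comp (pd s F) ψ) z * ev (pd r (ψ s)) z :=
    Filter.eventually_all.2 fun s => ((hF.pd s).comp hψ hv).ev_mul ((hψ s).pd r)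
  have e2 : ∀ᶠ z in 𝓝 (0 : Fin m → ℂ), ∀ s, ev (comp (pd s F) ψ) z =
      ev (pd s F) (fun s => ev (ψ s) z) :=
    Filter.eventually_all.2 fun s => (hF.pd s).ev_comp hψ hv
  have e3 : ∀ᶠ z in 𝓝 (0 : Fin m → ℂ), ∀ s, HasFDerivAt (ev (ψ s))
      (∑ r, ev (pd r (ψ s)) z • (ContinuousLinearMap.proj r : (Fin m → ℂ) →L[ℂ] ℂ)) z :=
    Filter.eventually_all.2 fun s => (hψ s).hasFDerivAt
  filter_upwards [e1, e2, e3, Conv.ev_sum (S := Finset.univ) fun s _ => hc s,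
    (hF.comp hψ hv).hasFDerivAt, (Conv.tendsto_zero hψ hv).eventually hF.hasFDerivAt,
    (hF.ev_comp hψ hv).eventually_nhds] with z h1 h2 h3 h4 h5 h6 h7
  have h8 := h6.comp z (hasFDerivAt_pi.2 h3)
  have h9 := h8.congr_of_eventuallyEq h7
  have h10 := congrArg (fun T : (Fin m → ℂ) →L[ℂ] ℂ => T (Pi.single r 1)) (h5.unique h9)
  rw [h4]
  simp only [h1, h2]
  simpa [_root_.sum_apply, Pi.single_apply] using h10

theorem chain_Lop (μ : Fin m → ℂ) (hF : Conv F) (hψ : ∀ s, Conv (ψ s)) (hv : ∀ s, vanish 1 (ψ s)) :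
    Lop μ (comp F ψ) = ∑ s, comp (pd s F) ψ * Lop μ (ψ s) := by
  unfold Lop
  simp_rw [chain_pd hF hψ hv, Finset.mul_sum]
  rw [Finset.sum_comm]
  refine Finset.sum_congr rfl fun s _ => Finset.sum_congr rfl fun r _ => ?_
  ring

end

/-! expansion of real analytic functions -/

def cnt {n : ℕ} (w : Fin n → Fin m) : Fin m →₀ ℕ := ∑ i, Finsupp.single (w i) 1

theorem degree_cnt {n : ℕ} (w : Fin n → Fin m) : (cnt w).degree = n := by
  simp [cnt]

theorem mon_cnt {n : ℕ} (w : Fin n → Fin m) (z : Fin m → ℂ) : mon z (cnt w) = ∏ i, z (w i) := by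
  unfold cnt
  have : ∀ S : Finset (Fin n), mon z (∑ i ∈ S, Finsupp.single (w i) 1) = ∏ i ∈ S, z (w i) := by
    classical
    intro S
    induction S using Finset.induction_on with
    | empty => simp [mon_zero]
    | insert a S ha ih => rw [Finset.sum_insert ha, Finset.prod_insert ha, mon_add, mon_single, ih]
  exact this _

open Classical in
def collect (c : (n : ℕ) → (Fin n → Fin m) → ℂ) : PS m :=
  fun α => ∑ w : Fin α.degree → Fin m, if cnt w = α then c _ w else 0

open Classical in
theorem coeff_collect (c : (n : ℕ) → (Fin n → Fin m) → ℂ) {n : ℕ} {α : Fin m →₀ ℕ} (h : α.degree = n) :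
    coeff α (collect c) = ∑ w : Fin n → Fin m, if cnt w = α then c _ w else 0 := by
  subst h; rfl

theorem hp_collect (c : (n : ℕ) → (Fin n → Fin m) → ℂ) (n : ℕ) (z : Fin m → ℂ) :
    hp n (collect c) z = ∑ w : Fin n → Fin m, c n w * ∏ i, z (w i) := by
  classical
  unfold hp
  have : ∀ α ∈ degFin m n, coeff α (collect c) * mon z α =
      ∑ w : Fin n → Fin m, if cnt w = α then c n w * ∏ i, z (w i) else 0 := by
    intro α hα
    rw [coeff_collect c (mem_degFin.1 hα), Finset.sum_mul]
    refine Finset.sum_congr rfl fun w _ => ?_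
    split_ifs with h
    · rw [← h, mon_cnt]
    · simp
  rw [Finset.sum_congr rfl this, Finset.sum_comm]
  refine Finset.sum_congr rfl fun w _ => ?_
  rw [Finset.sum_ite_eq, if_pos (mem_degFin.2 (degree_cnt w))]

theorem nrm_eq_degree (ρ : ℝ≥0) (f : PS m) :
    nrm ρ f = ∑' n : ℕ, (∑ α ∈ degFin m n, ‖coeff α f‖ₑ) * (ρ : ℝ≥0∞) ^ n := by
  unfold nrm
  rw [← (Equiv.sigmaFiberEquiv (fun α : Fin m →₀ ℕ => α.degree)).tsum_eq, ENNReal.tsum_sigma']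
  refine tsum_congr fun n => ?_
  let e : {α : Fin m →₀ ℕ // α.degree = n} ≃ {α // α ∈ degFin m n} :=
    Equiv.subtypeEquivRight fun α => mem_degFin.symm
  rw [← e.symm.tsum_eq, Finset.sum_mul]
  rw [← Finset.tsum_subtype (degFin m n) (fun α => ‖coeff α f‖ₑ * (ρ : ℝ≥0∞) ^ n)]
  refine tsum_congr fun α => ?_
  have h2 : α.1.degree = n := mem_degFin.1 α.2
  change ‖coeff α.1 f‖ₑ * (ρ : ℝ≥0∞) ^ α.1.degree = _
  rw [h2]

theorem sum_collect_le (c : (n : ℕ) → (Fin n → Fin m) → ℂ) (n : ℕ) :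
    ∑ α ∈ degFin m n, ‖coeff α (collect c)‖ₑ ≤ ∑ w : Fin n → Fin m, ‖c n w‖ₑ := by
  classical
  have : ∀ α ∈ degFin m n, ‖coeff α (collect c)‖ₑ ≤
      ∑ w : Fin n → Fin m, if cnt w = α then ‖c n w‖ₑ else 0 := by
    intro α hα
    rw [coeff_collect c (mem_degFin.1 hα)]
    refine (enorm_sum_le _ _).trans (Finset.sum_le_sum fun w _ => ?_)
    split_ifs <;> simp
  refine (Finset.sum_le_sum this).trans ?_
  rw [Finset.sum_comm]
  refine Finset.sum_le_sum fun w _ => ?_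
  rw [Finset.sum_ite_eq, if_pos (mem_degFin.2 (degree_cnt w))]

theorem exists_series_std {f : (Fin m → ℝ) → ℂ} (hf : AnalyticAt ℝ f 0) :
    ∃ a : PS m, Conv a ∧ ∀ᶠ x in 𝓝 0, f x = ev a (ofR x) := by
  classical
  obtain ⟨pf, r, hr⟩ := hf
  let c : (n : ℕ) → (Fin n → Fin m) → ℂ := fun n w => pf n (fun i => Pi.single (w i) 1)
  have hx : ∀ n (x : Fin m → ℝ), pf n (fun _ => x) = hp n (collect c) (ofR x) := by
    intro n x
    rw [hp_collect]
    have h1 : (fun _ : Fin n => x) = fun _ : Fin n => ∑ s, x s • (Pi.single s (1 : ℝ) : Fin m → ℝ) := by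
      funext _
      exact pi_eq_sum_univ' x
    rw [h1, ContinuousMultilinearMap.map_sum]
    refine Finset.sum_congr rfl fun w _ => ?_
    rw [ContinuousMultilinearMap.map_smul_univ (pf n) (fun i => x (w i)) (fun i => Pi.single (w i) 1)]
    simp only [c, ofR_apply, Complex.real_smul]
    push_cast
    ring
  obtain ⟨t, ht0, ht⟩ : ∃ t : ℝ≥0, 0 < t ∧ (t : ℝ≥0∞) < pf.radius := by
    obtain ⟨t, h1, h2⟩ := ENNReal.lt_iff_exists_nnreal_btwn.1 (lt_of_lt_of_le hr.r_pos hr.r_le)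
    exact ⟨t, by exact_mod_cast h1, h2⟩
  obtain ⟨K, hK, hb⟩ := pf.nnnorm_mul_pow_le_of_lt_radius ht
  set ρ : ℝ≥0 := t / (2 * (m + 1)) with hρ
  have hρ0 : 0 < ρ := by positivity
  have hmρ : ((m : ℝ≥0) + 1) * ρ = t / 2 := by rw [hρ]; field_simp
  have hconv : nrm ρ (collect c) ≠ ⊤ := by
    rw [nrm_eq_degree]
    have hle : ∀ n : ℕ, (∑ α ∈ degFin m n, ‖coeff α (collect c)‖ₑ) * (ρ : ℝ≥0∞) ^ n ≤
        K * (2⁻¹ : ℝ≥0∞) ^ n := by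
      intro n
      have h1 : ∑ w : Fin n → Fin m, ‖c n w‖ₑ ≤ ((m + 1 : ℝ≥0) : ℝ≥0∞) ^ n * (‖pf n‖₊ : ℝ≥0∞) := by
        calc ∑ w : Fin n → Fin m, ‖c n w‖ₑ ≤ ∑ w : Fin n → Fin m, (‖pf n‖₊ : ℝ≥0∞) := by
              refine Finset.sum_le_sum fun w _ => ?_
              rw [enorm_eq_nnnorm]
              have h3 : ‖c n w‖ ≤ ‖pf n‖ := by
                refine ((pf n).le_opNorm _).trans ?_
                refine mul_le_of_le_one_right (norm_nonneg _) ?_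
                refine Finset.prod_le_one (fun _ _ => norm_nonneg _) fun i _ => ?_
                refine (pi_norm_le_iff_of_nonneg zero_le_one).2 fun s => ?_
                by_cases h : s = w i
                · subst h; simp
                · simp [h]
              exact_mod_cast h3
          _ = ((m : ℝ≥0) : ℝ≥0∞) ^ n * (‖pf n‖₊ : ℝ≥0∞) := by simp
          _ ≤ _ := by gcongr; exact le_self_add
      calc _ ≤ ((m + 1 : ℝ≥0) : ℝ≥0∞) ^ n * (‖pf n‖₊ : ℝ≥0∞) * (ρ : ℝ≥0∞) ^ n := by
            gcongr; exact (sum_collect_le c n).trans h1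
        _ = ((‖pf n‖₊ * ((m + 1) * ρ) ^ n : ℝ≥0) : ℝ≥0∞) := by push_cast; rw [mul_pow]; ring
        _ = ((‖pf n‖₊ * t ^ n * (2⁻¹) ^ n : ℝ≥0) : ℝ≥0∞) := by
            rw [hmρ, div_eq_mul_inv, mul_pow]; ring_nf
        _ ≤ ((K * (2⁻¹) ^ n : ℝ≥0) : ℝ≥0∞) := by gcongr; exact hb n
        _ = _ := by push_cast; congr 2
    refine ne_top_of_le_ne_top ?_ (ENNReal.tsum_le_tsum hle)
    rw [ENNReal.tsum_mul_left, ENNReal.tsum_geometric]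
    refine ENNReal.mul_ne_top (by simp) ?_
    simp
  refine ⟨collect c, ⟨ρ, hρ0, hconv⟩, ?_⟩
  have hc : Filter.Tendsto (ofR (m := m)) (𝓝 0) (𝓝 0) := by
    have := (ofR (m := m)).continuous.tendsto 0
    rwa [map_zero] at this
  filter_upwards [Metric.eball_mem_nhds (0 : Fin m → ℝ) hr.r_pos, hc.eventually (eventually_small hρ0)]
    with x hx1 hx2
  have h1 := hr.hasSum hx1
  simp only [hx, zero_add] at h1
  exact h1.unique (hasSum_hp hconv hx2)

/-- `x ↦ M x` from `ℝ^m` to `ℂ^m`. -/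
def Lm (M : Matrix (Fin m) (Fin m) ℂ) : (Fin m → ℝ) →L[ℝ] (Fin m → ℂ) :=
  LinearMap.toContinuousLinearMap ((M.mulVecLin.restrictScalars ℝ).comp (ofR (m := m)).toLinearMap)

theorem Lm_apply (M : Matrix (Fin m) (Fin m) ℂ) (x : Fin m → ℝ) : Lm M x = M.mulVec (ofR x) := rfl

theorem Lm_tendsto (M : Matrix (Fin m) (Fin m) ℂ) : Filter.Tendsto (Lm M) (𝓝 0) (𝓝 0) := by
  have := (Lm M).continuous.tendsto 0
  rwa [map_zero] at this

theorem zdense_Lm {M N : Matrix (Fin m) (Fin m) ℂ} (h : M * N = 1) : ZDense (Lm M) := by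
  intro Q hQ
  have key : ∀ z, MvPolynomial.eval z (MvPolynomial.bind₁
      (fun i => ∑ s, MvPolynomial.C (M i s) * MvPolynomial.X s) Q) = MvPolynomial.eval (M.mulVec z) Q := by
    intro z
    rw [MvPolynomial.eval, MvPolynomial.eval₂Hom_bind₁]
    congr 2
    funext i
    simp [Matrix.mulVec, dotProduct]
  have h0 := zdense_ofR _ (fun x => by rw [key]; exact hQ x)
  refine MvPolynomial.funext fun z => ?_
  have := key (N.mulVec z)
  rw [h0, Matrix.mulVec_mulVec, h, Matrix.one_mulVec] at this
  rw [← this]; simp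

theorem exists_series {M N : Matrix (Fin m) (Fin m) ℂ} (h : N * M = 1) {f : (Fin m → ℝ) → ℂ}
    (hf : AnalyticAt ℝ f 0) : ∃ a : PS m, Conv a ∧ ∀ᶠ x in 𝓝 0, f x = ev a (Lm M x) := by
  obtain ⟨a, ha, hx⟩ := exists_series_std hf
  have hc : ∀ i s, Conv (C (N i s) * X s : PS m) := fun i s => (conv_C _).mul (conv_X s)
  have hg : ∀ i, Conv (∑ s, C (N i s) * X s : PS m) := fun i => Conv.sum fun s _ => hc i s
  have hv : ∀ i, vanish 1 (∑ s, C (N i s) * X s : PS m) := fun i =>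
    vanish.sum fun s _ => (vanish_X s).mul_left _
  refine ⟨comp a (fun i => ∑ s, C (N i s) * X s), ha.comp hg hv, ?_⟩
  have e1 : ∀ᶠ z in 𝓝 (0 : Fin m → ℂ), ∀ i, ev (∑ s, C (N i s) * X s : PS m) z =
      ∑ s, ev (C (N i s) * X s : PS m) z :=
    Filter.eventually_all.2 fun i => Conv.ev_sum fun s _ => hc i s
  filter_upwards [hx, (Lm_tendsto M).eventually (ha.ev_comp hg hv), (Lm_tendsto M).eventually e1]
    with x h1 h2 h3
  rw [h1, h2]
  congr 1
  funext i
  rw [h3]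
  simp only [ev_C_mul, ev_X]
  have : N.mulVec (Lm M x) i = ofR x i := by
    rw [Lm_apply, Matrix.mulVec_mulVec, h, Matrix.one_mulVec]
  rw [← this]; rfl

end
end GeoLin

open scoped BigOperators
namespace GeoLin
noncomputable section
open MvPowerSeries
open scoped ENNReal NNReal Topology
variable {m p : ℕ}

/-- Data of the formal iteration. -/
structure Dat (m p : ℕ) where
  lam : Fin p → Fin m → ℂ
  Y : Fin p → Fin m → PS m
  mu : Fin p → (Fin m →₀ ℕ) → Fin m → ℂ
  ell : Fin p → Fin m → ℂ
  res : (Fin m →₀ ℕ) → ℂ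

abbrev Sta (m p : ℕ) := (Fin m → PS m) × (Fin p → Fin p → PS m)

namespace Dat
variable (D : Dat m p)

def psi (u : Sta m p) : Fin m → PS m := fun s => X s + u.1 s

def M (u : Sta m p) (k : Fin p) (s : Fin m) : PS m :=
  comp (D.Y k s) (psi u) + ∑ i, u.2 k i * (C (D.lam i s) * u.1 s + comp (D.Y i s) (psi u))

def mxi (N : Fin p → Fin m → PS m) (s : Fin m) : PS m := fun β => ∑ k, D.mu k β s * coeff β (N k s)

def mg (N : Fin p → Fin m → PS m) (k i : Fin p) : PS m :=
  fun δ => - (D.res δ * ∑ s, D.ell i s * coeff (δ + Finsupp.single s 1) (N k s))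

theorem coeff_mxi (N : Fin p → Fin m → PS m) (s : Fin m) (β) :
    coeff β (D.mxi N s) = ∑ k, D.mu k β s * coeff β (N k s) := rfl
theorem coeff_mg (N : Fin p → Fin m → PS m) (k i : Fin p) (δ) :
    coeff δ (D.mg N k i) = - (D.res δ * ∑ s, D.ell i s * coeff (δ + Finsupp.single s 1) (N k s)) := rfl

def step (u : Sta m p) : Sta m p := (D.mxi (D.M u), D.mg (D.M u))

structure Good (u : Sta m p) : Prop where
  xi : ∀ s, vanish 2 (u.1 s)
  g : ∀ k i, vanish 1 (u.2 k i)

theorem Good.psi {u : Sta m p} (h : Good u) (s : Fin m) : vanish 1 (psi u s) :=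
  (vanish_X s).add ((h.xi s).mono (by norm_num))

variable {D}

theorem M_vanish (hY : ∀ i s, vanish 2 (D.Y i s)) {u : Sta m p} (h : Good u) (k s) :
    vanish 2 (D.M u k s) := by
  refine (comp_vanish (hY k s) h.psi).add (vanish.sum fun i _ => ?_)
  exact (((h.xi s).mul_left _).add (comp_vanish (hY i s) h.psi)).mul_left _

theorem mxi_vanish {N : Fin p → Fin m → PS m} {n : ℕ} (h : ∀ k s, vanish n (N k s)) (s) :
    vanish n (D.mxi N s) := fun β hβ => by
  rw [coeff_mxi]
  exact Finset.sum_eq_zero fun k _ => by rw [h k s β hβ, mul_zero]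

theorem mg_vanish {N : Fin p → Fin m → PS m} {n : ℕ} (h : ∀ k s, vanish (n + 1) (N k s)) (k i) :
    vanish n (D.mg N k i) := fun β hβ => by
  rw [coeff_mg, Finset.sum_eq_zero, mul_zero, neg_zero]
  intro s _
  rw [h k s _ (by rw [map_add, Finsupp.degree_single]; omega), mul_zero]

theorem mxi_sub (N N' : Fin p → Fin m → PS m) (s) :
    D.mxi (fun k s => N k s - N' k s) s = D.mxi N s - D.mxi N' s := by
  ext β
  simp only [coeff_mxi, map_sub, mul_sub, Finset.sum_sub_distrib]

theorem mg_sub (N N' : Fin p → Fin m → PS m) (k i) :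
    D.mg (fun k s => N k s - N' k s) k i = D.mg N k i - D.mg N' k i := by
  ext β
  simp only [coeff_mg, map_sub, mul_sub, Finset.sum_sub_distrib]
  ring

theorem Good.step (hY : ∀ i s, vanish 2 (D.Y i s)) {u : Sta m p} (h : Good u) : Good (D.step u) :=
  ⟨mxi_vanish (M_vanish hY h), mg_vanish (n := 1) (M_vanish hY h)⟩

structure Near (N : ℕ) (u v : Sta m p) : Prop where
  xi : ∀ s, vanish (N + 2) (u.1 s - v.1 s)
  g : ∀ k i, vanish (N + 1) (u.2 k i - v.2 k i)

theorem vsum_sub {ι : Type*} {S : Finset ι} {n : ℕ} {f g : ι → PS m}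
    (h : ∀ i ∈ S, vanish n (f i - g i)) : vanish n (∑ i ∈ S, f i - ∑ i ∈ S, g i) := by
  rw [← Finset.sum_sub_distrib]; exact vanish.sum h

theorem M_near (hY : ∀ i s, vanish 2 (D.Y i s)) {u v : Sta m p} (hu : Good u) (hv : Good v) {N : ℕ}
    (h : Near N u v) (k s) : vanish (N + 3) (D.M u k s - D.M v k s) := by
  have hψ : ∀ t, Rel (N + 1) 1 (Dat.psi u t) (Dat.psi v t) := fun t =>
    ⟨hu.psi t, hv.psi t, by
      have : Dat.psi u t - Dat.psi v t = u.1 t - v.1 t := by simp [Dat.psi]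
      rw [this]; exact h.xi t⟩
  have hc : ∀ i, vanish (N + 3) (comp (D.Y i s) (Dat.psi u) - comp (D.Y i s) (Dat.psi v)) := fun i =>
    comp_congr (N := N + 1) (n := 2) (hY i s) hψ
  have e : D.M u k s - D.M v k s = (comp (D.Y k s) (Dat.psi u) - comp (D.Y k s) (Dat.psi v)) +
    ((∑ i, u.2 k i * (C (D.lam i s) * u.1 s + comp (D.Y i s) (Dat.psi u))) -
     (∑ i, v.2 k i * (C (D.lam i s) * v.1 s + comp (D.Y i s) (Dat.psi v)))) := by
    simp only [Dat.M]; ring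
  rw [e]
  refine (hc k).add (vsum_sub fun i _ => ?_)
  have h1 : Rel N 1 (u.2 k i) (v.2 k i) := ⟨hu.g k i, hv.g k i, h.g k i⟩
  have h2 : Rel N 2 (C (D.lam i s) * u.1 s + comp (D.Y i s) (Dat.psi u))
      (C (D.lam i s) * v.1 s + comp (D.Y i s) (Dat.psi v)) := by
    refine ⟨((hu.xi s).mul_left _).add (comp_vanish (hY i s) hu.psi),
      ((hv.xi s).mul_left _).add (comp_vanish (hY i s) hv.psi), ?_⟩
    have : C (D.lam i s) * u.1 s + comp (D.Y i s) (Dat.psi u) -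
      (C (D.lam i s) * v.1 s + comp (D.Y i s) (Dat.psi v)) = C (D.lam i s) * (u.1 s - v.1 s) +
       (comp (D.Y i s) (Dat.psi u) - comp (D.Y i s) (Dat.psi v)) := by ring
    rw [this]
    exact ((h.xi s).mul_left _).add ((hc i).mono (by omega))
  exact (h1.mul h2).2.2

theorem Near.step (hY : ∀ i s, vanish 2 (D.Y i s)) {u v : Sta m p} (hu : Good u) (hv : Good v) {N : ℕ}
    (h : Near N u v) : Near (N + 1) (D.step u) (D.step v) := by
  have hM := M_near hY hu hv h
  refine ⟨fun s => ?_, fun k i => ?_⟩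
  · have := mxi_vanish (D := D) hM s
    rw [mxi_sub] at this; exact this
  · have := mg_vanish (D := D) (n := N + 2) hM k i
    rw [mg_sub] at this; exact this

theorem Near.refl (N : ℕ) (u : Sta m p) : Near N u u :=
  ⟨fun s => by rw [sub_self]; exact vanish.zero _, fun k i => by rw [sub_self]; exact vanish.zero _⟩
theorem Near.symm {N : ℕ} {u v : Sta m p} (h : Near N u v) : Near N v u :=
  ⟨fun s => by rw [← neg_sub]; exact (h.xi s).neg, fun k i => by rw [← neg_sub]; exact (h.g k i).neg⟩
theorem Near.trans {N : ℕ} {u v w : Sta m p} (h : Near N u v) (h' : Near N v w) : Near N u w :=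
  ⟨fun s => by rw [← sub_add_sub_cancel (u.1 s) (v.1 s)]; exact (h.xi s).add (h'.xi s),
   fun k i => by rw [← sub_add_sub_cancel (u.2 k i) (v.2 k i)]; exact (h.g k i).add (h'.g k i)⟩
theorem Near.mono {N N' : ℕ} {u v : Sta m p} (h : Near N u v) (hN : N' ≤ N) : Near N' u v :=
  ⟨fun s => (h.xi s).mono (by omega), fun k i => (h.g k i).mono (by omega)⟩

variable (D)
def it (n : ℕ) : Sta m p := D.step^[n] 0
theorem it_succ (n : ℕ) : D.it (n + 1) = D.step (D.it n) := by
  simp only [it, Function.iterate_succ_apply']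

def lim : Sta m p := (fun s β => coeff β ((D.it β.degree).1 s), fun k i δ => coeff δ ((D.it δ.degree).2 k i))

variable {D}
theorem good_zero : Good (0 : Sta m p) := ⟨fun _ => vanish.zero _, fun _ _ => vanish.zero _⟩

theorem good_it (hY : ∀ i s, vanish 2 (D.Y i s)) (n : ℕ) : Good (D.it n) := by
  induction n with
  | zero => exact good_zero
  | succ n ih => rw [it_succ]; exact ih.step hY

theorem near_it_succ (hY : ∀ i s, vanish 2 (D.Y i s)) (n : ℕ) : Near n (D.it n) (D.it (n + 1)) := by
  induction n with
  | zero =>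
    have h1 := good_it hY 0
    have h2 := good_it hY 1
    exact ⟨fun s => (h1.xi s).sub (h2.xi s), fun k i => (h1.g k i).sub (h2.g k i)⟩
  | succ n ih =>
    rw [it_succ, it_succ _ (n + 1)]
    exact ih.step hY (good_it hY _) (good_it hY _)

theorem near_it (hY : ∀ i s, vanish 2 (D.Y i s)) {n n' : ℕ} (h : n ≤ n') : Near n (D.it n) (D.it n') := by
  induction n', h using Nat.le_induction with
  | base => exact Near.refl _ _
  | succ k hk ih => exact ih.trans ((near_it_succ hY k).mono hk)

theorem coeff_lim_xi (hY : ∀ i s, vanish 2 (D.Y i s)) {n : ℕ} {β : Fin m →₀ ℕ} (h : β.degree ≤ n + 1) (s) :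
    coeff β (D.lim.1 s) = coeff β ((D.it n).1 s) := by
  change coeff β ((D.it β.degree).1 s) = _
  rcases le_total β.degree n with h1 | h1
  · have := (near_it hY h1).xi s β (by omega)
    rwa [map_sub, sub_eq_zero] at this
  · have := (near_it hY h1).xi s β (by omega)
    rw [map_sub, sub_eq_zero] at this; exact this.symm

theorem coeff_lim_g (hY : ∀ i s, vanish 2 (D.Y i s)) {n : ℕ} {β : Fin m →₀ ℕ} (h : β.degree ≤ n) (k i) :
    coeff β (D.lim.2 k i) = coeff β ((D.it n).2 k i) := by
  change coeff β ((D.it β.degree).2 k i) = _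
  have := (near_it hY h).g k i β (by omega)
  rwa [map_sub, sub_eq_zero] at this

theorem near_lim (hY : ∀ i s, vanish 2 (D.Y i s)) (n : ℕ) : Near n D.lim (D.it n) :=
  ⟨fun s β hβ => by rw [map_sub, coeff_lim_xi hY (n := n) (by omega), sub_self],
   fun k i β hβ => by rw [map_sub, coeff_lim_g hY (n := n) (by omega), sub_self]⟩

theorem good_lim (hY : ∀ i s, vanish 2 (D.Y i s)) : Good D.lim :=
  ⟨fun s β hβ => by rw [coeff_lim_xi hY (n := 2) (by omega)]; exact (good_it hY 2).xi s β hβ,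
   fun k i β hβ => by rw [coeff_lim_g hY (n := 2) (by omega)]; exact (good_it hY 2).g k i β hβ⟩

theorem step_lim (hY : ∀ i s, vanish 2 (D.Y i s)) : D.step D.lim = D.lim := by
  have h : ∀ n, Near (n + 1) (D.step D.lim) D.lim := fun n => by
    have h1 := (near_lim hY n).step hY (good_lim hY) (good_it hY n)
    rw [← it_succ] at h1
    exact h1.trans (near_lim hY (n + 1)).symm
  refine Prod.ext (funext fun s => ?_) (funext fun k => funext fun i => ?_)
  · ext β
    have := (h β.degree).xi s β (by omega)
    rwa [map_sub, sub_eq_zero] at this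
  · ext β
    have := (h β.degree).g k i β (by omega)
    rwa [map_sub, sub_eq_zero] at this

theorem nrm_le_of_fin {f : PS m} {ρ : ℝ≥0} {c : ℝ≥0∞}
    (h : ∀ n, ∃ f' : PS m, nrm ρ f' ≤ c ∧ ∀ β : Fin m →₀ ℕ, β.degree ≤ n → coeff β f = coeff β f') :
    nrm ρ f ≤ c := by
  unfold nrm
  rw [ENNReal.tsum_eq_iSup_sum]
  refine iSup_le fun S => ?_
  obtain ⟨f', hf', hS⟩ := h (S.sup Finsupp.degree)
  calc ∑ β ∈ S, ‖coeff β f‖ₑ * (ρ : ℝ≥0∞) ^ β.degree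
      = ∑ β ∈ S, ‖coeff β f'‖ₑ * (ρ : ℝ≥0∞) ^ β.degree :=
        Finset.sum_congr rfl fun β hβ => by rw [hS β (Finset.le_sup hβ)]
    _ ≤ nrm ρ f' := ENNReal.sum_le_tsum S
    _ ≤ c := hf'

/-! norm bounds -/

structure Bdd (ρ η : ℝ≥0) (u : Sta m p) : Prop where
  xi : ∀ s, nrm ρ (u.1 s) ≤ (ρ * η : ℝ≥0)
  g : ∀ k i, nrm ρ (u.2 k i) ≤ (η : ℝ≥0)

theorem nrm_mxi {κ ρ : ℝ≥0} (hκ : ∀ k β s, ‖D.mu k β s‖ₑ ≤ κ) (N : Fin p → Fin m → PS m) (s) :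
    nrm ρ (D.mxi N s) ≤ ∑ k, (κ : ℝ≥0∞) * nrm ρ (N k s) := by
  unfold nrm
  simp_rw [← ENNReal.tsum_mul_left]
  rw [← Summable.tsum_finsetSum (fun _ _ => ENNReal.summable)]
  refine ENNReal.tsum_le_tsum fun β => ?_
  rw [coeff_mxi]
  calc _ ≤ (∑ k, ‖D.mu k β s * coeff β (N k s)‖ₑ) * (ρ : ℝ≥0∞) ^ β.degree := by
        gcongr; exact enorm_sum_le _ _
    _ = ∑ k, ‖D.mu k β s‖ₑ * (‖coeff β (N k s)‖ₑ * (ρ : ℝ≥0∞) ^ β.degree) := by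
        rw [Finset.sum_mul]; exact Finset.sum_congr rfl fun k _ => by rw [enorm_mul, mul_assoc]
    _ ≤ _ := by gcongr with k _; exact hκ k β s

theorem nrm_mg {ρ : ℝ≥0} (hres : ∀ δ, ‖D.res δ‖ₑ ≤ 1) (N : Fin p → Fin m → PS m) (k i) :
    (ρ : ℝ≥0∞) * nrm ρ (D.mg N k i) ≤ ∑ s, ‖D.ell i s‖ₑ * nrm ρ (N k s) := by
  have h1 : ∀ s, ∑' δ : Fin m →₀ ℕ, ‖coeff (δ + Finsupp.single s 1) (N k s)‖ₑ * (ρ : ℝ≥0∞) ^ (δ + Finsupp.single s 1).degree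
      ≤ nrm ρ (N k s) := fun s => by
    unfold nrm
    exact ENNReal.tsum_comp_le_tsum_of_injective (add_left_injective (Finsupp.single s 1))
      (fun β => ‖coeff β (N k s)‖ₑ * (ρ : ℝ≥0∞) ^ β.degree)
  calc (ρ : ℝ≥0∞) * nrm ρ (D.mg N k i)
      ≤ ∑ s, ‖D.ell i s‖ₑ * ∑' δ : Fin m →₀ ℕ, ‖coeff (δ + Finsupp.single s 1) (N k s)‖ₑ * (ρ : ℝ≥0∞) ^ (δ + Finsupp.single s 1).degree := by
        unfold nrm
        simp_rw [← ENNReal.tsum_mul_left]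
        rw [← Summable.tsum_finsetSum (fun _ _ => ENNReal.summable)]
        refine ENNReal.tsum_le_tsum fun β => ?_
        rw [coeff_mg, enorm_neg, enorm_mul]
        calc _ ≤ (ρ : ℝ≥0∞) * (1 * (∑ s, ‖D.ell i s * coeff (β + Finsupp.single s 1) (N k s)‖ₑ) * (ρ : ℝ≥0∞) ^ β.degree) := by
              gcongr
              · exact hres β
              · exact enorm_sum_le _ _
          _ = _ := by
              rw [one_mul, Finset.sum_mul, Finset.mul_sum]
              refine Finset.sum_congr rfl fun s _ => ?_
              rw [enorm_mul, map_add, Finsupp.degree_single, pow_succ]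
              ring
    _ ≤ _ := by gcongr with s _; exact h1 s

theorem nrm_M {ρ η c Λ : ℝ≥0} (hη : η ≤ 1) (hΛ : ∀ i s, ‖D.lam i s‖ₑ ≤ Λ)
    (hc : ∀ i s, nrm (2 * ρ) (D.Y i s) ≤ (c * ρ : ℝ≥0)) {u : Sta m p} (hu : Bdd ρ η u) (k s) :
    nrm ρ (D.M u k s) ≤ (ρ * (c * (1 + p) + p * Λ * η ^ 2) : ℝ≥0) := by
  have hψ : ∀ t, nrm ρ (psi u t) ≤ ((2 * ρ : ℝ≥0) : ℝ≥0∞) := fun t => by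
    refine (nrm_add _ _ _).trans ?_
    rw [nrm_X]
    calc (ρ : ℝ≥0∞) + nrm ρ (u.1 t) ≤ ((ρ : ℝ≥0) : ℝ≥0∞) + ((ρ * η : ℝ≥0) : ℝ≥0∞) := by gcongr; exact hu.xi t
      _ = ((ρ + ρ * η : ℝ≥0) : ℝ≥0∞) := by push_cast; rfl
      _ ≤ _ := by
        refine ENNReal.coe_le_coe.2 ?_
        calc ρ + ρ * η ≤ ρ + ρ * 1 := by gcongr
          _ = 2 * ρ := by ring
  have hY : ∀ i, nrm ρ (comp (D.Y i s) (psi u)) ≤ ((c * ρ : ℝ≥0) : ℝ≥0∞) := fun i =>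
    (nrm_comp _ hψ).trans (hc i s)
  calc nrm ρ (D.M u k s) ≤ ((c * ρ : ℝ≥0) : ℝ≥0∞) + ∑ i : Fin p, ((η * (Λ * (ρ * η) + c * ρ) : ℝ≥0) : ℝ≥0∞) := by
        refine (nrm_add _ _ _).trans (add_le_add (hY k) ((nrm_sum _ _ _).trans (Finset.sum_le_sum fun i _ => ?_)))
        refine (nrm_mul _ _ _).trans ?_
        rw [ENNReal.coe_mul]
        refine mul_le_mul' (hu.g k i) ((nrm_add _ _ _).trans ?_)
        rw [nrm_C_mul, ENNReal.coe_add, ENNReal.coe_mul]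
        exact add_le_add (mul_le_mul' (hΛ i s) (hu.xi s)) (hY i)
    _ = ((c * ρ + p * (η * (Λ * (ρ * η) + c * ρ)) : ℝ≥0) : ℝ≥0∞) := by
        rw [Finset.sum_const, Finset.card_univ, Fintype.card_fin, nsmul_eq_mul]; push_cast; rfl
    _ ≤ _ := by
        refine ENNReal.coe_le_coe.2 ?_
        calc c * ρ + p * (η * (Λ * (ρ * η) + c * ρ)) = c * ρ + p * Λ * ρ * η ^ 2 + η * (p * c * ρ) := by ring
          _ ≤ c * ρ + p * Λ * ρ * η ^ 2 + 1 * (p * c * ρ) := by gcongr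
          _ = _ := by ring

theorem Bdd.step {ρ η c Λ κ E : ℝ≥0} (hρ : 0 < ρ) (hη : η ≤ 1) (hΛ : ∀ i s, ‖D.lam i s‖ₑ ≤ Λ)
    (hκ : ∀ k β s, ‖D.mu k β s‖ₑ ≤ κ) (hE : ∀ i, ∑ s, ‖D.ell i s‖ₑ ≤ E) (hres : ∀ δ, ‖D.res δ‖ₑ ≤ 1)
    (hc : ∀ i s, nrm (2 * ρ) (D.Y i s) ≤ (c * ρ : ℝ≥0))
    (h1 : p * κ * (c * (1 + p) + p * Λ * η ^ 2) ≤ η) (h2 : E * (c * (1 + p) + p * Λ * η ^ 2) ≤ η)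
    {u : Sta m p} (hu : Bdd ρ η u) : Bdd ρ η (D.step u) := by
  have hM := nrm_M hη hΛ hc hu
  refine ⟨fun s => ?_, fun k i => ?_⟩
  · refine (nrm_mxi hκ _ s).trans ?_
    calc _ ≤ ∑ k : Fin p, (κ : ℝ≥0∞) * (ρ * (c * (1 + p) + p * Λ * η ^ 2) : ℝ≥0) := by
          gcongr with k _; exact hM k s
      _ = ((ρ * (p * κ * (c * (1 + p) + p * Λ * η ^ 2)) : ℝ≥0) : ℝ≥0∞) := by
          rw [Finset.sum_const, Finset.card_univ, Fintype.card_fin, nsmul_eq_mul]; push_cast; ring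
      _ ≤ _ := by refine ENNReal.coe_le_coe.2 ?_; gcongr
  · have hρ' : (ρ : ℝ≥0∞) ≠ 0 := by exact_mod_cast hρ.ne'
    rw [← ENNReal.mul_le_mul_iff_right hρ' ENNReal.coe_ne_top]
    refine (nrm_mg hres _ k i).trans ?_
    calc _ ≤ ∑ s, ‖D.ell i s‖ₑ * (ρ * (c * (1 + p) + p * Λ * η ^ 2) : ℝ≥0) := by
          gcongr with s _; exact hM k s
      _ ≤ E * ((ρ * (c * (1 + p) + p * Λ * η ^ 2) : ℝ≥0) : ℝ≥0∞) := by
          rw [← Finset.sum_mul]; gcongr; exact hE i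
      _ = ((ρ * (E * (c * (1 + p) + p * Λ * η ^ 2)) : ℝ≥0) : ℝ≥0∞) := by push_cast; ring
      _ ≤ ((ρ * η : ℝ≥0) : ℝ≥0∞) := by refine ENNReal.coe_le_coe.2 ?_; gcongr
      _ = _ := by push_cast; rfl

theorem exists_rho {ι : Type*} [Fintype ι] {f : ι → PS m} (hf : ∀ i, Conv (f i)) (hv : ∀ i, vanish 2 (f i))
    {c : ℝ≥0} (hc : 0 < c) : ∃ ρ : ℝ≥0, 0 < ρ ∧ ∀ i, nrm (2 * ρ) (f i) ≤ (c * ρ : ℝ≥0) := by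
  obtain ⟨ρ0, hρ0, h⟩ := Conv.common_fin Finset.univ (f := f) (fun i _ => hf i)
  obtain ⟨K, hK⟩ : ∃ K : ℝ≥0, ∀ i, nrm ρ0 (f i) ≤ K := by
    refine ⟨∑ i, (nrm ρ0 (f i)).toNNReal, fun i => ?_⟩
    rw [← ENNReal.coe_toNNReal (h i (Finset.mem_univ _))]
    exact ENNReal.coe_le_coe.2 (Finset.single_le_sum (f := fun i => (nrm ρ0 (f i)).toNNReal) (fun _ _ => zero_le) (Finset.mem_univ i))
  set t : ℝ≥0 := min 1 (c / 2 * ρ0 / (K + 1)) with ht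
  have ht0 : 0 < t := lt_min one_pos (by positivity)
  refine ⟨t * ρ0 / 2, by positivity, fun i => ?_⟩
  have e : 2 * (t * ρ0 / 2) = t * ρ0 := by field_simp
  rw [e]
  refine (nrm_scale (hv i) (min_le_left _ _) ρ0).trans ?_
  calc _ ≤ (t : ℝ≥0∞) ^ 2 * K := by gcongr; exact hK i
    _ = ((t * (t * K) : ℝ≥0) : ℝ≥0∞) := by push_cast; ring
    _ ≤ _ := by
      refine ENNReal.coe_le_coe.2 ?_
      calc t * (t * K) ≤ t * ((c / 2 * ρ0 / (K + 1)) * (K + 1)) := by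
            gcongr
            · exact min_le_right _ _
            · exact le_self_add
        _ = c * (t * ρ0 / 2) := by field_simp

theorem exists_bdd {Λ κ E : ℝ≥0} (hΛ : ∀ i s, ‖D.lam i s‖ₑ ≤ Λ)
    (hκ : ∀ k β s, ‖D.mu k β s‖ₑ ≤ κ) (hE : ∀ i, ∑ s, ‖D.ell i s‖ₑ ≤ E) (hres : ∀ δ, ‖D.res δ‖ₑ ≤ 1)
    (hYc : ∀ i s, Conv (D.Y i s)) (hY : ∀ i s, vanish 2 (D.Y i s)) :
    (∀ s, Conv (D.lim.1 s)) ∧ ∀ k i, Conv (D.lim.2 k i) := by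
  set B : ℝ≥0 := p * κ + E + p * Λ + 1 with hB
  have hB1 : 0 < B := by positivity
  set η : ℝ≥0 := 1 / (2 * B ^ 2 + 1) with hη
  have hη0 : 0 < η := by positivity
  have hη1 : η ≤ 1 := by rw [hη]; exact div_le_one_of_le₀ le_add_self zero_le
  set c : ℝ≥0 := η / (2 * B * (1 + p)) with hcdef
  have hc0 : 0 < c := by positivity
  have key : B * (c * (1 + p) + B * η ^ 2) ≤ η := by
    have e1 : B * (c * (1 + p)) = η / 2 := by rw [hcdef]; field_simp
    have e2 : B * (B * η ^ 2) ≤ η / 2 := by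
      have : B ^ 2 * η ≤ 1 / 2 := by
        rw [hη, mul_one_div, div_le_div_iff₀ (by positivity) (by positivity)]
        rw [one_mul, mul_comm]; exact le_self_add
      calc B * (B * η ^ 2) = (B ^ 2 * η) * η := by ring
        _ ≤ 1 / 2 * η := by gcongr
        _ = η / 2 := by ring
    calc _ = B * (c * (1 + p)) + B * (B * η ^ 2) := by ring
      _ ≤ η / 2 + η / 2 := by rw [e1]; gcongr
      _ = η := add_halves η
  have hb1 : p * κ ≤ B := by rw [hB, add_assoc, add_assoc]; exact le_self_add
  have hb2 : E ≤ B := by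
    calc E ≤ E + (p * κ + p * Λ + 1) := le_self_add
      _ = B := by rw [hB]; ring
  have hb3 : p * Λ ≤ B := by rw [hB]; exact le_trans le_add_self le_self_add
  obtain ⟨ρ, hρ, hρY⟩ := exists_rho (f := fun x : Fin p × Fin m => D.Y x.1 x.2) (fun x => hYc _ _) (fun x => hY _ _) hc0
  have hle : c * (1 + p) + p * Λ * η ^ 2 ≤ c * (1 + p) + B * η ^ 2 := by gcongr
  have hbd : ∀ n, Bdd ρ η (D.it n) := fun n => by
    induction n with
    | zero => exact ⟨fun s => by change nrm ρ 0 ≤ _; rw [nrm_zero]; exact zero_le,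
        fun k i => by change nrm ρ 0 ≤ _; rw [nrm_zero]; exact zero_le⟩
    | succ n ih =>
      rw [it_succ]
      exact ih.step hρ hη1 hΛ hκ hE hres (fun i s => hρY (i, s))
        ((mul_le_mul' hb1 hle).trans key) ((mul_le_mul' hb2 hle).trans key)
  refine ⟨fun s => ⟨ρ, hρ, ne_top_of_le_ne_top ENNReal.coe_ne_top (nrm_le_of_fin (c := ((ρ * η : ℝ≥0) : ℝ≥0∞)) fun n => ?_)⟩,
    fun k i => ⟨ρ, hρ, ne_top_of_le_ne_top ENNReal.coe_ne_top (nrm_le_of_fin (c := (η : ℝ≥0∞)) fun n => ?_)⟩⟩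
  · exact ⟨_, (hbd n).xi s, fun β hβ => coeff_lim_xi hY (by omega) s⟩
  · exact ⟨_, (hbd n).g k i, fun β hβ => coeff_lim_g hY (by omega) k i⟩

end Dat
end
end GeoLin

open scoped BigOperators
namespace GeoLin
noncomputable section
open MvPowerSeries
open scoped ENNReal NNReal Topology ComplexConjugate
variable {m p : ℕ}

def tau (σ : Equiv.Perm (Fin m)) : (Fin m →₀ ℕ) ≃+ (Fin m →₀ ℕ) := Finsupp.domCongr σ

theorem tau_apply (σ : Equiv.Perm (Fin m)) (α : Fin m →₀ ℕ) (s) : tau σ α s = α (σ.symm s) := by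
  simp [tau]

theorem tau_single (σ : Equiv.Perm (Fin m)) (s) : tau σ (Finsupp.single s 1) = Finsupp.single (σ s) 1 := by
  simp [tau]

theorem symm_apply_invol {σ : Equiv.Perm (Fin m)} (hσ : ∀ s, σ (σ s) = s) (s) : σ.symm s = σ s := by
  rw [Equiv.symm_apply_eq, hσ]

theorem tau_tau {σ : Equiv.Perm (Fin m)} (hσ : ∀ s, σ (σ s) = s) (α) : tau σ (tau σ α) = α := by
  ext s; simp only [tau_apply, symm_apply_invol hσ, hσ]

theorem degree_tau (σ : Equiv.Perm (Fin m)) (α) : (tau σ α).degree = α.degree := by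
  rw [Finsupp.degree_eq_sum, Finsupp.degree_eq_sum]
  simp only [tau_apply]
  exact Equiv.sum_comp σ.symm α

def cj (σ : Equiv.Perm (Fin m)) (f : PS m) : PS m := fun α => conj (coeff (tau σ α) f)

theorem coeff_cj (σ : Equiv.Perm (Fin m)) (f : PS m) (α) : coeff α (cj σ f) = conj (coeff (tau σ α) f) := rfl

theorem cj_add (σ : Equiv.Perm (Fin m)) (f g : PS m) : cj σ (f + g) = cj σ f + cj σ g := by
  ext α; simp [coeff_cj]

theorem cj_sub (σ : Equiv.Perm (Fin m)) (f g : PS m) : cj σ (f - g) = cj σ f - cj σ g := by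
  ext α; simp [coeff_cj]

theorem cj_zero (σ : Equiv.Perm (Fin m)) : cj σ (0 : PS m) = 0 := by
  ext α; simp [coeff_cj]

theorem cj_sum {ι : Type*} (σ : Equiv.Perm (Fin m)) (S : Finset ι) (f : ι → PS m) :
    cj σ (∑ i ∈ S, f i) = ∑ i ∈ S, cj σ (f i) := by
  ext α; simp [coeff_cj]

theorem cj_one (σ : Equiv.Perm (Fin m)) : cj σ (1 : PS m) = 1 := by
  classical
  ext α
  simp only [coeff_cj, coeff_one, EmbeddingLike.map_eq_zero_iff]
  split_ifs <;> simp

theorem cj_mul (σ : Equiv.Perm (Fin m)) (f g : PS m) : cj σ (f * g) = cj σ f * cj σ g := by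
  classical
  ext α
  rw [coeff_cj, coeff_mul, coeff_mul, map_sum]
  symm
  refine Finset.sum_bij (fun x _ => (tau σ x.1, tau σ x.2)) ?_ ?_ ?_ ?_
  · intro x hx
    rw [Finset.HasAntidiagonal.mem_antidiagonal] at hx ⊢
    rw [← map_add, hx]
  · intro x _ y _ h
    simp only [Prod.mk.injEq, EmbeddingLike.apply_eq_iff_eq] at h
    exact Prod.ext h.1 h.2
  · intro y hy
    rw [Finset.HasAntidiagonal.mem_antidiagonal] at hy
    refine ⟨((tau σ).symm y.1, (tau σ).symm y.2), ?_, by simp⟩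
    rw [Finset.HasAntidiagonal.mem_antidiagonal]
    change (tau σ).symm y.1 + (tau σ).symm y.2 = α
    rw [← map_add, hy, AddEquiv.symm_apply_apply]
  · intro x _
    rw [coeff_cj, coeff_cj, map_mul]

theorem cj_pow (σ : Equiv.Perm (Fin m)) (f : PS m) (n : ℕ) : cj σ (f ^ n) = cj σ f ^ n := by
  induction n with
  | zero => simp [cj_one]
  | succ n ih => rw [pow_succ, cj_mul, ih, pow_succ]

theorem cj_prod {ι : Type*} (σ : Equiv.Perm (Fin m)) (S : Finset ι) (f : ι → PS m) :
    cj σ (∏ i ∈ S, f i) = ∏ i ∈ S, cj σ (f i) := by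
  classical
  induction S using Finset.induction_on with
  | empty => simp [cj_one]
  | insert a S ha ih => rw [Finset.prod_insert ha, Finset.prod_insert ha, cj_mul, ih]

theorem cj_C (σ : Equiv.Perm (Fin m)) (c : ℂ) : cj σ (C c) = C (conj c) := by
  classical
  ext α
  simp only [coeff_cj, coeff_C, EmbeddingLike.map_eq_zero_iff]
  split_ifs <;> simp

theorem cj_X {σ : Equiv.Perm (Fin m)} (hσ : ∀ s, σ (σ s) = s) (s : Fin m) : cj σ (X s) = X (σ s) := by
  classical
  ext α
  simp only [coeff_cj, coeff_X]
  have : tau σ α = Finsupp.single s 1 ↔ α = Finsupp.single (σ s) 1 := by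
    rw [← tau_single]
    constructor
    · intro h; rw [← h, tau_tau hσ]
    · intro h; rw [h, tau_tau hσ]
  simp only [this]
  split_ifs <;> simp

theorem cj_mpow {σ : Equiv.Perm (Fin m)} (hσ : ∀ s, σ (σ s) = s) (ψ : Fin m → PS m) (d) :
    cj σ (mpow ψ d) = mpow (fun s => cj σ (ψ (σ s))) (tau σ d) := by
  unfold mpow
  rw [cj_prod, ← Equiv.prod_comp σ]
  refine Finset.prod_congr rfl fun s _ => ?_
  rw [cj_pow, tau_apply, symm_apply_invol hσ]

theorem cj_comp {σ : Equiv.Perm (Fin m)} (hσ : ∀ s, σ (σ s) = s) (f : PS m) (ψ : Fin m → PS m) :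
    cj σ (comp f ψ) = comp (cj σ f) (fun s => cj σ (ψ (σ s))) := by
  ext α
  rw [coeff_cj, coeff_comp, coeff_comp, Complex.conj_tsum, ← (tau σ).toEquiv.tsum_eq]
  refine tsum_congr fun d => ?_
  have h := congrArg (coeff α) (cj_mpow hσ ψ (tau σ d))
  rw [coeff_cj, tau_tau hσ] at h
  simp only [AddEquiv.toEquiv_eq_coe, AddEquiv.coe_toEquiv]
  rw [map_mul, coeff_cj, h]

theorem mon_tau {σ : Equiv.Perm (Fin m)} (hσ : ∀ s, σ (σ s) = s) {z : Fin m → ℂ} (hz : ∀ s, conj (z s) = z (σ s)) (α) :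
    mon z (tau σ α) = conj (mon z α) := by
  unfold mon
  rw [← Equiv.prod_comp σ, map_prod]
  refine Finset.prod_congr rfl fun s _ => ?_
  rw [tau_apply, symm_apply_invol hσ, hσ, map_pow, hz]

theorem ev_cj {σ : Equiv.Perm (Fin m)} (hσ : ∀ s, σ (σ s) = s) (f : PS m) {z : Fin m → ℂ} (hz : ∀ s, conj (z s) = z (σ s)) :
    ev (cj σ f) z = conj (ev f z) := by
  unfold ev
  rw [Complex.conj_tsum, ← (tau σ).toEquiv.tsum_eq]
  refine tsum_congr fun d => ?_
  simp only [AddEquiv.toEquiv_eq_coe, AddEquiv.coe_toEquiv]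
  rw [coeff_cj, tau_tau hσ, mon_tau hσ hz, map_mul]

theorem Conv.cj {σ : Equiv.Perm (Fin m)} {f : PS m} (hf : Conv f) : Conv (cj σ f) := by
  obtain ⟨ρ, h0, h⟩ := hf
  refine ⟨ρ, h0, ?_⟩
  have : nrm ρ (GeoLin.cj σ f) = nrm ρ f := by
    unfold nrm
    rw [← (tau σ).toEquiv.tsum_eq (fun α => ‖coeff α f‖ₑ * (ρ : ℝ≥0∞) ^ α.degree)]
    refine tsum_congr fun d => ?_
    simp only [AddEquiv.toEquiv_eq_coe, AddEquiv.coe_toEquiv]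
    rw [coeff_cj, degree_tau, RCLike.enorm_conj]
  rwa [this]

namespace Dat
variable {D : Dat m p}

structure Equi (D : Dat m p) (σ : Equiv.Perm (Fin m)) : Prop where
  inv : ∀ s, σ (σ s) = s
  lam : ∀ i s, conj (D.lam i s) = D.lam i (σ s)
  Y : ∀ i s, cj σ (D.Y i s) = D.Y i (σ s)
  mu : ∀ k β s, conj (D.mu k (tau σ β) s) = D.mu k β (σ s)
  ell : ∀ i s, conj (D.ell i s) = D.ell i (σ s)
  res : ∀ δ, conj (D.res (tau σ δ)) = D.res δ

structure Sym (σ : Equiv.Perm (Fin m)) (u : Sta m p) : Prop where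
  xi : ∀ s, cj σ (u.1 s) = u.1 (σ s)
  g : ∀ k i, cj σ (u.2 k i) = u.2 k i

theorem M_sym {σ : Equiv.Perm (Fin m)} (hD : Equi D σ) {u : Sta m p} (hu : Sym σ u) (k s) :
    cj σ (D.M u k s) = D.M u k (σ s) := by
  have hψ : (fun s => cj σ (psi u (σ s))) = psi u := by
    funext t
    simp only [psi]
    rw [cj_add, cj_X hD.inv, hu.xi, hD.inv]
  have hc : ∀ i, cj σ (comp (D.Y i s) (psi u)) = comp (D.Y i (σ s)) (psi u) := fun i => by
    rw [cj_comp hD.inv, hψ, hD.Y]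
  simp only [M]
  rw [cj_add, hc, cj_sum]
  congr 1
  refine Finset.sum_congr rfl fun i _ => ?_
  rw [cj_mul, cj_add, cj_mul, hc, cj_C, hD.lam, hu.g, hu.xi]

theorem Sym.step {σ : Equiv.Perm (Fin m)} (hD : Equi D σ) {u : Sta m p} (hu : Sym σ u) :
    Sym σ (D.step u) := by
  refine ⟨fun s => ?_, fun k i => ?_⟩
  · ext β
    change coeff β (cj σ (D.mxi (D.M u) s)) = coeff β (D.mxi (D.M u) (σ s))
    rw [coeff_cj, coeff_mxi, coeff_mxi, map_sum]
    refine Finset.sum_congr rfl fun k _ => ?_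
    rw [map_mul, hD.mu, ← coeff_cj, M_sym hD hu]
  · ext δ
    change coeff δ (cj σ (D.mg (D.M u) k i)) = coeff δ (D.mg (D.M u) k i)
    rw [coeff_cj, coeff_mg, coeff_mg, map_neg, map_mul, hD.res, map_sum]
    congr 2
    rw [← Equiv.sum_comp σ]
    refine Finset.sum_congr rfl fun s _ => ?_
    rw [map_mul, hD.ell, hD.inv, ← M_sym hD hu, coeff_cj, map_add, tau_single, hD.inv,
      tau_tau hD.inv, Complex.conj_conj]

theorem sym_lim {σ : Equiv.Perm (Fin m)} (hD : Equi D σ) : Sym σ D.lim := by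
  have h : ∀ n, Sym σ (D.it n) := fun n => by
    induction n with
    | zero => exact ⟨fun s => cj_zero σ, fun k i => cj_zero σ⟩
    | succ n ih => rw [it_succ]; exact ih.step hD
  refine ⟨fun s => ?_, fun k i => ?_⟩
  · ext β
    rw [coeff_cj]
    change conj (coeff _ ((D.it _).1 s)) = coeff _ ((D.it _).1 (σ s))
    rw [← (h _).xi, coeff_cj, degree_tau]
  · ext β
    rw [coeff_cj]
    change conj (coeff _ ((D.it _).2 k i)) = coeff _ ((D.it _).2 k i)
    rw [degree_tau, ← coeff_cj, (h _).g]

end Dat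
end
end GeoLin

open scoped BigOperators
namespace GeoLin
noncomputable section
open MvPowerSeries
open scoped ENNReal NNReal Topology ComplexConjugate
variable {m p q : ℕ}

theorem hp_add (n : ℕ) (f g : PS m) (z) : hp n (f + g) z = hp n f z + hp n g z := by
  simp only [hp, map_add, add_mul, Finset.sum_add_distrib]

theorem hp_sum {ι : Type*} (n : ℕ) (S : Finset ι) (f : ι → PS m) (z) :
    hp n (∑ i ∈ S, f i) z = ∑ i ∈ S, hp n (f i) z := by
  simp only [hp, map_sum, Finset.sum_mul]
  exact Finset.sum_comm

theorem hp_mul {n d : ℕ} {f g : PS m} (hf : vanish n f) (hg : vanish d g) (z) :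
    hp (n + d) (f * g) z = hp n f z * hp d g z := by
  classical
  unfold hp
  rw [Finset.sum_mul_sum, ← Finset.sum_product', ← Finset.sum_fiberwise_of_maps_to
    (t := degFin m (n + d)) (g := fun x : (Fin m →₀ ℕ) × (Fin m →₀ ℕ) => x.1 + x.2)]
  · refine Finset.sum_congr rfl fun γ hγ => ?_
    rw [mem_degFin] at hγ
    rw [coeff_mul, Finset.sum_mul]
    symm
    refine Finset.sum_subset_zero_on_sdiff ?_ ?_ ?_
    · intro x hx
      rw [Finset.mem_filter] at hx
      rw [Finset.HasAntidiagonal.mem_antidiagonal]; exact hx.2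
    · intro x hx
      rw [Finset.mem_sdiff, Finset.HasAntidiagonal.mem_antidiagonal, Finset.mem_filter, Finset.mem_product,
        mem_degFin, mem_degFin] at hx
      have hd : x.1.degree + x.2.degree = n + d := by rw [← map_add, hx.1, hγ]
      by_cases h1 : x.1.degree < n
      · rw [hf _ h1]; ring
      · by_cases h2 : x.2.degree < d
        · rw [hg _ h2]; ring
        · exact absurd ⟨⟨by omega, by omega⟩, hx.1⟩ hx.2
    · intro x hx
      rw [Finset.mem_filter] at hx
      rw [← hx.2, mon_add]; ring
  · intro x hx
    rw [Finset.mem_product, mem_degFin, mem_degFin] at hx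
    rw [mem_degFin, map_add, hx.1, hx.2]

theorem coeff_mul_X_add (f : PS m) (s : Fin m) (δ) :
    coeff (δ + Finsupp.single s 1) (f * X s) = coeff δ f := by
  rw [X_def, coeff_add_mul_monomial, mul_one]

theorem coeff_mul_X_zero (f : PS m) (s : Fin m) {β : Fin m →₀ ℕ} (h : β s = 0) :
    coeff β (f * X s) = 0 := by
  classical
  rw [X_def, coeff_mul_monomial, if_neg]
  intro hle
  have := hle s
  simp [h] at this

theorem exists_sub {β : Fin m →₀ ℕ} {s : Fin m} (h : β s ≠ 0) : ∃ δ, β = δ + Finsupp.single s 1 := by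
  refine ⟨β - Finsupp.single s 1, (tsub_add_cancel_of_le ?_).symm⟩
  rw [Finsupp.single_le_iff]; omega

theorem coeff_eq_of_vanish_sub {n : ℕ} {f g : PS m} (h : vanish n (f - g)) {α : Fin m →₀ ℕ} (hα : α.degree < n) :
    coeff α f = coeff α g := by
  have := h α hα
  rwa [map_sub, sub_eq_zero] at this

namespace Dat
variable (D : Dat m p)

def Z (i : Fin p) (s : Fin m) : PS m := C (D.lam i s) * X s + D.Y i s
def om (k : Fin p) (β : Fin m →₀ ℕ) (s : Fin m) : ℂ := wt (D.lam k) β - D.lam k s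
def hh (k i : Fin p) : PS m := (if k = i then 1 else 0) + D.lim.2 k i
def ps (s : Fin m) : PS m := psi D.lim s
def H (k : Fin p) (s : Fin m) : PS m := ∑ i, D.hh k i * comp (D.Z i s) D.ps
def r (k : Fin p) (s : Fin m) : PS m := Lop (D.lam k) (D.ps s) - D.H k s

structure Hyp (F : Fin q → PS m) (n : Fin q → ℕ) (S : Set (Fin m → ℂ)) : Prop where
  Yc : ∀ i s, Conv (D.Y i s)
  Yv : ∀ i s, vanish 2 (D.Y i s)
  comm : ∀ i j s, ∑ t, D.Z i t * pd t (D.Z j s) = ∑ t, D.Z j t * pd t (D.Z i s)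
  Fc : ∀ j, Conv (F j)
  Fv : ∀ j, vanish (n j + 1) (F j)
  FZ : ∀ i j, ∑ t, D.Z i t * pd t (F j) = 0
  ell : ∀ i j, ∑ s, D.ell i s * D.lam j s = if i = j then 1 else 0
  mu : ∀ k β s, D.mu k β s = conj (D.om k β s) / ∑ l, (Complex.normSq (D.om l β s) : ℂ)
  res1 : ∀ δ, (∀ l, wt (D.lam l) δ = 0) → D.res δ = 1
  res0 : ∀ δ, ¬ (∀ l, wt (D.lam l) δ = 0) → D.res δ = 0
  gap : ∃ κ : ℝ≥0, ∀ k β s, ‖D.mu k β s‖ₑ ≤ κ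
  dense : ∀ P : MvPolynomial (Fin m) ℂ, (∀ z ∈ S, MvPolynomial.eval z P = 0) → P = 0
  gen : ∀ z ∈ S, ∀ v : Fin m → ℂ, (∀ j, ∑ s, v s * hp (n j) (pd s (F j)) z = 0) →
    ∃ c : Fin p → ℂ, ∀ s, v s = (∑ i, c i * D.lam i s) * z s

section
variable {D} {F : Fin q → PS m} {n : Fin q → ℕ} {S : Set (Fin m → ℂ)}

theorem Hyp.res_bd (h : D.Hyp F n S) (δ) : ‖D.res δ‖ₑ ≤ 1 := by
  by_cases h1 : ∀ l, wt (D.lam l) δ = 0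
  · rw [h.res1 δ h1]; simp
  · rw [h.res0 δ h1]; simp

theorem Hyp.conv (h : D.Hyp F n S) : (∀ s, Conv (D.lim.1 s)) ∧ ∀ k i, Conv (D.lim.2 k i) := by
  obtain ⟨κ, hκ⟩ := h.gap
  refine exists_bdd (Λ := ∑ x : Fin p × Fin m, ‖D.lam x.1 x.2‖₊) (E := ∑ x : Fin p × Fin m, ‖D.ell x.1 x.2‖₊)
    ?_ hκ ?_ h.res_bd h.Yc h.Yv
  · intro i s
    exact ENNReal.coe_le_coe.2 (Finset.single_le_sum (f := fun x : Fin p × Fin m => ‖D.lam x.1 x.2‖₊)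
      (fun _ _ => zero_le) (Finset.mem_univ (i, s)))
  · intro i
    have : ∑ s, ‖D.ell i s‖ₑ = ((∑ s, ‖D.ell i s‖₊ : ℝ≥0) : ℝ≥0∞) := by push_cast; rfl
    rw [this]
    refine ENNReal.coe_le_coe.2 ?_
    rw [Fintype.sum_prod_type]
    exact Finset.single_le_sum (f := fun i => ∑ s, ‖D.ell i s‖₊) (fun _ _ => zero_le) (Finset.mem_univ i)

theorem Hyp.ps_conv (h : D.Hyp F n S) (s) : Conv (D.ps s) := (conv_X s).add (h.conv.1 s)
theorem Hyp.ps_van (h : D.Hyp F n S) (s) : vanish 1 (D.ps s) := (good_lim h.Yv).psi s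
theorem Hyp.hh_conv (h : D.Hyp F n S) (k i) : Conv (D.hh k i) := by
  refine Conv.add ?_ (h.conv.2 k i)
  split_ifs
  exacts [conv_one, conv_zero]
theorem Hyp.hh_van (h : D.Hyp F n S) (k i) : vanish 1 (D.hh k i - if k = i then 1 else 0) := by
  simp only [hh, add_sub_cancel_left]; exact (good_lim h.Yv).g k i

theorem Hyp.Z_conv (h : D.Hyp F n S) (i s) : Conv (D.Z i s) := ((conv_C _).mul (conv_X s)).add (h.Yc i s)
theorem Hyp.comp_Z (h : D.Hyp F n S) (i s) : comp (D.Z i s) D.ps = C (D.lam i s) * D.ps s + comp (D.Y i s) D.ps := by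
  rw [Z, comp_add ((conv_C _).mul (conv_X s)) (h.Yc i s) h.ps_conv h.ps_van, comp_C_mul, comp_X]

theorem Hyp.fix_xi (h : D.Hyp F n S) (s β) : coeff β (D.lim.1 s) = ∑ k, D.mu k β s * coeff β (D.M D.lim k s) := by
  conv_lhs => rw [← step_lim h.Yv]
  rfl

theorem Hyp.fix_g (h : D.Hyp F n S) (k i δ) : coeff δ (D.lim.2 k i) =
    - (D.res δ * ∑ s, D.ell i s * coeff (δ + Finsupp.single s 1) (D.M D.lim k s)) := by
  conv_lhs => rw [← step_lim h.Yv]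
  rfl

theorem Hyp.g_inv (h : D.Hyp F n S) (k i l) : Lop (D.lam l) (D.lim.2 k i) = 0 := by
  ext δ
  rw [coeff_Lop, map_zero]
  by_cases h1 : ∀ l, wt (D.lam l) δ = 0
  · rw [h1, zero_mul]
  · rw [h.fix_g, h.res0 δ h1]; ring

theorem Hyp.hh_inv (h : D.Hyp F n S) (k i l) : Lop (D.lam l) (D.hh k i) = 0 := by
  rw [hh, Lop_add, h.g_inv, add_zero]
  ext δ
  rw [coeff_Lop, map_zero]
  classical
  split_ifs
  · rw [coeff_one]
    split_ifs with h1
    · rw [h1, wt_zero, zero_mul]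
    · rw [mul_zero]
  · simp

theorem Hyp.r_eq (h : D.Hyp F n S) (k s) : D.r k s = Lop (D.lam k) (D.lim.1 s) - C (D.lam k s) * D.lim.1 s - D.M D.lim k s
    - ∑ i, C (D.lam i s) * (D.lim.2 k i * X s) := by
  have e1 : D.H k s = comp (D.Z k s) D.ps + ∑ i, D.lim.2 k i * comp (D.Z i s) D.ps := by
    simp only [H, hh, add_mul, Finset.sum_add_distrib, ite_mul, one_mul, zero_mul, Finset.sum_ite_eq,
      Finset.mem_univ, if_true]
  have e2 : ∀ i, D.lim.2 k i * comp (D.Z i s) D.ps = C (D.lam i s) * (D.lim.2 k i * X s) +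
      D.lim.2 k i * (C (D.lam i s) * D.lim.1 s + comp (D.Y i s) D.ps) := fun i => by
    rw [h.comp_Z]; simp only [ps, psi]; ring
  have e3 : D.M D.lim k s = comp (D.Y k s) D.ps +
    ∑ i, D.lim.2 k i * (C (D.lam i s) * D.lim.1 s + comp (D.Y i s) D.ps) := rfl
  rw [r, e1, Finset.sum_congr rfl fun i _ => e2 i, Finset.sum_add_distrib, h.comp_Z, e3]
  have e4 : Lop (D.lam k) (D.ps s) = C (D.lam k s) * X s + Lop (D.lam k) (D.lim.1 s) := by
    simp only [ps, psi]
    rw [Lop_add, Lop_X]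
  have e5 : D.ps s = X s + D.lim.1 s := rfl
  rw [e4, e5]; ring

theorem Hyp.r_coeff (h : D.Hyp F n S) (k s β) : coeff β (D.r k s) = D.om k β s * coeff β (D.lim.1 s) - coeff β (D.M D.lim k s)
    - ∑ i, D.lam i s * coeff β (D.lim.2 k i * X s) := by
  rw [h.r_eq]
  simp only [map_sub, map_sum, coeff_Lop, coeff_C_mul, om]
  ring

theorem normSq_sum_ne (h : D.Hyp F n S) {D : Dat m p} {β s} (hω : ¬ ∀ l, D.om l β s = 0) :
    (∑ l, (Complex.normSq (D.om l β s) : ℂ)) ≠ 0 := by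
  rw [← Complex.ofReal_sum, Complex.ofReal_ne_zero]
  intro h0
  rw [Finset.sum_eq_zero_iff_of_nonneg (fun _ _ => Complex.normSq_nonneg _)] at h0
  exact hω fun l => Complex.normSq_eq_zero.1 (h0 l (Finset.mem_univ l))

theorem Hyp.factA (h : D.Hyp F n S) {β s} (hω : ¬ ∀ l, D.om l β s = 0) : ∑ k, conj (D.om k β s) * coeff β (D.r k s) = 0 := by
  have hg : ∀ k i, coeff β (D.lim.2 k i * X s) = 0 := fun k i => by
    by_cases hβ : β s = 0
    · exact coeff_mul_X_zero _ _ hβ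
    · obtain ⟨δ, rfl⟩ := exists_sub hβ
      rw [coeff_mul_X_add, h.fix_g, h.res0 δ, zero_mul, neg_zero]
      intro h0
      exact hω fun l => by rw [om, wt_add, wt_single, h0 l]; ring
  have hN := normSq_sum_ne h hω
  simp only [h.r_coeff, hg, mul_zero, Finset.sum_const_zero, sub_zero, mul_sub, Finset.sum_sub_distrib]
  rw [h.fix_xi]
  simp only [h.mu]
  set N := ∑ l, (Complex.normSq (D.om l β s) : ℂ) with hNdef
  have e : ∑ k, conj (D.om k β s) * (D.om k β s * ∑ x, conj (D.om x β s) / N * coeff β (D.M D.lim x s)) =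
      N * ∑ x, conj (D.om x β s) / N * coeff β (D.M D.lim x s) := by
    conv_rhs => rw [hNdef, Finset.sum_mul]
    refine Finset.sum_congr rfl fun k _ => ?_
    rw [Complex.normSq_eq_conj_mul_self]; ring
  rw [e, Finset.mul_sum, sub_eq_zero]
  refine Finset.sum_congr rfl fun k _ => ?_
  field_simp

theorem Hyp.factB (h : D.Hyp F n S) {δ} (hδ : ∀ l, wt (D.lam l) δ = 0) (k j) :
    ∑ s, D.ell j s * coeff (δ + Finsupp.single s 1) (D.r k s) = 0 := by
  have ho : ∀ s, D.om k (δ + Finsupp.single s 1) s = 0 := fun s => by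
    rw [om, wt_add, wt_single, hδ]; ring
  simp only [h.r_coeff, ho, zero_mul, coeff_mul_X_add, zero_sub, mul_sub, Finset.sum_sub_distrib,
    Finset.mul_sum]
  rw [Finset.sum_comm (s := Finset.univ (α := Fin m))]
  have e : ∀ i, ∑ s, D.ell j s * (D.lam i s * coeff δ (D.lim.2 k i)) = (if j = i then 1 else 0) * coeff δ (D.lim.2 k i) := fun i => by
    rw [← h.ell, Finset.sum_mul]
    exact Finset.sum_congr rfl fun s _ => by ring
  simp only [e, ite_mul, one_mul, zero_mul, Finset.sum_ite_eq, Finset.mem_univ, if_true]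
  rw [h.fix_g, h.res1 δ hδ, one_mul, sub_neg_eq_add, ← Finset.sum_add_distrib]
  exact Finset.sum_eq_zero fun s _ => by ring

end
end Dat
end
end GeoLin

open scoped BigOperators
namespace GeoLin
noncomputable section
open MvPowerSeries
open scoped ENNReal NNReal Topology ComplexConjugate
variable {m p q : ℕ}

namespace Dat
section
variable {D : Dat m p} {F : Fin q → PS m} {n : Fin q → ℕ} {S : Set (Fin m → ℂ)}

theorem Hyp.Lps (h : D.Hyp F n S) (k s) : Lop (D.lam k) (D.ps s) = D.r k s + D.H k s := by rw [r]; ring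

theorem Hyp.comp_comm (h : D.Hyp F n S) (i j s) : ∑ t, comp (D.Z i t) D.ps * comp (pd t (D.Z j s)) D.ps =
    ∑ t, comp (D.Z j t) D.ps * comp (pd t (D.Z i s)) D.ps := by
  have e := congrArg (fun f => comp f D.ps) (h.comm i j s)
  have hc : ∀ i j s t, Conv (D.Z i t * pd t (D.Z j s)) := fun i j s t => (h.Z_conv _ _).mul ((h.Z_conv _ _).pd t)
  rw [comp_sum (hc i j s) h.ps_conv h.ps_van, comp_sum (hc j i s) h.ps_conv h.ps_van] at e
  simpa only [comp_mul (h.Z_conv _ _) ((h.Z_conv _ _).pd _) h.ps_conv h.ps_van] using e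

theorem Hyp.comp_FZ (h : D.Hyp F n S) (i j) : ∑ t, comp (D.Z i t) D.ps * comp (pd t (F j)) D.ps = 0 := by
  have e := congrArg (fun f => comp f D.ps) (h.FZ i j)
  rw [comp_sum (fun t => (h.Z_conv _ _).mul ((h.Fc j).pd t)) h.ps_conv h.ps_van, comp_zero] at e
  simpa only [comp_mul (h.Z_conv _ _) ((h.Fc j).pd _) h.ps_conv h.ps_van] using e

theorem Hyp.LH (h : D.Hyp F n S) (l k s) : Lop (D.lam l) (D.H k s) = ∑ i, ∑ t, D.hh k i * comp (pd t (D.Z i s)) D.ps * D.r l t +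
    ∑ i, ∑ j, D.hh k i * D.hh l j * ∑ t, comp (D.Z j t) D.ps * comp (pd t (D.Z i s)) D.ps := by
  rw [H, Lop_sum, ← Finset.sum_add_distrib]
  refine Finset.sum_congr rfl fun i _ => ?_
  rw [Lop_mul, h.hh_inv, zero_mul, zero_add, chain_Lop _ (h.Z_conv i s) h.ps_conv h.ps_van]
  simp only [h.Lps, H, mul_add, Finset.sum_add_distrib, Finset.mul_sum, mul_assoc]
  congr 1
  rw [Finset.sum_comm]
  exact Finset.sum_congr rfl fun j _ => Finset.sum_congr rfl fun t _ => by ring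

theorem Hyp.I1 (h : D.Hyp F n S) (l k s) : Lop (D.lam l) (D.r k s) - Lop (D.lam k) (D.r l s) =
    ∑ i, ∑ t, D.hh l i * comp (pd t (D.Z i s)) D.ps * D.r k t -
    ∑ i, ∑ t, D.hh k i * comp (pd t (D.Z i s)) D.ps * D.r l t := by
  have e := Lop_comm (D.lam l) (D.lam k) (D.ps s)
  rw [h.Lps k, h.Lps l, Lop_add, Lop_add, h.LH l k, h.LH k l] at e
  have e2 : ∑ i, ∑ j, D.hh k i * D.hh l j * ∑ t, comp (D.Z j t) D.ps * comp (pd t (D.Z i s)) D.ps =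
      ∑ i, ∑ j, D.hh l i * D.hh k j * ∑ t, comp (D.Z j t) D.ps * comp (pd t (D.Z i s)) D.ps := by
    rw [Finset.sum_comm]
    refine Finset.sum_congr rfl fun j _ => Finset.sum_congr rfl fun i _ => ?_
    rw [h.comp_comm j i s]; ring
  rw [e2] at e
  linear_combination e

theorem Hyp.pdZ_van (h : D.Hyp F n S) (i s t) : vanish 1 (comp (pd t (D.Z i s)) D.ps - C (if t = s then D.lam i s else 0)) := by
  have h1 : vanish 1 (pd t (D.Z i s) - C (if t = s then D.lam i s else 0)) := by
    have : pd t (D.Z i s) - C (if t = s then D.lam i s else 0) = pd t (D.Y i s) := by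
      have e : pd t (D.Z i s) = C (if t = s then D.lam i s else 0) + pd t (D.Y i s) := by
        ext β
        rw [coeff_pderiv, map_add, coeff_pderiv, Z, map_add, add_mul]
        congr 1
        classical
        rw [coeff_C_mul, coeff_X, coeff_C]
        by_cases hβ : β = 0
        · subst hβ
          by_cases ht : t = s
          · subst ht; simp
          · have : ¬ (Finsupp.single t 1 : Fin m →₀ ℕ) = Finsupp.single s 1 := by
              rw [Finsupp.single_left_inj one_ne_zero]; exact ht
            simp [ht, this]
        · rw [if_neg hβ, if_neg]
          · ring
          · intro h0
            apply hβ
            have := congrArg Finsupp.degree h0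
            rw [map_add, Finsupp.degree_single, Finsupp.degree_single] at this
            exact (Finsupp.degree_eq_zero_iff _).1 (by omega)
      rw [e]; ring
    rw [this]; exact (h.Yv i s).pd t
  have h2 : vanish 1 (comp (pd t (D.Z i s)) D.ps - pd t (D.Z i s)) :=
    comp_sub_vanish (n := 0) (vanish_zero_ord _) (good_lim h.Yv).xi
  have := h2.add h1
  rwa [sub_add_sub_cancel] at this

theorem Hyp.main_term (h : D.Hyp F n S) {d : ℕ} (hr : ∀ k s, vanish d (D.r k s)) (l k s) :
    vanish (d + 1) (∑ i, ∑ t, D.hh l i * comp (pd t (D.Z i s)) D.ps * D.r k t - C (D.lam l s) * D.r k s) := by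
  have e : C (D.lam l s) * D.r k s = ∑ i, ∑ t, (if l = i then 1 else 0) * C (if t = s then D.lam i s else 0) * D.r k t := by
    simp only [ite_mul, one_mul, zero_mul]
    rw [Finset.sum_eq_single l, Finset.sum_eq_single s]
    · simp
    · intro b _ hb; simp [hb]
    · simp
    · intro b _ hb; simp [hb.symm]
    · simp
  rw [e]
  refine vsum_sub fun i _ => vsum_sub fun t _ => ?_
  rw [← sub_mul]
  rw [add_comm]
  refine vanish.mul ?_ (hr k t)
  have h1 := h.hh_van l i
  have h2 := h.pdZ_van i s t
  have : D.hh l i * comp (pd t (D.Z i s)) D.ps - (if l = i then 1 else 0) * C (if t = s then D.lam i s else 0)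
    = (D.hh l i - if l = i then 1 else 0) * comp (pd t (D.Z i s)) D.ps + (if l = i then 1 else 0) *
      (comp (pd t (D.Z i s)) D.ps - C (if t = s then D.lam i s else 0)) := by ring
  rw [this]
  exact (h1.mul_right _).add (h2.mul_left _)

theorem Hyp.factC (h : D.Hyp F n S) {d : ℕ} (hr : ∀ k s, vanish d (D.r k s)) {β s} (hβ : β.degree = d)
    (hω : ¬ ∀ l, D.om l β s = 0) (k) : coeff β (D.r k s) = 0 := by
  have key : ∀ l k, D.om l β s * coeff β (D.r k s) = D.om k β s * coeff β (D.r l s) := fun l k => by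
    have e := congrArg (coeff β) (h.I1 l k s)
    have h1 := coeff_eq_of_vanish_sub (h.main_term hr l k s) (α := β) (by omega)
    have h2 := coeff_eq_of_vanish_sub (h.main_term hr k l s) (α := β) (by omega)
    rw [map_sub, map_sub, h1, h2, coeff_Lop, coeff_Lop, coeff_C_mul, coeff_C_mul] at e
    simp only [om]
    linear_combination e
  have hA := h.factA hω
  have : (∑ l, (Complex.normSq (D.om l β s) : ℂ)) * coeff β (D.r k s) = 0 := by
    rw [Finset.sum_mul, ← mul_zero (D.om k β s), ← hA, Finset.mul_sum]
    refine Finset.sum_congr rfl fun l _ => ?_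
    rw [Complex.normSq_eq_conj_mul_self, mul_assoc, key l k]; ring
  exact (mul_eq_zero.1 this).resolve_left (normSq_sum_ne h hω)

theorem Hyp.F_wt (h : D.Hyp F n S) (j i) {α : Fin m →₀ ℕ} (hα : α.degree = n j + 1) (hne : coeff α (F j) ≠ 0) : wt (D.lam i) α = 0 := by
  have e := h.FZ i j
  have e1 : ∑ t, D.Z i t * pd t (F j) = Lop (D.lam i) (F j) + ∑ t, D.Y i t * pd t (F j) := by
    rw [Lop, ← Finset.sum_add_distrib]
    exact Finset.sum_congr rfl fun t _ => by rw [Z]; ring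
  have h2 : vanish (n j + 2) (∑ t, D.Y i t * pd t (F j)) := vanish.sum fun t _ => by
    rw [add_comm]; exact (h.Yv i t).mul ((h.Fv j).pd t)
  rw [e1] at e
  have := congrArg (coeff α) e
  rw [map_add, h2 α (by omega), coeff_Lop, add_zero, map_zero] at this
  exact (mul_eq_zero.1 this).resolve_right hne

theorem Hyp.I2 (h : D.Hyp F n S) (j k) : Lop (D.lam k) (comp (F j) D.ps) = ∑ s, comp (pd s (F j)) D.ps * D.r k s := by
  rw [chain_Lop _ (h.Fc j) h.ps_conv h.ps_van]
  simp only [h.Lps, mul_add, Finset.sum_add_distrib]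
  rw [add_eq_left]
  simp only [H, Finset.mul_sum]
  rw [Finset.sum_comm]
  refine Finset.sum_eq_zero fun i _ => ?_
  have := h.comp_FZ i j
  calc _ = D.hh k i * ∑ t, comp (D.Z i t) D.ps * comp (pd t (F j)) D.ps := by
        rw [Finset.mul_sum]; exact Finset.sum_congr rfl fun t _ => by ring
    _ = 0 := by rw [this, mul_zero]

theorem Hyp.q_zero (h : D.Hyp F n S) {d : ℕ} (hr : ∀ k s, vanish d (D.r k s)) (j k) {γ : Fin m →₀ ℕ} (hγ : γ.degree = n j + d) :
    coeff γ (∑ s, pd s (F j) * D.r k s) = 0 := by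
  classical
  by_cases hw : wt (D.lam k) γ = 0
  · have e := congrArg (coeff γ) (h.I2 j k)
    rw [coeff_Lop, hw, zero_mul] at e
    rw [e]
    refine (coeff_eq_of_vanish_sub (n := n j + d + 1) (vsum_sub fun s _ => ?_) (by omega)).symm
    rw [← sub_mul, add_right_comm]
    exact (comp_sub_vanish ((h.Fv j).pd s) (good_lim h.Yv).xi).mul (hr k s)
  · rw [map_sum]
    refine Finset.sum_eq_zero fun s _ => ?_
    rw [coeff_mul]
    refine Finset.sum_eq_zero fun x hx => ?_
    rw [Finset.HasAntidiagonal.mem_antidiagonal] at hx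
    by_contra hne
    have hne1 := left_ne_zero_of_mul hne
    have hne2 := right_ne_zero_of_mul hne
    have hd : x.1.degree + x.2.degree = n j + d := by rw [← map_add, hx, hγ]
    have d1 : ¬ x.1.degree < n j := fun hlt => hne1 ((h.Fv j).pd s _ hlt)
    have d2 : ¬ x.2.degree < d := fun hlt => hne2 (hr k s _ hlt)
    rw [coeff_pderiv] at hne1
    have w1 := h.F_wt j k (by rw [map_add, Finsupp.degree_single]; omega) (left_ne_zero_of_mul hne1)
    have w2 : ∀ l, D.om l x.2 s = 0 := by
      by_contra hω
      exact hne2 (h.factC hr (by omega) hω k)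
    have w3 := w2 k
    rw [wt_add, wt_single] at w1
    rw [om] at w3
    apply hw
    rw [← hx, wt_add]
    linear_combination w1 + w3

theorem Hyp.R_gen (h : D.Hyp F n S) {d : ℕ} (hr : ∀ k s, vanish d (D.r k s)) (k) {z} (hz : z ∈ S) :
    ∃ c : Fin p → ℂ, ∀ s, hp d (D.r k s) z = (∑ i, c i * D.lam i s) * z s := by
  refine h.gen z hz (fun s => hp d (D.r k s) z) fun j => ?_
  have e : hp (n j + d) (∑ s, pd s (F j) * D.r k s) z = 0 := by
    unfold hp
    exact Finset.sum_eq_zero fun γ hγ => by rw [h.q_zero hr j k (mem_degFin.1 hγ), zero_mul]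
  rw [hp_sum] at e
  rw [← e]
  exact Finset.sum_congr rfl fun s _ => by rw [hp_mul ((h.Fv j).pd s) (hr k s)]; ring

end

def Q (D : Dat m p) (t s : Fin m) : ℂ := (if t = s then 1 else 0) - ∑ i, D.lam i t * D.ell i s

def oth (s : Fin m) : Fin m →₀ ℕ := ∑ t ∈ Finset.univ.erase s, Finsupp.single t 1

theorem oth_add (s : Fin m) : oth s + Finsupp.single s 1 = ∑ t, Finsupp.single t 1 :=
  Finset.sum_erase_add _ _ (Finset.mem_univ s)

theorem oth_apply (s t : Fin m) : oth s t = if s = t then 0 else 1 := by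
  have := congrArg (fun f : Fin m →₀ ℕ => f t) (oth_add s)
  simp only [Finsupp.add_apply, Finsupp.finsetSum_apply] at this
  rw [Finset.sum_eq_single t] at this
  · by_cases hs : s = t
    · subst hs; simp at this ⊢; exact this
    · simp [hs] at this ⊢; exact this
  · intro b _ hb; simp [hb]
  · simp

theorem mon_oth (z : Fin m → ℂ) (s) : z s * mon z (oth s) = ∏ t, z t := by
  rw [← mon_single z s, ← mon_add, add_comm, oth_add, mon]
  refine Finset.prod_congr rfl fun t _ => ?_
  rw [Finsupp.finsetSum_apply, Finset.sum_eq_single t]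
  · simp
  · intro b _ hb; simp [hb]
  · simp

section
variable {D : Dat m p} {F : Fin q → PS m} {n : Fin q → ℕ} {S : Set (Fin m → ℂ)}

open Classical in
theorem Hyp.poly (h : D.Hyp F n S) {d : ℕ} (hr : ∀ k s, vanish d (D.r k s)) (k t γ) :
    ∑ s, ∑ β ∈ degFin m d, (if β + oth s = γ then D.Q t s * coeff β (D.r k s) else 0) = 0 := by
  set P : MvPolynomial (Fin m) ℂ := ∑ s, ∑ β ∈ degFin m d, MvPolynomial.monomial (β + oth s) (D.Q t s * coeff β (D.r k s)) with hP
  have hev : ∀ z ∈ S, MvPolynomial.eval z P = 0 := fun z hz => by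
    obtain ⟨c, hc⟩ := h.R_gen hr k hz
    have e1 : MvPolynomial.eval z P = ∑ s, D.Q t s * hp d (D.r k s) z * mon z (oth s) := by
      rw [hP, map_sum]
      refine Finset.sum_congr rfl fun s _ => ?_
      rw [map_sum, hp, Finset.mul_sum, Finset.sum_mul]
      refine Finset.sum_congr rfl fun β _ => ?_
      rw [MvPolynomial.eval_monomial, Finsupp.prod_fintype _ _ (fun _ => pow_zero _)]
      change _ * mon z (β + oth s) = _
      rw [mon_add]; ring
    have e2 : ∀ i, ∑ s, D.Q t s * D.lam i s = 0 := fun i => by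
      simp only [Q, sub_mul, Finset.sum_sub_distrib, ite_mul, one_mul, zero_mul, Finset.sum_ite_eq,
        Finset.mem_univ, if_true, Finset.sum_mul]
      rw [Finset.sum_comm]
      have : ∀ j, ∑ s, D.lam j t * D.ell j s * D.lam i s = D.lam j t * if j = i then 1 else 0 := fun j => by
        rw [← h.ell, Finset.mul_sum]; exact Finset.sum_congr rfl fun s _ => by ring
      simp [this]
    rw [e1]
    calc _ = ∑ s, ∑ i, (c i * ∏ t, z t) * (D.Q t s * D.lam i s) := by
          refine Finset.sum_congr rfl fun s _ => ?_
          rw [hc, ← mon_oth z s, Finset.sum_mul, Finset.mul_sum, Finset.sum_mul]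
          exact Finset.sum_congr rfl fun i _ => by ring
      _ = 0 := by
          rw [Finset.sum_comm]
          exact Finset.sum_eq_zero fun i _ => by rw [← Finset.mul_sum, e2, mul_zero]
  have := congrArg (MvPolynomial.coeff γ) (h.dense P hev)
  rw [hP] at this
  simpa only [MvPolynomial.coeff_sum, MvPolynomial.coeff_monomial, MvPolynomial.coeff_zero] using this

theorem Hyp.r_succ (h : D.Hyp F n S) {d : ℕ} (hr : ∀ k s, vanish d (D.r k s)) (k s0) : vanish (d + 1) (D.r k s0) := by
  classical
  intro β0 hβ0
  by_cases hlt : β0.degree < d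
  · exact hr k s0 _ hlt
  have hd : β0.degree = d := by omega
  by_cases hω : ∀ l, D.om l β0 s0 = 0
  swap
  · exact h.factC hr hd hω k
  by_cases hz : β0 s0 = 0
  · -- case without the variable
    have hQ : ∀ t, D.Q t s0 * coeff β0 (D.r k s0) = 0 := fun t => by
      have e := h.poly hr k t (β0 + oth s0)
      rw [Finset.sum_eq_single s0, Finset.sum_eq_single β0, if_pos rfl] at e
      · exact e
      · intro b _ hb; rw [if_neg]; intro h0; exact hb (add_right_cancel h0)
      · intro hn; exact absurd (mem_degFin.2 hd) hn
      · intro s _ hs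
        refine Finset.sum_eq_zero fun β _ => if_neg fun h0 => ?_
        have := congrArg (fun f : Fin m →₀ ℕ => f s0) h0
        simp [oth_apply, hz, hs] at this
      · simp
    by_contra hne
    have hQ' : ∀ t, D.Q t s0 = 0 := fun t => (mul_eq_zero.1 (hQ t)).resolve_right hne
    have e : ∑ t, ((β0 t : ℂ) - if t = s0 then 1 else 0) * D.Q t s0 = 0 :=
      Finset.sum_eq_zero fun t _ => by rw [hQ', mul_zero]
    have e2 : ∑ t, ((β0 t : ℂ) - if t = s0 then 1 else 0) * D.Q t s0 =
        ((β0 s0 : ℂ) - 1) - ∑ i, D.om i β0 s0 * D.ell i s0 := by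
      simp only [Q, mul_sub, Finset.sum_sub_distrib]
      congr 1
      · simp
      · simp only [Finset.mul_sum]
        rw [Finset.sum_comm]
        refine Finset.sum_congr rfl fun i _ => ?_
        rw [om, wt, sub_mul, Finset.sum_mul]
        simp only [sub_mul, Finset.sum_sub_distrib, ite_mul, one_mul, zero_mul, Finset.sum_ite_eq',
          Finset.mem_univ, if_true]
        congr 1
        exact Finset.sum_congr rfl fun t _ => by ring
    rw [e2] at e
    simp [hω, hz] at e
  · obtain ⟨δ, rfl⟩ := exists_sub hz
    have hδ : ∀ l, wt (D.lam l) δ = 0 := fun l => by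
      have := hω l
      rw [om, wt_add, wt_single] at this
      linear_combination this
    have hB := fun i => h.factB hδ k i
    have hQ : ∑ s, D.Q s0 s * coeff (δ + Finsupp.single s 1) (D.r k s) = 0 := by
      have e := h.poly hr k s0 (δ + ∑ t, Finsupp.single t 1)
      rw [← e]
      refine Finset.sum_congr rfl fun s _ => ?_
      rw [Finset.sum_eq_single (δ + Finsupp.single s 1), if_pos]
      · rw [add_assoc, add_comm _ (oth s), oth_add]
      · intro b _ hb
        rw [if_neg]
        intro h0
        rw [← oth_add s, add_comm (oth s), ← add_assoc] at h0
        exact hb (add_right_cancel h0)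
      · intro hn
        refine absurd (mem_degFin.2 ?_) hn
        rw [← hd, map_add, map_add, Finsupp.degree_single, Finsupp.degree_single]
    simp only [Q, sub_mul, Finset.sum_sub_distrib, ite_mul, one_mul, zero_mul, Finset.sum_ite_eq,
        Finset.mem_univ, if_true, Finset.sum_mul] at hQ
    rw [Finset.sum_comm] at hQ
    rw [sub_eq_zero] at hQ
    rw [hQ]
    refine Finset.sum_eq_zero fun i _ => ?_
    rw [← mul_zero (D.lam i s0), ← hB i, Finset.mul_sum]
    exact Finset.sum_congr rfl fun s _ => by ring

theorem Hyp.r_zero (h : D.Hyp F n S) (k s) : D.r k s = 0 := by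
  have : ∀ d k s, vanish d (D.r k s) := fun d => by
    induction d with
    | zero => exact fun k s => vanish_zero_ord _
    | succ d ih => exact h.r_succ ih
  ext β
  exact this (β.degree + 1) k s β (by omega)

theorem Hyp.final (h : D.Hyp F n S) (k s) : Lop (D.lam k) (D.ps s) = ∑ i, D.hh k i * comp (D.Z i s) D.ps := by
  rw [h.Lps, h.r_zero, zero_add, H]

end
end Dat
end
end GeoLin

open scoped BigOperators
namespace GeoLin
noncomputable section
open MvPowerSeries
open scoped ENNReal NNReal Topology ComplexConjugate
variable {m p q : ℕ}

section eig
variable (B : Fin p → Matrix (Fin m) (Fin m) ℂ)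

def Eig : Set (Fin m → ℂ) := {v | ∃ χ : Fin p → ℂ, ∀ k, (B k).mulVec v = χ k • v}

theorem diag_gen {M P Q : Matrix (Fin m) (Fin m) ℂ} {d : Fin m → ℂ} (hPQ : P * Q = 1) (hQP : Q * P = 1)
    (hM : M = P * Matrix.diagonal d * Q) (μ : ℂ) (v : Fin m → ℂ)
    (hv : v ∈ Module.End.maxGenEigenspace (Matrix.toLin' M) μ) : M.mulVec v = μ • v := by
  rw [Module.End.mem_maxGenEigenspace] at hv
  obtain ⟨n, hn⟩ := hv
  have key : ∀ (n : ℕ) (w : Fin m → ℂ), ((Matrix.toLin' M - μ • 1 : Module.End ℂ (Fin m → ℂ)) ^ n) w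
      = P.mulVec (fun s => (d s - μ) ^ n * (Q.mulVec w) s) := by
    intro n
    induction n with
    | zero => intro w; simp [hPQ]
    | succ n ih =>
      intro w
      rw [pow_succ, Module.End.mul_apply, ih]
      congr 1
      funext s
      have : Q.mulVec ((Matrix.toLin' M - μ • 1 : Module.End ℂ (Fin m → ℂ)) w) = fun s => (d s - μ) * (Q.mulVec w) s := by
        rw [LinearMap.sub_apply, Matrix.toLin'_apply, LinearMap.smul_apply, Module.End.one_apply,
          Matrix.mulVec_sub, Matrix.mulVec_smul, hM, Matrix.mulVec_mulVec, ← mul_assoc, ← mul_assoc, hQP,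
          one_mul]
        funext s
        rw [← Matrix.mulVec_mulVec, Pi.sub_apply, Matrix.mulVec_diagonal, Pi.smul_apply, smul_eq_mul]; ring
      rw [this]; ring
  have h0 : ∀ s, (d s - μ) ^ n * (Q.mulVec v) s = 0 := by
    rw [key] at hn
    have := congrArg Q.mulVec hn
    rw [Matrix.mulVec_mulVec, hQP, Matrix.one_mulVec, Matrix.mulVec_zero] at this
    exact fun s => congrFun this s
  have h1 : ((Matrix.toLin' M - μ • 1 : Module.End ℂ (Fin m → ℂ)) ^ 1) v = 0 := by
    rw [key]
    have : (fun s => (d s - μ) ^ 1 * (Q.mulVec v) s) = 0 := by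
      funext s
      rcases mul_eq_zero.1 (h0 s) with h | h
      · rw [eq_zero_of_pow_eq_zero h]; simp
      · simp [h]
    rw [this, Matrix.mulVec_zero]
  rw [pow_one, LinearMap.sub_apply, Matrix.toLin'_apply, LinearMap.smul_apply, Module.End.one_apply,
    sub_eq_zero] at h1
  exact h1

theorem diag_top {M P Q : Matrix (Fin m) (Fin m) ℂ} {d : Fin m → ℂ} (hPQ : P * Q = 1) (hQP : Q * P = 1)
    (hM : M = P * Matrix.diagonal d * Q) : ⨆ μ, Module.End.maxGenEigenspace (Matrix.toLin' M) μ = ⊤ := by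
  rw [eq_top_iff]
  intro v _
  have hv : v = ∑ s, (Q.mulVec v) s • P.col s := by
    have : v = P.mulVec (Q.mulVec v) := by rw [Matrix.mulVec_mulVec, hPQ, Matrix.one_mulVec]
    conv_lhs => rw [this]
    funext a
    simp [Matrix.mulVec, dotProduct, Matrix.col, mul_comm]
  rw [hv]
  refine Submodule.sum_mem _ fun s _ => Submodule.smul_mem _ _ ?_
  refine Submodule.mem_iSup_of_mem (d s) ?_
  rw [Module.End.mem_maxGenEigenspace]
  refine ⟨1, ?_⟩
  rw [pow_one, LinearMap.sub_apply, Matrix.toLin'_apply, LinearMap.smul_apply, Module.End.one_apply,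
    sub_eq_zero]
  have hMP : M * P = P * Matrix.diagonal d := by rw [hM, mul_assoc, hQP, mul_one]
  have := congrArg (fun R : Matrix (Fin m) (Fin m) ℂ => R.col s) hMP
  funext a
  have := congrFun this a
  simp only [Matrix.col, Matrix.transpose_apply, Matrix.mul_diagonal] at this
  rw [Matrix.mul_apply] at this
  simp only [Matrix.mulVec, dotProduct, Matrix.col, Matrix.transpose_apply, Pi.smul_apply, smul_eq_mul]
  rw [this]; ring

theorem span_Eig (hc : ∀ i j, B i * B j = B j * B i)
    (hd : ∀ i, ∃ P Q : Matrix (Fin m) (Fin m) ℂ, ∃ d, P * Q = 1 ∧ Q * P = 1 ∧ B i = P * Matrix.diagonal d * Q) :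
    Submodule.span ℂ (Eig B) = ⊤ := by
  have h := Module.End.iSup_iInf_maxGenEigenspace_eq_top_of_iSup_maxGenEigenspace_eq_top_of_commute
    (fun i => Matrix.toLin' (B i)) (by
      intro i j _
      change _ * _ = _ * _
      rw [Module.End.mul_eq_comp, Module.End.mul_eq_comp, ← Matrix.toLin'_mul, ← Matrix.toLin'_mul, hc])
    (fun i => by
      obtain ⟨P, Q, d, h1, h2, h3⟩ := hd i
      exact diag_top h1 h2 h3)
  rw [eq_top_iff, ← h]
  refine iSup_le fun χ => ?_
  intro v hv
  refine Submodule.subset_span ⟨χ, fun k => ?_⟩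
  obtain ⟨P, Q, d, h1, h2, h3⟩ := hd k
  rw [Submodule.mem_iInf] at hv
  exact diag_gen h1 h2 h3 _ _ (hv k)

structure GoodB (T : Finset (Fin m → ℂ)) : Prop where
  eig : ∀ v ∈ T, v ∈ Eig B
  star : ∀ v ∈ T, star v ∈ T
  ind : LinearIndepOn ℂ id (T : Set (Fin m → ℂ))

variable {B}

theorem star_mulVec_real (hB : ∀ k a b, conj (B k a b) = B k a b) (k) (v : Fin m → ℂ) :
    (B k).mulVec (star v) = star ((B k).mulVec v) := by
  funext a
  simp [Matrix.mulVec, dotProduct, hB]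

theorem star_span {T : Finset (Fin m → ℂ)} (hT : GoodB B T) {v : Fin m → ℂ}
    (hv : v ∈ Submodule.span ℂ (T : Set (Fin m → ℂ))) : star v ∈ Submodule.span ℂ (T : Set (Fin m → ℂ)) := by
  induction hv using Submodule.span_induction with
  | mem x hx => exact Submodule.subset_span (hT.star x hx)
  | zero => simp
  | add x y _ _ h1 h2 => rw [star_add]; exact add_mem h1 h2
  | smul a x _ h => rw [star_smul]; exact Submodule.smul_mem _ _ h

theorem inv_span {T : Finset (Fin m → ℂ)} (hT : GoodB B T) (k) {v : Fin m → ℂ}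
    (hv : v ∈ Submodule.span ℂ (T : Set (Fin m → ℂ))) :
    (B k).mulVec v ∈ Submodule.span ℂ (T : Set (Fin m → ℂ)) := by
  induction hv using Submodule.span_induction with
  | mem x hx =>
    obtain ⟨χ, h⟩ := hT.eig x hx
    rw [h]; exact Submodule.smul_mem _ _ (Submodule.subset_span hx)
  | zero => simp
  | add x y _ _ h1 h2 => rw [Matrix.mulVec_add]; exact add_mem h1 h2
  | smul a x _ h => rw [Matrix.mulVec_smul]; exact Submodule.smul_mem _ _ h

theorem star_eig (hB : ∀ k a b, conj (B k a b) = B k a b) {v : Fin m → ℂ} {χ : Fin p → ℂ}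
    (h : ∀ k, (B k).mulVec v = χ k • v) (k) : (B k).mulVec (star v) = conj (χ k) • star v := by
  rw [star_mulVec_real hB, h, star_smul]; rfl

theorem extendB (hB : ∀ k a b, conj (B k a b) = B k a b) {T : Finset (Fin m → ℂ)} (hT : GoodB B T)
    {v : Fin m → ℂ} (hv : v ∈ Eig B) (hn : v ∉ Submodule.span ℂ (T : Set (Fin m → ℂ))) :
    ∃ T', GoodB B T' ∧ T.card < T'.card := by
  classical
  obtain ⟨χ, hχ⟩ := hv
  have hs := star_eig hB hχ
  by_cases hr : ∀ k, conj (χ k) = χ k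
  · have : ∃ w, star w = w ∧ (∀ k, (B k).mulVec w = χ k • w) ∧ w ∉ Submodule.span ℂ (T : Set (Fin m → ℂ)) := by
      by_cases h1 : v + star v ∈ Submodule.span ℂ (T : Set (Fin m → ℂ))
      · refine ⟨Complex.I • (v - star v), ?_, ?_, ?_⟩
        · funext s; simp; ring
        · intro k
          rw [Matrix.mulVec_smul, Matrix.mulVec_sub, hs, hr, hχ, ← smul_sub, smul_comm]
        · intro h2
          apply hn
          have : v = (1/2 : ℂ) • ((v + star v) + (-Complex.I) • (Complex.I • (v - star v))) := by
            rw [smul_smul]; funext s; simp; ring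
          rw [this]
          exact Submodule.smul_mem _ _ (add_mem h1 (Submodule.smul_mem _ _ h2))
      · refine ⟨v + star v, ?_, ?_, h1⟩
        · rw [star_add, star_star, add_comm]
        · intro k
          rw [Matrix.mulVec_add, hs, hr, hχ, smul_add]
    obtain ⟨w, w1, w2, w3⟩ := this
    refine ⟨insert w T, ⟨?_, ?_, ?_⟩, ?_⟩
    · intro u hu
      rcases Finset.mem_insert.1 hu with rfl | hu
      · exact ⟨χ, w2⟩
      · exact hT.eig u hu
    · intro u hu
      rcases Finset.mem_insert.1 hu with rfl | hu
      · rw [w1]; exact Finset.mem_insert_self _ _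
      · exact Finset.mem_insert_of_mem (hT.star u hu)
    · rw [Finset.coe_insert]
      exact hT.ind.id_insert w3
    · rw [Finset.card_insert_of_notMem (fun h => w3 (Submodule.subset_span h))]; omega
  · push Not at hr
    obtain ⟨k, hk⟩ := hr
    have hn2 : star v ∉ Submodule.span ℂ (insert v (T : Set (Fin m → ℂ))) := by
      intro h
      rw [Submodule.mem_span_insert] at h
      obtain ⟨a, b, hb, hab⟩ := h
      have h1 : (conj (χ k) - χ k) • star v = (B k).mulVec b - χ k • b := by
        have := hs k
        rw [sub_smul, ← this, hab, Matrix.mulVec_add, Matrix.mulVec_smul, hχ, smul_add, smul_comm]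
        abel
      have h2 : (conj (χ k) - χ k) • star v ∈ Submodule.span ℂ (T : Set (Fin m → ℂ)) := by
        rw [h1]; exact sub_mem (inv_span hT k hb) (Submodule.smul_mem _ _ hb)
      rw [Submodule.smul_mem_iff _ (sub_ne_zero.2 hk)] at h2
      have := star_span hT h2
      rw [star_star] at this
      exact hn this
    refine ⟨insert (star v) (insert v T), ⟨?_, ?_, ?_⟩, ?_⟩
    · intro u hu
      rcases Finset.mem_insert.1 hu with rfl | hu
      · exact ⟨_, hs⟩
      rcases Finset.mem_insert.1 hu with rfl | hu
      · exact ⟨χ, hχ⟩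
      · exact hT.eig u hu
    · intro u hu
      rcases Finset.mem_insert.1 hu with rfl | hu
      · rw [star_star]; simp
      rcases Finset.mem_insert.1 hu with rfl | hu
      · simp
      · exact Finset.mem_insert_of_mem (Finset.mem_insert_of_mem (hT.star u hu))
    · rw [Finset.coe_insert, Finset.coe_insert]
      exact (hT.ind.id_insert hn).id_insert hn2
    · rw [Finset.card_insert_of_notMem, Finset.card_insert_of_notMem (fun h => hn (Submodule.subset_span h))]
      · omega
      · intro h; rw [← Finset.mem_coe, Finset.coe_insert] at h; exact hn2 (Submodule.subset_span h)

theorem exists_goodB (hB : ∀ k a b, conj (B k a b) = B k a b) (hsp : Submodule.span ℂ (Eig B) = ⊤) :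
    ∃ T, GoodB B T ∧ Submodule.span ℂ (T : Set (Fin m → ℂ)) = ⊤ := by
  classical
  by_contra! hne
  have : ∀ n : ℕ, ∃ T, GoodB B T ∧ n ≤ T.card := by
    intro n
    induction n with
    | zero => exact ⟨∅, ⟨by simp, by simp, by simp⟩, by simp⟩
    | succ n ih =>
      obtain ⟨T, hT, hc⟩ := ih
      have h1 := hne T hT
      have : ∃ v ∈ Eig B, v ∉ Submodule.span ℂ (T : Set (Fin m → ℂ)) := by
        by_contra! h
        apply h1
        rw [eq_top_iff, ← hsp]
        exact Submodule.span_le.2 h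
      obtain ⟨v, hv, hn⟩ := this
      obtain ⟨T', h, h'⟩ := extendB hB hT hv hn
      exact ⟨T', h, by omega⟩
  obtain ⟨T, hT, hc⟩ := this (m + 1)
  have := (show LinearIndependent ℂ (fun v : T => (v : Fin m → ℂ)) from hT.ind).fintype_card_le_finrank
  simp at this
  omega

theorem exists_eigenbasis (A : Fin p → Matrix (Fin m) (Fin m) ℝ) (hc : ∀ i j, A i * A j = A j * A i)
    (hd : ∀ i, ∃ P : Matrix (Fin m) (Fin m) ℂ, IsUnit P ∧ ∃ d : Fin m → ℂ,
      (A i).map (algebraMap ℝ ℂ) = P * Matrix.diagonal d * P⁻¹) :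
    ∃ (P N : Matrix (Fin m) (Fin m) ℂ) (lam : Fin p → Fin m → ℂ) (σ : Equiv.Perm (Fin m)),
      P * N = 1 ∧ N * P = 1 ∧ (∀ s, σ (σ s) = s) ∧ (∀ a s, conj (P a s) = P a (σ s)) ∧
      (∀ a s, conj (N s a) = N (σ s) a) ∧ (∀ k s, conj (lam k s) = lam k (σ s)) ∧
      ∀ k, (A k).map (algebraMap ℝ ℂ) * P = P * Matrix.diagonal (lam k) := by
  classical
  set B : Fin p → Matrix (Fin m) (Fin m) ℂ := fun k => (A k).map (algebraMap ℝ ℂ) with hBdef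
  have hB : ∀ k a b, conj (B k a b) = B k a b := by intro k a b; simp [hBdef]
  have hsp : Submodule.span ℂ (Eig B) = ⊤ := by
    apply span_Eig
    · intro i j
      simp only [hBdef, ← Matrix.map_mul, hc i j]
    · intro i
      obtain ⟨P, hP, d, h⟩ := hd i
      rw [Matrix.isUnit_iff_isUnit_det] at hP
      exact ⟨P, P⁻¹, d, Matrix.mul_nonsing_inv _ hP, Matrix.nonsing_inv_mul _ hP, h⟩
  obtain ⟨T, hT, hTs⟩ := exists_goodB hB hsp
  have hTi : LinearIndependent ℂ (fun v : T => (v : Fin m → ℂ)) := hT.ind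
  let b : Module.Basis T ℂ (Fin m → ℂ) := Module.Basis.mk hTi (by
    rw [Subtype.range_coe_subtype]; simp [hTs])
  have hcard : Fintype.card T = Fintype.card (Fin m) := by
    have := Module.finrank_eq_card_basis b
    rw [← this]; simp
  let e : T ≃ Fin m := Fintype.equivOfCardEq hcard
  let b' := b.reindex e
  have hb' : ∀ s, b' s = ((e.symm s : T) : Fin m → ℂ) := by
    intro s; simp [b', b]
  let st : Equiv.Perm T := ⟨fun v => ⟨star v.1, hT.star _ v.2⟩, fun v => ⟨star v.1, hT.star _ v.2⟩,
    fun v => Subtype.ext (star_star _), fun v => Subtype.ext (star_star _)⟩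
  let σ : Equiv.Perm (Fin m) := (e.symm.trans st).trans e
  have hσ : ∀ s, b' (σ s) = star (b' s) := by
    intro s; rw [hb', hb']; simp [σ, st]
  have hσσ : ∀ s, σ (σ s) = s := by
    intro s; apply b'.injective; rw [hσ, hσ, star_star]
  have hE : ∀ s, ∃ χ : Fin p → ℂ, ∀ k, (B k).mulVec (b' s) = χ k • b' s := by
    intro s; rw [hb']; exact hT.eig _ (e.symm s).2
  choose χ hχ using hE
  let P : Matrix (Fin m) (Fin m) ℂ := Matrix.of fun a s => b' s a
  have hPeq : P = (Pi.basisFun ℂ (Fin m)).toMatrix b' := by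
    ext a s; simp [P, Module.Basis.toMatrix_apply]
  let N : Matrix (Fin m) (Fin m) ℂ := b'.toMatrix (Pi.basisFun ℂ (Fin m))
  have h1 : P * N = 1 := by rw [hPeq]; exact Module.Basis.toMatrix_mul_toMatrix_flip _ _
  have h2 : N * P = 1 := by rw [hPeq]; exact Module.Basis.toMatrix_mul_toMatrix_flip _ _
  have hPc : ∀ a s, conj (P a s) = P a (σ s) := by
    intro a s; simp only [P, Matrix.of_apply, hσ]; rfl
  refine ⟨P, N, fun k s => χ s k, σ, h1, h2, hσσ, hPc, ?_, ?_, ?_⟩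
  · -- the permuted conjugate is also a left inverse
    let N' : Matrix (Fin m) (Fin m) ℂ := Matrix.of fun s a => conj (N (σ s) a)
    have : N' * P = 1 := by
      ext s t
      have := congrArg conj (congrFun (congrFun h2 (σ s)) (σ t))
      rw [Matrix.mul_apply, map_sum] at this
      rw [Matrix.mul_apply]
      simp only [map_mul, hPc, hσσ] at this
      simp only [N', Matrix.of_apply]
      rw [this, Matrix.one_apply, Matrix.one_apply]
      simp [apply_ite]
    have hN : N' = N := by
      calc N' = N' * (P * N) := by rw [h1, mul_one]
        _ = N := by rw [← mul_assoc, this, one_mul]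
    intro a s
    have := congrFun (congrFun hN (σ s)) a
    simp only [N', Matrix.of_apply, hσσ] at this
    exact this
  · intro k s
    have h3 := star_eig hB (hχ s) k
    rw [← hσ, hχ] at h3
    have := smul_left_injective ℂ (b'.ne_zero (σ s)) h3
    exact this.symm
  · intro k
    ext a s
    have := congrFun (hχ s k) a
    rw [Matrix.mul_diagonal, Matrix.mul_apply]
    simp only [Matrix.mulVec, dotProduct, Pi.smul_apply, smul_eq_mul] at this
    simp only [P, Matrix.of_apply]
    rw [mul_comm (b' s a), ← this]
end eig

end
end GeoLin

open scoped BigOperators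
namespace GeoLin
noncomputable section
open MvPowerSeries
open scoped ENNReal NNReal Topology ComplexConjugate
variable {m p q : ℕ}

theorem gap_exists (lam : Fin p → Fin m → ℂ) (Γ : Set (Fin m →₀ ℕ))
    (hΓ : ∀ i, ∀ α ∈ Γ, wt (lam i) α = 0)
    (H : ∀ w : Fin m → ℂ, (∀ α ∈ Γ, wt w α = 0) → ∃ c : Fin p → ℂ, ∀ s, w s = ∑ i, c i * lam i s) :
    ∃ ε : ℝ, 0 < ε ∧ ∀ δ : Fin m → ℤ, (∀ i, ∑ s, (δ s : ℂ) * lam i s = 0) ∨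
      ε ≤ ∑ i, ‖∑ s, (δ s : ℂ) * lam i s‖ := by
  classical
  let b := Module.Basis.ofVectorSpace ℚ ℂ
  let w := fun a (i : Fin p) (s : Fin m) => (b.repr (lam i s) a : ℚ)
  have hrep : ∀ (δ : Fin m → ℤ) i a, b.repr (∑ s, (δ s : ℂ) * lam i s) a = ∑ s, (δ s : ℚ) * w a i s := by
    intro δ i a
    rw [map_sum, Finsupp.finsetSum_apply]
    refine Finset.sum_congr rfl fun s _ => ?_
    rw [← zsmul_eq_mul, map_zsmul, Finsupp.smul_apply, zsmul_eq_mul]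
  have hc : ∀ a i, ∃ c : Fin p → ℂ, ∀ s, (w a i s : ℂ) = ∑ k, c k * lam k s := by
    intro a i
    apply H
    intro α hα
    have h1 := hΓ i α hα
    have h2 := hrep (fun s => (α s : ℤ)) i a
    have h3 : ∑ s, (((α s : ℤ)) : ℂ) * lam i s = 0 := by
      rw [← h1, wt]; simp
    rw [h3, map_zero, Finsupp.zero_apply] at h2
    have h4 := congrArg (fun r : ℚ => (r : ℂ)) h2
    simp only [Rat.cast_zero, Rat.cast_sum, Rat.cast_mul, Rat.cast_intCast, Int.cast_natCast, Rat.cast_natCast] at h4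
    rw [wt, ← h4]
  choose c hc using hc
  let A0 := (Finset.univ : Finset (Fin p × Fin m)).biUnion fun x => (b.repr (lam x.1 x.2)).support
  let Dn : ℕ := ∏ a ∈ A0, ∏ i : Fin p, ∏ s : Fin m, (w a i s).den
  have hDpos : 0 < Dn := Finset.prod_pos fun a _ => Finset.prod_pos fun i _ =>
    Finset.prod_pos fun s _ => Rat.den_pos _
  have hDint : ∀ a ∈ A0, ∀ i s, ∃ z : ℤ, (Dn : ℚ) * w a i s = z := by
    intro a ha i s
    have hd : (w a i s).den ∣ Dn :=
      ((Finset.dvd_prod_of_mem _ (Finset.mem_univ s)).trans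
        (Finset.dvd_prod_of_mem (fun i => ∏ s : Fin m, (w a i s).den) (Finset.mem_univ i))).trans
        (Finset.dvd_prod_of_mem (fun a => ∏ i : Fin p, ∏ s : Fin m, (w a i s).den) ha)
    obtain ⟨e, he⟩ := hd
    refine ⟨e * (w a i s).num, ?_⟩
    rw [he]
    push_cast
    have := Rat.den_mul_eq_num (w a i s)
    linear_combination (e : ℚ) * this
  let Cc : ℝ := 1 + ∑ a ∈ A0, ∑ i, ∑ k, ‖c a i k‖
  have hCpos : 0 < Cc := by positivity
  have hCle : ∀ a ∈ A0, ∀ i k, ‖c a i k‖ ≤ Cc := by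
    intro a ha i k
    have h1 := Finset.single_le_sum (f := fun k => ‖c a i k‖) (fun _ _ => norm_nonneg _) (Finset.mem_univ k)
    have h2 := Finset.single_le_sum (f := fun i => ∑ k, ‖c a i k‖)
      (fun _ _ => Finset.sum_nonneg fun _ _ => norm_nonneg _) (Finset.mem_univ i)
    have h3 := Finset.single_le_sum (f := fun a => ∑ i, ∑ k, ‖c a i k‖)
      (fun _ _ => Finset.sum_nonneg fun _ _ => Finset.sum_nonneg fun _ _ => norm_nonneg _) ha
    simp only [Cc] at *
    linarith
  refine ⟨1 / (Dn * Cc), by positivity, fun δ => ?_⟩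
  by_cases hz : ∀ i, ∑ s, (δ s : ℂ) * lam i s = 0
  · exact Or.inl hz
  right
  push Not at hz
  obtain ⟨i, hi⟩ := hz
  have : ∃ a, b.repr (∑ s, (δ s : ℂ) * lam i s) a ≠ 0 := by
    by_contra! h
    exact hi (b.repr.map_eq_zero_iff.1 (Finsupp.ext h))
  obtain ⟨a, ha⟩ := this
  rw [hrep] at ha
  have haA : a ∈ A0 := by
    by_contra hn
    apply ha
    refine Finset.sum_eq_zero fun s _ => ?_
    have : w a i s = 0 := by
      by_contra h
      exact hn (Finset.mem_biUnion.2 ⟨(i, s), Finset.mem_univ _, Finsupp.mem_support_iff.2 h⟩)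
    rw [this, mul_zero]
  choose z hz using hDint a haA i
  have hr : (1 : ℚ) ≤ Dn * |∑ s, (δ s : ℚ) * w a i s| := by
    have e : (Dn : ℚ) * (∑ s, (δ s : ℚ) * w a i s) = ((∑ s, δ s * z s : ℤ) : ℚ) := by
      push_cast
      rw [Finset.mul_sum]
      refine Finset.sum_congr rfl fun s _ => ?_
      rw [← hz]; ring
    have e2 : (Dn : ℚ) * |∑ s, (δ s : ℚ) * w a i s| = ((|∑ s, δ s * z s| : ℤ) : ℚ) := by
      rw [Int.cast_abs, ← e, abs_mul, Nat.abs_cast]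
    rw [e2]
    have hne : ∑ s, δ s * z s ≠ 0 := by
      intro h0
      rw [h0, Int.cast_zero, mul_eq_zero] at e
      rcases e with e | e
      · have : (Dn : ℚ) ≠ 0 := by exact_mod_cast hDpos.ne'
        exact this e
      · exact ha e
    exact_mod_cast Int.one_le_abs hne
  have hr' : (1 : ℝ) ≤ Dn * ‖∑ s, (δ s : ℂ) * (w a i s : ℂ)‖ := by
    have e : ∑ s, (δ s : ℂ) * (w a i s : ℂ) = (((∑ s, (δ s : ℚ) * w a i s : ℚ) : ℝ) : ℂ) := by
      push_cast; rfl
    rw [e, Complex.norm_real, Real.norm_eq_abs]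
    exact_mod_cast hr
  have e1 : ∑ s, (δ s : ℂ) * (w a i s : ℂ) = ∑ k, c a i k * ∑ s, (δ s : ℂ) * lam k s := by
    simp only [hc, Finset.mul_sum]
    rw [Finset.sum_comm]
    exact Finset.sum_congr rfl fun k _ => Finset.sum_congr rfl fun s _ => by ring
  have e2 : ‖∑ s, (δ s : ℂ) * (w a i s : ℂ)‖ ≤ Cc * ∑ k, ‖∑ s, (δ s : ℂ) * lam k s‖ := by
    rw [e1, Finset.mul_sum]
    refine (norm_sum_le _ _).trans (Finset.sum_le_sum fun k _ => ?_)
    rw [norm_mul]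
    exact mul_le_mul_of_nonneg_right (hCle a haA i k) (norm_nonneg _)
  rw [div_le_iff₀ (by positivity)]
  have : (0 : ℝ) < Dn := by exact_mod_cast hDpos
  nlinarith

theorem hp_one_CX (a : ℂ) (s : Fin m) (z : Fin m → ℂ) : hp 1 (C a * X s) z = a * z s := by
  classical
  unfold hp
  rw [Finset.sum_eq_single (Finsupp.single s 1)]
  · rw [coeff_C_mul, coeff_X, if_pos rfl, mul_one, mon_single]
  · intro β _ hne
    rw [coeff_C_mul, coeff_X, if_neg hne]; ring
  · intro h
    exact absurd (mem_degFin.2 (by simp)) h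

theorem vanish_CX (a : ℂ) (s : Fin m) : vanish 1 (C a * X s : PS m) := by
  classical
  intro α hα
  rw [coeff_C_mul, coeff_X, if_neg]
  · ring
  · rintro rfl
    simp at hα

theorem hp_Lop {n : ℕ} {f : PS m} (hf : vanish (n + 1) f) (w z : Fin m → ℂ) :
    hp (n + 1) (Lop w f) z = ∑ s, (w s * z s) * hp n (pd s f) z := by
  rw [Lop, hp_sum]
  refine Finset.sum_congr rfl fun s _ => ?_
  rw [← mul_assoc, add_comm n 1, hp_mul (vanish_CX _ _) (hf.pd s), hp_one_CX]

/-- the gap bound for `mu` -/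
theorem gap_mu {F : Fin q → PS m} {n : Fin q → ℕ} {S : Set (Fin m → ℂ)} {lam : Fin p → Fin m → ℂ}
    (Fv : ∀ j, vanish (n j + 1) (F j))
    (hwt : ∀ i j α, α.degree = n j + 1 → coeff α (F j) ≠ 0 → wt (lam i) α = 0)
    (dense : ∀ P : MvPolynomial (Fin m) ℂ, (∀ z ∈ S, MvPolynomial.eval z P = 0) → P = 0)
    (gen : ∀ z ∈ S, ∀ v : Fin m → ℂ, (∀ j, ∑ s, v s * hp (n j) (pd s (F j)) z = 0) →
      ∃ c : Fin p → ℂ, ∀ s, v s = (∑ i, c i * lam i s) * z s) :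
    ∃ κ : ℝ≥0, ∀ (k : Fin p) (β : Fin m →₀ ℕ) (s : Fin m),
      ‖conj (wt (lam k) β - lam k s) / ∑ l, (Complex.normSq (wt (lam l) β - lam l s) : ℂ)‖ₑ ≤ κ := by
  classical
  obtain ⟨z, hzS, hz⟩ : ∃ z ∈ S, ∀ s, z s ≠ 0 := by
    by_contra! h
    have h0 : (∏ s : Fin m, MvPolynomial.X s : MvPolynomial (Fin m) ℂ) = 0 := by
      apply dense
      intro z hz
      obtain ⟨s, hs⟩ := h z hz
      rw [map_prod]
      exact Finset.prod_eq_zero (Finset.mem_univ s) (by simpa using hs)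
    rw [Finset.prod_eq_zero_iff] at h0
    obtain ⟨s, _, hs⟩ := h0
    exact MvPolynomial.X_ne_zero s hs
  obtain ⟨ε, hε, hgap⟩ := gap_exists lam {α | ∃ j, α.degree = n j + 1 ∧ coeff α (F j) ≠ 0}
    (fun i α hα => by obtain ⟨j, h1, h2⟩ := hα; exact hwt i j α h1 h2)
    (fun w hw => by
      obtain ⟨c, hc⟩ := gen z hzS (fun s => w s * z s) (fun j => by
        rw [← hp_Lop (Fv j)]
        unfold hp
        refine Finset.sum_eq_zero fun α hα => ?_
        rw [mem_degFin] at hα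
        rw [coeff_Lop]
        by_cases h0 : coeff α (F j) = 0
        · rw [h0]; ring
        · rw [hw α ⟨j, hα, h0⟩]; ring)
      exact ⟨c, fun s => mul_right_cancel₀ (hz s) (hc s)⟩)
  refine ⟨Real.toNNReal (p / ε), fun k β s => ?_⟩
  set om : Fin p → ℂ := fun l => wt (lam l) β - lam l s with hom
  have hδ : ∀ l, ∑ t, (((β t : ℤ) - (if t = s then 1 else 0) : ℤ) : ℂ) * lam l t = om l := by
    intro l
    simp [hom, wt, sub_mul, Finset.sum_sub_distrib]
  rw [← ofReal_norm]
  refine ENNReal.ofReal_le_ofReal ?_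
  change ‖conj (om k) / ∑ l, (Complex.normSq (om l) : ℂ)‖ ≤ _
  have hsum : ∑ l, (Complex.normSq (om l) : ℂ) = ((∑ l, ‖om l‖ ^ 2 : ℝ) : ℂ) := by
    push_cast
    exact Finset.sum_congr rfl fun l _ => by rw [Complex.normSq_eq_norm_sq]; push_cast; rfl
  rw [hsum, norm_div, Complex.norm_real, RCLike.norm_conj, Real.norm_of_nonneg (by positivity)]
  rcases hgap (fun t => (β t : ℤ) - (if t = s then 1 else 0)) with h | h
  · have : om k = 0 := by rw [← hδ]; exact h k
    rw [this]; simp; positivity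
  · simp only [hδ] at h
    set T := ∑ l, ‖om l‖ ^ 2 with hT
    have h1 : ∀ l, ‖om l‖ ^ 2 ≤ T := fun l =>
      Finset.single_le_sum (f := fun l => ‖om l‖ ^ 2) (fun _ _ => by positivity) (Finset.mem_univ l)
    have h2 : ∀ l, ‖om l‖ ≤ Real.sqrt T := fun l => Real.le_sqrt_of_sq_le (h1 l)
    have h3 : ε ≤ p * Real.sqrt T := by
      refine h.trans ((Finset.sum_le_sum fun l _ => h2 l).trans ?_)
      simp
    have hp0 : (0 : ℝ) ≤ p := by positivity
    have hs0 : 0 < Real.sqrt T := by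
      by_contra hh
      have : Real.sqrt T = 0 := le_antisymm (not_lt.1 hh) (Real.sqrt_nonneg _)
      rw [this, mul_zero] at h3
      linarith
    have hT0 : 0 < T := Real.sqrt_pos.1 hs0
    have hTs : T = Real.sqrt T * Real.sqrt T := (Real.mul_self_sqrt hT0.le).symm
    rw [div_le_div_iff₀ hT0 hε]
    calc ‖om k‖ * ε ≤ Real.sqrt T * (p * Real.sqrt T) :=
          mul_le_mul (h2 k) h3 hε.le hs0.le
      _ = p * T := by conv_rhs => rw [hTs]
                      ring

end
end GeoLin

open scoped BigOperators
namespace GeoLin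
noncomputable section
open MvPowerSeries
open scoped ENNReal NNReal Topology ComplexConjugate
variable {m p q : ℕ}

theorem mon_hasFDerivAt (α : Fin m →₀ ℕ) (z : Fin m → ℂ) :
    HasFDerivAt (fun z => mon z α)
      (∑ s, ((α s : ℂ) * mon z (α - Finsupp.single s 1)) • (ContinuousLinearMap.proj s : (Fin m → ℂ) →L[ℂ] ℂ)) z := by
  classical
  have h := HasFDerivAt.finsetProd (u := Finset.univ) (g := fun (s : Fin m) (z : Fin m → ℂ) => z s ^ α s)
    (g' := fun s => ((α s : ℂ) * z s ^ (α s - 1)) • (ContinuousLinearMap.proj s : (Fin m → ℂ) →L[ℂ] ℂ)) (x := z)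
    (fun s _ => by
      have := ((ContinuousLinearMap.proj s : (Fin m → ℂ) →L[ℂ] ℂ).hasFDerivAt (x := z)).pow (α s)
      refine this.congr_fderiv ?_
      ext v; simp)
  refine h.congr_fderiv ?_
  refine Finset.sum_congr rfl fun s _ => ?_
  rw [smul_smul]
  congr 1
  unfold mon
  rw [← Finset.mul_prod_erase _ _ (Finset.mem_univ s)]
  have : ∏ x ∈ Finset.univ.erase s, z x ^ (α - Finsupp.single s 1 : Fin m →₀ ℕ) x = ∏ x ∈ Finset.univ.erase s, z x ^ α x :=
    Finset.prod_congr rfl fun x hx => by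
      have : x ≠ s := Finset.ne_of_mem_erase hx
      rw [Finsupp.tsub_apply, Finsupp.single_apply, if_neg this.symm, Nat.sub_zero]
  rw [this]
  simp
  ring

theorem hp_hasFDerivAt (n : ℕ) (f : PS m) (z : Fin m → ℂ) :
    HasFDerivAt (hp (n + 1) f)
      (∑ s, hp n (pd s f) z • (ContinuousLinearMap.proj s : (Fin m → ℂ) →L[ℂ] ℂ)) z := by
  classical
  have h := HasFDerivAt.fun_sum (u := degFin m (n + 1)) (A := fun α z => coeff α f * mon z α) (x := z)
    (fun α _ => (mon_hasFDerivAt α z).const_mul (coeff α f))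
  refine h.congr_fderiv ?_
  simp only [Finset.smul_sum, smul_smul]
  rw [Finset.sum_comm]
  refine Finset.sum_congr rfl fun s _ => ?_
  rw [← Finset.sum_smul]
  congr 1
  unfold hp
  symm
  refine Finset.sum_of_injOn (fun β => β + Finsupp.single s 1) (fun a _ b _ h => add_right_cancel h) ?_ ?_ ?_
  · intro β hβ
    rw [Finset.mem_coe, mem_degFin] at *
    rw [map_add, hβ, Finsupp.degree_single]
  · intro α _ hα
    have : α s = 0 := by
      by_contra hne
      obtain ⟨δ, hδ⟩ := exists_sub hne
      refine hα ⟨δ, ?_, hδ.symm⟩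
      rename_i hα'
      rw [mem_degFin] at hα'
      rw [Finset.mem_coe, mem_degFin]
      rw [hδ, map_add, Finsupp.degree_single] at hα'
      omega
    rw [this]; simp
  · intro β _
    rw [coeff_pderiv]
    simp
    ring

theorem real_span (hm : m = p + q) (φ : Fin q → ((Fin m → ℝ) →L[ℝ] ℝ)) (hφ : LinearIndependent ℝ φ)
    (a : Fin p → Fin m → ℝ) (ha : LinearIndependent ℝ a) (h0 : ∀ j i, φ j (a i) = 0)
    (u : Fin m → ℝ) (hu : ∀ j, φ j u = 0) : ∃ c : Fin p → ℝ, u = ∑ i, c i • a i := by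
  let φ' : Fin q → Module.Dual ℝ (Fin m → ℝ) := fun j => (φ j).toLinearMap
  have hφ' : LinearIndependent ℝ φ' := by
    have := hφ.map' (ContinuousLinearMap.coeLM (R := ℝ) (M := Fin m → ℝ) (N₃ := ℝ) ℝ)
      (LinearMap.ker_eq_bot.2 ContinuousLinearMap.coe_injective)
    exact this
  let W := Submodule.span ℝ (Set.range φ')
  have hW : Module.finrank ℝ W = q := by rw [finrank_span_eq_card hφ']; simp
  have h1 := Subspace.finrank_add_finrank_dualCoannihilator_eq W
  have hle : ∀ v, (∀ j, φ j v = 0) → v ∈ W.dualCoannihilator := by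
    intro v hv
    rw [Submodule.mem_dualCoannihilator]
    intro ψ hψ
    induction hψ using Submodule.span_induction with
    | mem x hx => obtain ⟨j, rfl⟩ := hx; exact hv j
    | zero => rfl
    | add x y _ _ h1 h2 => rw [LinearMap.add_apply, h1, h2, add_zero]
    | smul a x _ h => rw [LinearMap.smul_apply, h, smul_zero]
  have hle2 : Submodule.span ℝ (Set.range a) ≤ W.dualCoannihilator := by
    rw [Submodule.span_le]
    rintro _ ⟨i, rfl⟩
    exact hle _ fun j => h0 j i
  have heq : Submodule.span ℝ (Set.range a) = W.dualCoannihilator := by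
    apply Submodule.eq_of_le_of_finrank_eq hle2
    rw [finrank_span_eq_card ha]
    simp at h1 ⊢
    omega
  have := hle u hu
  rw [← heq, Submodule.mem_span_range_iff_exists_fun] at this
  obtain ⟨c, hc⟩ := this
  exact ⟨c, hc.symm⟩

section
variable {P N : Matrix (Fin m) (Fin m) ℂ} {A : Fin p → Matrix (Fin m) (Fin m) ℝ} {lam : Fin p → Fin m → ℂ}

theorem ofR_mulVec (B : Matrix (Fin m) (Fin m) ℝ) (x : Fin m → ℝ) :
    ofR (B.mulVec x) = (B.map (algebraMap ℝ ℂ)).mulVec (ofR x) := by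
  funext a
  simp [ofR_apply, Matrix.mulVec, dotProduct]

theorem Lm_A (hPN : P * N = 1) (hNP : N * P = 1)
    (hAP : ∀ k, (A k).map (algebraMap ℝ ℂ) * P = P * Matrix.diagonal (lam k)) (k) (x : Fin m → ℝ) (s) :
    Lm N ((A k).mulVec x) s = lam k s * Lm N x s := by
  have h : N * (A k).map (algebraMap ℝ ℂ) = Matrix.diagonal (lam k) * N := by
    calc N * (A k).map (algebraMap ℝ ℂ) = N * (((A k).map (algebraMap ℝ ℂ) * P) * N) := by
          rw [mul_assoc, hPN, mul_one]
      _ = Matrix.diagonal (lam k) * N := by rw [hAP, ← mul_assoc, ← mul_assoc, hNP, one_mul]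
  rw [Lm_apply, Lm_apply, ofR_mulVec, Matrix.mulVec_mulVec, h, ← Matrix.mulVec_mulVec, Matrix.mulVec_diagonal]

theorem fderiv_hp {G : (Fin m → ℝ) → ℝ} {f : PS m} {n : ℕ}
    (hG : ∀ x, (G x : ℂ) = hp (n + 1) f (Lm N x)) (x v : Fin m → ℝ) :
    ((fderiv ℝ G x v : ℝ) : ℂ) = ∑ s, Lm N v s * hp n (pd s f) (Lm N x) := by
  have h1 : HasFDerivAt (fun x => (G x : ℂ)) _ x :=
    (((hp_hasFDerivAt n f (Lm N x)).restrictScalars ℝ).comp x ((Lm N).hasFDerivAt (x := x))).congr_of_eventuallyEq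
      (Filter.Eventually.of_forall hG)
  have h2 : DifferentiableAt ℝ G x := by
    have := Complex.reCLM.differentiableAt.comp x h1.differentiableAt
    exact this
  have h3 : HasFDerivAt (fun x => (G x : ℂ)) (Complex.ofRealCLM.comp (fderiv ℝ G x)) x :=
    Complex.ofRealCLM.hasFDerivAt.comp x h2.hasFDerivAt
  have h4 := congrArg (fun T => T v) (h3.unique h1)
  simp at h4
  rw [h4]
  exact Finset.sum_congr rfl fun s _ => mul_comm _ _

theorem generic_gen (hm : m = p + q) (hPN : P * N = 1) (hNP : N * P = 1)
    (hAP : ∀ k, (A k).map (algebraMap ℝ ℂ) * P = P * Matrix.diagonal (lam k))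
    {F : Fin q → PS m} {n : Fin q → ℕ} {G : Fin q → (Fin m → ℝ) → ℝ}
    (hG : ∀ j x, (G j x : ℂ) = hp (n j + 1) (F j) (Lm N x))
    (Fv : ∀ j, vanish (n j + 1) (F j))
    (hwt : ∀ i j α, α.degree = n j + 1 → coeff α (F j) ≠ 0 → wt (lam i) α = 0)
    {x : Fin m → ℝ} (h1 : LinearIndependent ℝ fun j => fderiv ℝ (G j) x)
    (h2 : LinearIndependent ℝ fun i => (A i).mulVec x)
    (v : Fin m → ℂ) (hv : ∀ j, ∑ s, v s * hp (n j) (pd s (F j)) (Lm N x) = 0) :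
    ∃ c : Fin p → ℂ, ∀ s, v s = (∑ i, c i * lam i s) * Lm N x s := by
  have h0 : ∀ j i, fderiv ℝ (G j) x ((A i).mulVec x) = 0 := by
    intro j i
    have := fderiv_hp (hG j) x ((A i).mulVec x)
    simp only [Lm_A hPN hNP hAP] at this
    rw [← hp_Lop (Fv j)] at this
    have h0 : hp (n j + 1) (Lop (lam i) (F j)) (Lm N x) = 0 := by
      unfold hp
      refine Finset.sum_eq_zero fun α hα => ?_
      rw [mem_degFin] at hα
      rw [coeff_Lop]
      by_cases h0 : coeff α (F j) = 0
      · rw [h0]; ring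
      · rw [hwt i j α hα h0]; ring
    rw [h0] at this
    exact_mod_cast this
  let u := P.mulVec v
  let a : Fin m → ℝ := fun s => (u s).re
  let b : Fin m → ℝ := fun s => (u s).im
  have hvab : ∀ s, v s = Lm N a s + Complex.I * Lm N b s := by
    intro s
    have e : u = ofR a + Complex.I • ofR b := by
      funext s
      simp only [Pi.add_apply, Pi.smul_apply, ofR_apply, smul_eq_mul, a, b]
      rw [mul_comm]; exact (Complex.re_add_im _).symm
    have e2 : v = N.mulVec u := by simp only [u]; rw [Matrix.mulVec_mulVec, hNP, Matrix.one_mulVec]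
    have := congrFun e2 s
    rw [e, Matrix.mulVec_add, Matrix.mulVec_smul] at this
    exact this
  have hab : ∀ j, fderiv ℝ (G j) x a = 0 ∧ fderiv ℝ (G j) x b = 0 := by
    intro j
    have e : ((fderiv ℝ (G j) x a : ℝ) : ℂ) + Complex.I * ((fderiv ℝ (G j) x b : ℝ) : ℂ) = 0 := by
      rw [fderiv_hp (hG j), fderiv_hp (hG j), Finset.mul_sum, ← Finset.sum_add_distrib, ← hv j]
      exact Finset.sum_congr rfl fun s _ => by rw [hvab]; ring
    have e1 := congrArg Complex.re e
    have e2 := congrArg Complex.im e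
    simp at e1 e2
    exact ⟨e1, e2⟩
  obtain ⟨c, hc⟩ := real_span hm _ h1 _ h2 h0 a fun j => (hab j).1
  obtain ⟨d, hd⟩ := real_span hm _ h1 _ h2 h0 b fun j => (hab j).2
  refine ⟨fun i => c i + Complex.I * d i, fun s => ?_⟩
  have key : ∀ (c : Fin p → ℝ), Lm N (∑ i, c i • (A i).mulVec x) s = (∑ i, (c i : ℂ) * lam i s) * Lm N x s := by
    intro c
    rw [map_sum, Finset.sum_apply, Finset.sum_mul]
    refine Finset.sum_congr rfl fun i _ => ?_
    rw [map_smul, Pi.smul_apply, Lm_A hPN hNP hAP, Complex.real_smul, mul_assoc]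
  rw [hvab, hc, hd, key, key, ← mul_assoc, ← add_mul, Finset.mul_sum, ← Finset.sum_add_distrib]
  congr 1
  exact Finset.sum_congr rfl fun i _ => by ring

theorem generic_dense (hNP : N * P = 1) {T : Set (Fin m → ℝ)} (hT : Dense T)
    (hA : Dense {x : Fin m → ℝ | LinearIndependent ℝ fun i => (A i).mulVec x})
    (Q : MvPolynomial (Fin m) ℂ)
    (h : ∀ z ∈ Lm N '' (T ∩ {x : Fin m → ℝ | LinearIndependent ℝ fun i => (A i).mulVec x}),
      MvPolynomial.eval z Q = 0) : Q = 0 := by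
  apply zdense_Lm hNP
  have ho : IsOpen {x : Fin m → ℝ | LinearIndependent ℝ fun i => (A i).mulVec x} :=
    isOpen_setOfPred_linearIndependent.preimage
      (f := fun x i => (A i).mulVec x) (by fun_prop)
  have hd := hT.inter_of_isOpen_right hA ho
  have hc : Continuous fun x => MvPolynomial.eval (Lm N x) Q :=
    (MvPolynomial.continuous_eval Q).comp (Lm N).continuous
  have := Continuous.ext_on hd hc continuous_const (fun x hx => h _ ⟨x, hx, rfl⟩)
  exact fun x => congrFun this x
end

end
end GeoLin

open scoped BigOperators
namespace GeoLin
noncomputable section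
open MvPowerSeries
open scoped ENNReal NNReal Topology ComplexConjugate
variable {m p q : ℕ}

theorem comm_A {X : Fin p → (Fin m → ℝ) → (Fin m → ℝ)} (hX : ∀ i, AnalyticAt ℝ (X i) 0)
    (hcomm : ∀ i j, ∀ᶠ x in 𝓝 0, fderiv ℝ (X j) x (X i x) - fderiv ℝ (X i) x (X j x) = 0)
    (hfix : ∀ i, X i 0 = 0) {A : Fin p → Matrix (Fin m) (Fin m) ℝ}
    (hA : ∀ i v, (A i).mulVec v = fderiv ℝ (X i) 0 v) (i j) : A i * A j = A j * A i := by
  have key : ∀ i j, HasFDerivAt (fun x => fderiv ℝ (X j) x (X i x))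
      ((fderiv ℝ (X j) 0).comp (fderiv ℝ (X i) 0)) 0 := by
    intro i j
    have h1 : HasFDerivAt (fderiv ℝ (X j)) _ 0 := (hX j).fderiv.differentiableAt.hasFDerivAt
    have h2 := (hX i).differentiableAt.hasFDerivAt
    refine (h1.clm_apply h2).congr_fderiv ?_
    ext v
    simp [hfix]
  have h1 : HasFDerivAt (fun x => fderiv ℝ (X j) x (X i x))
      ((fderiv ℝ (X i) 0).comp (fderiv ℝ (X j) 0)) 0 :=
    (key j i).congr_of_eventuallyEq ((hcomm i j).mono fun x hx => sub_eq_zero.1 hx)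
  have h2 := h1.unique (key i j)
  apply Matrix.toLin'.injective
  refine LinearMap.ext fun v => ?_
  rw [Matrix.toLin'_apply, Matrix.toLin'_apply, ← Matrix.mulVec_mulVec, ← Matrix.mulVec_mulVec, hA, hA, hA, hA]
  exact congrArg (fun T => T v) h2

theorem fderiv_series {N : Matrix (Fin m) (Fin m) ℂ} {f : (Fin m → ℝ) → ℂ} {a : PS m} (ha : Conv a)
    (h : ∀ᶠ x in 𝓝 0, f x = ev a (Lm N x)) :
    ∀ᶠ x in 𝓝 0, ∀ v, fderiv ℝ f x v = ∑ t, Lm N v t * ev (pd t a) (Lm N x) := by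
  filter_upwards [h.eventually_nhds, (Lm_tendsto N).eventually ha.hasFDerivAt] with x hx hd v
  have h1 : HasFDerivAt f _ x :=
    ((hd.restrictScalars ℝ).comp x ((Lm N).hasFDerivAt (x := x))).congr_of_eventuallyEq hx
  rw [h1.fderiv]
  simp
  exact Finset.sum_congr rfl fun s _ => mul_comm _ _

theorem conv_lie {Z : Fin m → PS m} (hZ : ∀ t, Conv (Z t)) {a : PS m} (ha : Conv a) :
    Conv (∑ t, Z t * pd t a) := Conv.sum fun t _ => (hZ t).mul (ha.pd t)

theorem ev_lie {N : Matrix (Fin m) (Fin m) ℂ} {f : (Fin m → ℝ) → ℂ} {a : PS m} (ha : Conv a)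
    (h : ∀ᶠ x in 𝓝 0, f x = ev a (Lm N x)) {Xi : (Fin m → ℝ) → (Fin m → ℝ)} {Z : Fin m → PS m}
    (hZ : ∀ t, Conv (Z t)) (hX : ∀ t, ∀ᶠ x in 𝓝 0, Lm N (Xi x) t = ev (Z t) (Lm N x)) :
    ∀ᶠ x in 𝓝 0, fderiv ℝ f x (Xi x) = ev (∑ t, Z t * pd t a) (Lm N x) := by
  have h1 := (Lm_tendsto N).eventually (Conv.ev_sum (S := Finset.univ) (f := fun t => Z t * pd t a)
    (fun t _ => (hZ t).mul (ha.pd t)))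
  have h2 : ∀ᶠ x in 𝓝 0, ∀ t, ev (Z t * pd t a) (Lm N x) = ev (Z t) (Lm N x) * ev (pd t a) (Lm N x) :=
    Filter.eventually_all.2 fun t => (Lm_tendsto N).eventually (Conv.ev_mul (hZ t) (ha.pd t))
  filter_upwards [fderiv_series ha h, h1, h2, Filter.eventually_all.2 hX] with x e0 e1 e2 e3
  rw [e0, e1]
  exact Finset.sum_congr rfl fun t _ => by rw [e2, e3]

theorem hp_taylor {N : Matrix (Fin m) (Fin m) ℂ} {f : (Fin m → ℝ) → ℝ} (hf : AnalyticAt ℝ f 0) {a : PS m}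
    (ha : Conv a) (h : ∀ᶠ x in 𝓝 0, (f x : ℂ) = ev a (Lm N x)) (n : ℕ) (x : Fin m → ℝ) :
    hp n a (Lm N x) = ((((n.factorial : ℝ))⁻¹ • iteratedFDeriv ℝ n f 0 (fun _ => x) : ℝ) : ℂ) := by
  obtain ⟨P, r, hP⟩ := hf
  have h1 := Complex.ofRealCLM.comp_hasFPowerSeriesOnBall hP
  have h2 := hp_eq_of_fps ha (Lm N) ⟨r, h1⟩ h n x
  rw [h2, ← hP.factorial_smul]
  have : ((n.factorial : ℝ)) ≠ 0 := by exact_mod_cast n.factorial_ne_zero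
  rw [← Nat.cast_smul_eq_nsmul ℝ, smul_smul, inv_mul_cancel₀ this, one_smul]
  rfl

theorem exists_Z {P N : Matrix (Fin m) (Fin m) ℂ} {B : Matrix (Fin m) (Fin m) ℝ} {lam : Fin m → ℂ}
    (hPN : P * N = 1) (hNP : N * P = 1) (hB : ∀ v s, Lm N (B.mulVec v) s = lam s * Lm N v s)
    {Xi : (Fin m → ℝ) → (Fin m → ℝ)} (hX : AnalyticAt ℝ Xi 0) (hfix : Xi 0 = 0)
    (hA : ∀ v, B.mulVec v = fderiv ℝ Xi 0 v) (s : Fin m) :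
    ∃ Y : PS m, Conv Y ∧ vanish 2 Y ∧ ∀ᶠ x in 𝓝 0, Lm N (Xi x) s = ev (C (lam s) * X s + Y) (Lm N x) := by
  let T : (Fin m → ℝ) →L[ℝ] ℂ := (ContinuousLinearMap.proj (R := ℝ) (φ := fun _ : Fin m => ℂ) s).comp (Lm N)
  have hT : ∀ v, T v = Lm N v s := fun v => rfl
  have han : AnalyticAt ℝ (fun x => Lm N (Xi x) s) 0 := (T.analyticAt _).comp hX
  obtain ⟨a, ha, he⟩ := exists_series hPN han
  obtain ⟨pp, hpp⟩ := han
  have hp := hp_eq_of_fps ha (Lm N) hpp he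
  have hd : HasFDerivAt (fun x => Lm N (Xi x) s) (T.comp (fderiv ℝ Xi 0)) 0 :=
    (T.hasFDerivAt (x := Xi 0)).comp (0 : Fin m → ℝ) hX.differentiableAt.hasFDerivAt
  have hsplit : a = (a - C (lam s) * X s) + C (lam s) * X s := by ring
  refine ⟨a - C (lam s) * X s, ha.sub ((conv_C _).mul (conv_X s)), ?_, ?_⟩
  · intro α hα
    have h2 : α.degree = 0 ∨ α.degree = 1 := by omega
    rcases h2 with h2 | h2
    · refine coeff_eq_zero_of_hp (zdense_Lm hNP) (n := 0) (fun x => ?_) h2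
      have e := hp 0 x
      rw [hpp.coeff_zero, hfix, map_zero, hsplit, hp_add] at e
      have e2 : GeoLin.hp 0 (C (lam s) * X s : PS m) (Lm N x) = 0 := by
        unfold GeoLin.hp
        exact Finset.sum_eq_zero fun β hβ => by
          rw [vanish_CX _ _ β (by rw [mem_degFin.1 hβ]; omega), zero_mul]
      rw [e2, add_zero] at e
      exact e
    · refine coeff_eq_zero_of_hp (zdense_Lm hNP) (n := 1) (fun x => ?_) h2
      have e := hp 1 x
      rw [hsplit, hp_add, hp_one_CX] at e
      have e3 : pp 1 (fun _ => x) = fderiv ℝ (fun x => Lm N (Xi x) s) 0 x := by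
        rw [hpp.fderiv_eq]
        simp [continuousMultilinearCurryFin1_apply]
        congr 1
        funext i; fin_cases i; rfl
      rw [e3, hd.fderiv, ContinuousLinearMap.comp_apply, ← hA, hT, hB] at e
      exact add_eq_right.1 e
  · rw [add_sub_cancel]
    exact he

theorem exists_ell {lam : Fin p → Fin m → ℂ} {σ : Equiv.Perm (Fin m)} (hσ : ∀ s, σ (σ s) = s)
    (hlam : ∀ k s, conj (lam k s) = lam k (σ s))
    (hind : ∀ c : Fin p → ℂ, (∀ s, ∑ i, c i * lam i s = 0) → c = 0) :
    ∃ ell : Fin p → Fin m → ℂ, (∀ i j, ∑ s, ell i s * lam j s = if i = j then 1 else 0) ∧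
      ∀ i s, conj (ell i s) = ell i (σ s) := by
  classical
  obtain ⟨g, hg⟩ := LinearMap.exists_leftInverse_of_injective (Fintype.linearCombination ℂ lam) (by
    rw [LinearMap.ker_eq_bot']
    intro c hc
    apply hind
    intro s
    have := congrFun hc s
    simpa [Fintype.linearCombination_apply] using this)
  let e0 : Fin p → Fin m → ℂ := fun i s => g (Pi.single s 1) i
  have h0 : ∀ i j, ∑ s, e0 i s * lam j s = if i = j then 1 else 0 := by
    intro i j
    have h1 : g (lam j) = Pi.single j 1 := by
      have := congrArg (fun T => T (Pi.single j 1)) hg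
      simpa [Fintype.linearCombination_apply_single] using this
    have h2 : lam j = ∑ s, lam j s • (Pi.single s 1 : Fin m → ℂ) := by
      funext t
      simp [Finset.sum_apply, Pi.single_apply]
    have h3 : g (lam j) i = ∑ s, e0 i s * lam j s := by
      conv_lhs => rw [h2]
      rw [map_sum, Finset.sum_apply]
      exact Finset.sum_congr rfl fun s _ => by rw [map_smul, Pi.smul_apply, smul_eq_mul, mul_comm]
    rw [← h3, h1, Pi.single_apply]
  refine ⟨fun i s => (e0 i s + conj (e0 i (σ s))) / 2, fun i j => ?_, fun i s => ?_⟩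
  · have h1 : ∑ s, conj (e0 i (σ s)) * lam j s = if i = j then 1 else 0 := by
      have := congrArg conj (h0 i j)
      rw [map_sum, ← Equiv.sum_comp σ] at this
      simp only [map_mul, hlam, hσ] at this
      rw [this]; split_ifs <;> simp
    have : ∑ s, (e0 i s + conj (e0 i (σ s))) / 2 * lam j s =
        (∑ s, e0 i s * lam j s + ∑ s, conj (e0 i (σ s)) * lam j s) / 2 := by
      rw [← Finset.sum_add_distrib, Finset.sum_div]
      exact Finset.sum_congr rfl fun s _ => by ring
    rw [this, h0, h1]; ring
  · simp only [map_div₀, map_add, Complex.conj_conj, hσ, map_ofNat]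
    rw [add_comm]

theorem lam_ind {P N : Matrix (Fin m) (Fin m) ℂ} {A : Fin p → Matrix (Fin m) (Fin m) ℝ} {lam : Fin p → Fin m → ℂ}
    (hPN : P * N = 1) (hNP : N * P = 1)
    (hAP : ∀ k, (A k).map (algebraMap ℝ ℂ) * P = P * Matrix.diagonal (lam k)) {x : Fin m → ℝ}
    (hx : LinearIndependent ℝ fun i => (A i).mulVec x) (c : Fin p → ℂ) (hc : ∀ s, ∑ i, c i * lam i s = 0) :
    c = 0 := by
  have h1 : N.mulVec (∑ i, c i • ofR ((A i).mulVec x)) = 0 := by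
    funext s
    have := hc s
    rw [Matrix.mulVec_sum, Finset.sum_apply]
    simp only [Matrix.mulVec_smul, Pi.smul_apply, ← Lm_apply, Lm_A hPN hNP hAP, smul_eq_mul]
    simp only [← mul_assoc]
    rw [← Finset.sum_mul, this, zero_mul]; rfl
  have h2 : ∑ i, c i • ofR ((A i).mulVec x) = 0 := by
    have := congrArg P.mulVec h1
    rwa [Matrix.mulVec_mulVec, hPN, Matrix.one_mulVec, Matrix.mulVec_zero] at this
  rw [Fintype.linearIndependent_iff] at hx
  have hre := hx (fun i => (c i).re) (by
    funext s
    have := congrArg Complex.re (congrFun h2 s)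
    simpa [Finset.sum_apply, ofR_apply] using this)
  have him := hx (fun i => (c i).im) (by
    funext s
    have := congrArg Complex.im (congrFun h2 s)
    simpa [Finset.sum_apply, ofR_apply] using this)
  funext i
  exact Complex.ext (hre i) (him i)

theorem wt_tau {lam : Fin m → ℂ} {σ : Equiv.Perm (Fin m)} (hlam : ∀ s, conj (lam s) = lam (σ s))
    (β : Fin m →₀ ℕ) : wt lam (tau σ β) = conj (wt lam β) := by
  unfold wt
  rw [map_sum, ← Equiv.sum_comp σ]
  refine Finset.sum_congr rfl fun s _ => ?_
  rw [tau_apply, Equiv.symm_apply_apply, map_mul, hlam]; simp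

end
end GeoLin

open scoped BigOperators
namespace GeoLin
noncomputable section
open MvPowerSeries
open scoped ENNReal NNReal Topology ComplexConjugate
variable {m p q : ℕ}

theorem conj_Lm {N : Matrix (Fin m) (Fin m) ℂ} {σ : Equiv.Perm (Fin m)}
    (hN : ∀ a s, conj (N s a) = N (σ s) a) (x : Fin m → ℝ) (s) : conj (Lm N x s) = Lm N x (σ s) := by
  rw [Lm_apply]
  simp [Matrix.mulVec, dotProduct, hN, ofR_apply]

theorem comm_Z {N P : Matrix (Fin m) (Fin m) ℂ} (hNP : N * P = 1)
    {Xi Xj : (Fin m → ℝ) → (Fin m → ℝ)} (hXi : AnalyticAt ℝ Xi 0) (hXj : AnalyticAt ℝ Xj 0)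
    (hcomm : ∀ᶠ x in 𝓝 0, fderiv ℝ Xj x (Xi x) - fderiv ℝ Xi x (Xj x) = 0)
    {Zi Zj : Fin m → PS m} (hi : ∀ s, Conv (Zi s)) (hj : ∀ s, Conv (Zj s))
    (ei : ∀ s, ∀ᶠ x in 𝓝 0, Lm N (Xi x) s = ev (Zi s) (Lm N x))
    (ej : ∀ s, ∀ᶠ x in 𝓝 0, Lm N (Xj x) s = ev (Zj s) (Lm N x)) (s : Fin m) :
    ∑ t, Zi t * pd t (Zj s) = ∑ t, Zj t * pd t (Zi s) := by
  refine ev_inj (conv_lie hi (hj s)) (conv_lie hj (hi s)) (zdense_Lm hNP) ?_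
  have hd : ∀ {Y : (Fin m → ℝ) → (Fin m → ℝ)} {x}, DifferentiableAt ℝ Y x → ∀ v,
      fderiv ℝ (fun x => Lm N (Y x) s) x v = Lm N (fderiv ℝ Y x v) s := by
    intro Y x hY v
    let T : (Fin m → ℝ) →L[ℝ] ℂ := (ContinuousLinearMap.proj (R := ℝ) (φ := fun _ : Fin m => ℂ) s).comp (Lm N)
    have : HasFDerivAt (fun x => T (Y x)) (T.comp (fderiv ℝ Y x)) x := T.hasFDerivAt.comp x hY.hasFDerivAt
    have h2 := congrArg (fun L => L v) this.fderiv
    exact h2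
  filter_upwards [hcomm, ev_lie (hj s) (ej s) hi ei, ev_lie (hi s) (ei s) hj ej,
    hXi.eventually_analyticAt, hXj.eventually_analyticAt] with x h0 h1 h2 h3 h4
  rw [← h1, ← h2, hd h4.differentiableAt, hd h3.differentiableAt, sub_eq_zero.1 h0]

theorem assemble (hm : m = p + q)
    {Xv : Fin p → (Fin m → ℝ) → (Fin m → ℝ)} {F : Fin q → (Fin m → ℝ) → ℝ}
    (hXan : ∀ i, AnalyticAt ℝ (Xv i) 0) (hFan : ∀ j, AnalyticAt ℝ (F j) 0)
    (hcomm : ∀ i j, ∀ᶠ x in 𝓝 0, fderiv ℝ (Xv j) x (Xv i x) - fderiv ℝ (Xv i) x (Xv j x) = 0)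
    (hFint : ∀ i j, ∀ᶠ x in 𝓝 0, fderiv ℝ (F j) x (Xv i x) = 0)
    (hfix : ∀ i, Xv i 0 = 0) {A : Fin p → Matrix (Fin m) (Fin m) ℝ}
    (hA : ∀ i v, (A i).mulVec v = fderiv ℝ (Xv i) 0 v)
    (hd : ∀ i, ∃ P : Matrix (Fin m) (Fin m) ℂ, IsUnit P ∧ ∃ d : Fin m → ℂ,
      (A i).map (algebraMap ℝ ℂ) = P * Matrix.diagonal d * P⁻¹)
    (hAind : Dense {x : Fin m → ℝ | LinearIndependent ℝ fun i => (A i).mulVec x})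
    (k : Fin q → ℕ) (G : Fin q → (Fin m → ℝ) → ℝ)
    (hklow : ∀ j, ∀ l < k j, iteratedFDeriv ℝ l (F j) 0 = 0)
    (hG : ∀ j x, G j x = (((k j).factorial : ℝ))⁻¹ • iteratedFDeriv ℝ (k j) (F j) 0 (fun _ => x))
    (hGind : Dense {x : Fin m → ℝ | LinearIndependent ℝ fun j => fderiv ℝ (G j) x}) :
    ∃ (P N : Matrix (Fin m) (Fin m) ℂ) (σ : Equiv.Perm (Fin m)) (D : Dat m p) (Fs : Fin q → PS m)
      (n : Fin q → ℕ) (S : Set (Fin m → ℂ)), P * N = 1 ∧ N * P = 1 ∧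
      (∀ a s, conj (P a s) = P a (σ s)) ∧ (∀ a s, conj (N s a) = N (σ s) a) ∧
      (∀ k, (A k).map (algebraMap ℝ ℂ) * P = P * Matrix.diagonal (D.lam k)) ∧
      D.Hyp Fs n S ∧ D.Equi σ ∧
      ∀ i s, ∀ᶠ x in 𝓝 0, Lm N (Xv i x) s = ev (D.Z i s) (Lm N x) := by
  classical
  obtain ⟨P, N, lam, σ, hPN, hNP, hσ, hP, hN, hlam, hAP⟩ :=
    exists_eigenbasis A (comm_A hXan hcomm hfix hA) hd
  choose Y Yc Yv hY using fun i s => exists_Z hPN hNP (fun v s => Lm_A hPN hNP hAP i v s)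
    (hXan i) (hfix i) (hA i) s
  obtain ⟨x0, hx0⟩ := hAind.nonempty
  obtain ⟨ell, hell, hells⟩ := exists_ell hσ hlam (fun c hc => lam_ind hPN hNP hAP hx0 c hc)
  choose Fs Fc hFs using fun j => exists_series hPN (f := fun x => (F j x : ℂ))
    (Complex.ofRealCLM.analyticAt _ |>.comp (hFan j))
  have hkpos : ∀ j, 1 ≤ k j := by
    intro j
    by_contra h0
    have h0 : k j = 0 := by omega
    obtain ⟨x1, hx1⟩ := hGind.nonempty
    have h2 := LinearIndependent.ne_zero j hx1
    apply h2
    have : G j = fun _ => F j 0 := by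
      funext x
      rw [hG, h0]; simp
    simp [this]
  let n : Fin q → ℕ := fun j => k j - 1
  have hn : ∀ j, n j + 1 = k j := fun j => by have := hkpos j; simp only [n]; omega
  have Fv : ∀ j, vanish (n j + 1) (Fs j) := by
    intro j α hα
    rw [hn] at hα
    refine coeff_eq_zero_of_hp (zdense_Lm hNP) (n := α.degree) (fun x => ?_) rfl
    rw [hp_taylor (hFan j) (Fc j) (hFs j), hklow j _ hα]
    simp
  let D : Dat m p :=
    { lam := lam, Y := Y, ell := ell
      mu := fun k β s => conj (wt (lam k) β - lam k s) / ∑ l, (Complex.normSq (wt (lam l) β - lam l s) : ℂ)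
      res := fun δ => if ∀ l, wt (lam l) δ = 0 then 1 else 0 }
  have Zc : ∀ i s, Conv (D.Z i s) := fun i s => ((conv_C _).mul (conv_X s)).add (Yc i s)
  have hZ : ∀ i s, ∀ᶠ x in 𝓝 0, Lm N (Xv i x) s = ev (D.Z i s) (Lm N x) := hY
  have FZ : ∀ i j, ∑ t, D.Z i t * pd t (Fs j) = 0 := by
    intro i j
    refine ev_inj_zero (conv_lie (Zc i) (Fc j)) (zdense_Lm hNP) ?_
    filter_upwards [ev_lie (Fc j) (hFs j) (Zc i) (hZ i), hFint i j, (hFan j).eventually_analyticAt] with x h1 h2 h3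
    rw [← h1]
    have : HasFDerivAt (fun x => (F j x : ℂ)) (Complex.ofRealCLM.comp (fderiv ℝ (F j) x)) x :=
      Complex.ofRealCLM.hasFDerivAt.comp x h3.differentiableAt.hasFDerivAt
    rw [this.fderiv]
    simp [h2]
  have hwt : ∀ i j α, α.degree = n j + 1 → coeff α (Fs j) ≠ 0 → wt (lam i) α = 0 := by
    intro i j α hα hne
    have e := FZ i j
    have e1 : ∑ t, D.Z i t * pd t (Fs j) = Lop (D.lam i) (Fs j) + ∑ t, D.Y i t * pd t (Fs j) := by
      rw [Lop, ← Finset.sum_add_distrib]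
      exact Finset.sum_congr rfl fun t _ => by rw [Dat.Z]; ring
    have h2 : vanish (n j + 2) (∑ t, D.Y i t * pd t (Fs j)) := vanish.sum fun t _ => by
      rw [add_comm]; exact (Yv i t).mul ((Fv j).pd t)
    rw [e1] at e
    have := congrArg (coeff α) e
    rw [map_add, h2 α (by omega), coeff_Lop, add_zero, map_zero] at this
    exact (mul_eq_zero.1 this).resolve_right hne
  have hG' : ∀ j x, (G j x : ℂ) = hp (n j + 1) (Fs j) (Lm N x) := by
    intro j x
    rw [hp_taylor (hFan j) (Fc j) (hFs j), hn, hG]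
  let S : Set (Fin m → ℂ) := Lm N '' ({x : Fin m → ℝ | LinearIndependent ℝ fun j => fderiv ℝ (G j) x} ∩
    {x : Fin m → ℝ | LinearIndependent ℝ fun i => (A i).mulVec x})
  have gen : ∀ z ∈ S, ∀ v : Fin m → ℂ, (∀ j, ∑ s, v s * hp (n j) (pd s (Fs j)) z = 0) →
      ∃ c : Fin p → ℂ, ∀ s, v s = (∑ i, c i * lam i s) * z s := by
    rintro z ⟨x, ⟨h1, h2⟩, rfl⟩ v hv
    exact generic_gen hm hPN hNP hAP hG' Fv hwt h1 h2 v hv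
  have dns : ∀ Q : MvPolynomial (Fin m) ℂ, (∀ z ∈ S, MvPolynomial.eval z Q = 0) → Q = 0 :=
    fun Q hQ => generic_dense hNP hGind hAind Q hQ
  have hwt' : ∀ l β, wt (lam l) (tau σ β) = conj (wt (lam l) β) := fun l β => wt_tau (hlam l) β
  have hom : ∀ l β s, wt (lam l) (tau σ β) - lam l s = conj (wt (lam l) β - lam l (σ s)) := by
    intro l β s
    rw [hwt', map_sub, hlam, hσ]
  refine ⟨P, N, σ, D, Fs, n, S, hPN, hNP, hP, hN, hAP, ?_, ?_, hZ⟩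
  · exact
      { Yc := Yc, Yv := Yv
        comm := fun i j s => comm_Z hNP (hXan i) (hXan j) (hcomm i j) (Zc i) (Zc j) (hZ i) (hZ j) s
        Fc := Fc, Fv := Fv, FZ := FZ, ell := hell
        mu := fun k β s => rfl
        res1 := fun δ h => if_pos h
        res0 := fun δ h => if_neg h
        gap := gap_mu Fv hwt dns gen
        dense := dns, gen := gen }
  · refine ⟨hσ, hlam, ?_, ?_, hells, ?_⟩
    · intro i s
      have h1 : cj σ (D.Z i s) = D.Z i (σ s) := by
        refine ev_inj (Zc i s).cj (Zc i (σ s)) (zdense_Lm hNP) ?_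
        filter_upwards [hZ i s, hZ i (σ s)] with x e1 e2
        rw [ev_cj hσ _ (conj_Lm hN x), ← e1, ← e2, conj_Lm hN]
      rw [Dat.Z, Dat.Z, cj_add, cj_mul, cj_C, cj_X hσ] at h1
      have h2 : conj (D.lam i s) = D.lam i (σ s) := hlam i s
      rw [h2] at h1
      exact add_left_cancel h1
    · intro k β s
      simp only [D, hom, map_div₀, Complex.conj_conj, map_sum, Complex.conj_ofReal, Complex.normSq_conj]
    · intro δ
      simp only [D, hwt', _root_.map_eq_zero]
      split_ifs <;> simp

end
end GeoLin

open scoped BigOperators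
namespace GeoLin
noncomputable section
open MvPowerSeries
open scoped ENNReal NNReal Topology ComplexConjugate
variable {m p q : ℕ}

theorem Lm_inj {P N : Matrix (Fin m) (Fin m) ℂ} (hPN : P * N = 1) {x y : Fin m → ℝ}
    (h : ∀ s, Lm N x s = Lm N y s) : x = y := by
  have h1 : Lm N x = Lm N y := funext h
  have h2 := congrArg P.mulVec h1
  rw [Lm_apply, Lm_apply, Matrix.mulVec_mulVec, Matrix.mulVec_mulVec, hPN, Matrix.one_mulVec,
    Matrix.one_mulVec] at h2
  funext a
  have := congrFun h2 a
  simpa [ofR_apply] using this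

theorem analytic_ev_Lm {N : Matrix (Fin m) (Fin m) ℂ} {a : PS m} (ha : Conv a) :
    AnalyticAt ℝ (fun x => ev a (Lm N x)) 0 := by
  have h1 : AnalyticAt ℝ (ev a) (Lm N 0) := by
    rw [map_zero]; exact ha.analyticAt.restrictScalars
  exact h1.comp ((Lm N).analyticAt 0)

theorem fderiv_Lm {N : Matrix (Fin m) (Fin m) ℂ} {Y : (Fin m → ℝ) → (Fin m → ℝ)} {x}
    (hY : DifferentiableAt ℝ Y x) (s v) :
    fderiv ℝ (fun x => Lm N (Y x) s) x v = Lm N (fderiv ℝ Y x v) s := by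
  let T : (Fin m → ℝ) →L[ℝ] ℂ := (ContinuousLinearMap.proj (R := ℝ) (φ := fun _ : Fin m => ℂ) s).comp (Lm N)
  have : HasFDerivAt (fun x => T (Y x)) (T.comp (fderiv ℝ Y x)) x := T.hasFDerivAt.comp x hY.hasFDerivAt
  have h2 := congrArg (fun L => L v) this.fderiv
  exact h2

theorem ev_Lop_Lm {P N : Matrix (Fin m) (Fin m) ℂ} {A : Fin p → Matrix (Fin m) (Fin m) ℝ} {lam : Fin p → Fin m → ℂ}
    (hPN : P * N = 1) (hNP : N * P = 1)
    (hAP : ∀ k, (A k).map (algebraMap ℝ ℂ) * P = P * Matrix.diagonal (lam k))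
    {f : (Fin m → ℝ) → ℂ} {a : PS m} (ha : Conv a)
    (h : ∀ᶠ x in 𝓝 0, f x = ev a (Lm N x)) (k) :
    ∀ᶠ x in 𝓝 0, fderiv ℝ f x ((A k).mulVec x) = ev (Lop (lam k) a) (Lm N x) := by
  have := ev_lie ha h (Xi := fun x => (A k).mulVec x) (Z := fun t => C (lam k t) * X t)
    (fun t => (conv_C _).mul (conv_X t))
    (fun t => Filter.Eventually.of_forall fun x => by
      rw [Lm_A hPN hNP hAP, ev_C_mul, ev_X])
  have e : ∑ t, C (lam k t) * X t * pd t a = Lop (lam k) a := by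
    rw [Lop]; exact Finset.sum_congr rfl fun t _ => by ring
  rwa [e] at this

theorem normal_real {Xv : Fin p → (Fin m → ℝ) → (Fin m → ℝ)} {A : Fin p → Matrix (Fin m) (Fin m) ℝ}
    {P N : Matrix (Fin m) (Fin m) ℂ} {σ : Equiv.Perm (Fin m)} {D : Dat m p} {Fs : Fin q → PS m}
    {n : Fin q → ℕ} {S : Set (Fin m → ℂ)} (hPN : P * N = 1) (hNP : N * P = 1)
    (hP : ∀ a s, conj (P a s) = P a (σ s)) (hN : ∀ a s, conj (N s a) = N (σ s) a)
    (hAP : ∀ k, (A k).map (algebraMap ℝ ℂ) * P = P * Matrix.diagonal (D.lam k))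
    (hD : D.Hyp Fs n S) (hE : D.Equi σ)
    (hZ : ∀ i s, ∀ᶠ x in 𝓝 0, Lm N (Xv i x) s = ev (D.Z i s) (Lm N x)) :
    ∃ (Ψ : (Fin m → ℝ) → (Fin m → ℝ)) (h : Fin p → Fin p → (Fin m → ℝ) → ℝ),
      AnalyticAt ℝ Ψ 0 ∧ (∀ k i, AnalyticAt ℝ (h k i) 0) ∧ Ψ 0 = 0 ∧
      fderiv ℝ Ψ 0 = ContinuousLinearMap.id ℝ _ ∧ (∀ k i, h k i 0 = if k = i then 1 else 0) ∧
      (∀ k, ∀ᶠ x in 𝓝 0, fderiv ℝ Ψ x ((A k).mulVec x) = ∑ i, h k i x • Xv i (Ψ x)) ∧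
      (∀ k i l, ∀ᶠ x in 𝓝 0, fderiv ℝ (h k i) x ((A l).mulVec x) = 0) := by
  have hsym := Dat.sym_lim hE
  have hgood := Dat.good_lim hD.Yv
  have hps : ∀ s, cj σ (D.ps s) = D.ps (σ s) := fun s => by
    show cj σ (X s + D.lim.1 s) = X (σ s) + D.lim.1 (σ s)
    rw [cj_add, cj_X hE.inv, hsym.xi]
  have hhs : ∀ k i, cj σ (D.hh k i) = D.hh k i := fun k i => by
    unfold Dat.hh
    rw [cj_add, hsym.g]
    split_ifs
    · rw [cj_one]
    · rw [cj_zero]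
  let w : (Fin m → ℝ) → Fin m → ℂ := fun x s => ev (D.ps s) (Lm N x)
  let Ψ : (Fin m → ℝ) → (Fin m → ℝ) := fun x a => (P.mulVec (w x) a).re
  let h : Fin p → Fin p → (Fin m → ℝ) → ℝ := fun k i x => (ev (D.hh k i) (Lm N x)).re
  have hΨ : ∀ x s, Lm N (Ψ x) s = ev (D.ps s) (Lm N x) := by
    intro x s
    have h1 : ofR (Ψ x) = P.mulVec (w x) := by
      funext a
      rw [ofR_apply]
      refine Complex.conj_eq_iff_re.1 ?_
      simp only [Matrix.mulVec, dotProduct, map_sum, map_mul, hP]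
      rw [← Equiv.sum_comp σ (fun s => P a s * w x s)]
      refine Finset.sum_congr rfl fun s _ => ?_
      simp only [w]
      rw [← ev_cj hE.inv _ (conj_Lm hN x), hps]
    rw [Lm_apply, h1, Matrix.mulVec_mulVec, hNP, Matrix.one_mulVec]
  have hh : ∀ k i x, ((h k i x : ℝ) : ℂ) = ev (D.hh k i) (Lm N x) := by
    intro k i x
    refine Complex.conj_eq_iff_re.1 ?_
    rw [← ev_cj hE.inv _ (conj_Lm hN x), hhs]
  have han : AnalyticAt ℝ Ψ 0 := by
    refine AnalyticAt.pi fun a => ?_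
    have h1 : AnalyticAt ℝ (fun x => P.mulVec (w x) a) 0 := by
      show AnalyticAt ℝ (fun x => ∑ s, P a s * ev (D.ps s) (Lm N x)) 0
      exact Finset.analyticAt_fun_sum _ fun s _ => analyticAt_const.mul (analytic_ev_Lm (hD.ps_conv s))
    exact (Complex.reCLM.analyticAt _).comp h1
  have hhan : ∀ k i, AnalyticAt ℝ (h k i) 0 := fun k i =>
    (Complex.reCLM.analyticAt _).comp (analytic_ev_Lm (hD.hh_conv k i))
  have hΨ0 : Ψ 0 = 0 := by
    apply Lm_inj hPN
    intro s
    rw [hΨ, map_zero, ev_at_zero, hD.ps_van s 0 (by simp)]; rfl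
  have hΨt : Filter.Tendsto Ψ (𝓝 0) (𝓝 0) := by
    have := han.continuousAt.tendsto
    rwa [hΨ0] at this
  refine ⟨Ψ, h, han, hhan, hΨ0, ?_, ?_, ?_, ?_⟩
  · ext1 v
    apply Lm_inj hPN
    intro s
    rw [← fderiv_Lm han.differentiableAt]
    have := (fderiv_series (N := N) (f := fun x => Lm N (Ψ x) s) (hD.ps_conv s)
      (Filter.Eventually.of_forall fun x => hΨ x s)).self_of_nhds v
    rw [this, map_zero]
    have e : ∀ t, ev (pd t (D.ps s)) (0 : Fin m → ℂ) = if t = s then 1 else 0 := by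
      intro t
      rw [ev_at_zero, coeff_pderiv, zero_add]
      show coeff _ (X s + D.lim.1 s) * _ = _
      rw [map_add, hgood.xi s _ (by simp), coeff_X]
      simp [Finsupp.single_left_inj]
    simp [e]
  · intro k i
    have h1 := hh k i 0
    have h2 := hD.hh_van k i 0 (by simp)
    rw [map_zero, ev_at_zero] at h1
    rw [map_sub, sub_eq_zero] at h2
    rw [h2] at h1
    apply Complex.ofReal_injective
    rw [h1]
    split_ifs <;> simp
  · intro k
    have e1 : ∀ s, ∀ᶠ x in 𝓝 0, fderiv ℝ (fun x => Lm N (Ψ x) s) x ((A k).mulVec x) =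
        ∑ i, (h k i x : ℂ) * Lm N (Xv i (Ψ x)) s := by
      intro s
      have c1 : ∀ i, Conv (comp (D.Z i s) D.ps) := fun i => (hD.Z_conv i s).comp hD.ps_conv hD.ps_van
      have a1 := ev_Lop_Lm hPN hNP hAP (f := fun x => Lm N (Ψ x) s) (hD.ps_conv s)
        (Filter.Eventually.of_forall fun x => hΨ x s) k
      have a2 := (Lm_tendsto N).eventually (Conv.ev_sum (S := Finset.univ)
        (f := fun i => D.hh k i * comp (D.Z i s) D.ps) (fun i _ => (hD.hh_conv k i).mul (c1 i)))
      have a3 := Filter.eventually_all.2 fun i => (Lm_tendsto N).eventually ((hD.hh_conv k i).ev_mul (c1 i))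
      have a4 := Filter.eventually_all.2 fun i => (Lm_tendsto N).eventually
        ((hD.Z_conv i s).ev_comp hD.ps_conv hD.ps_van)
      have a5 := Filter.eventually_all.2 fun i => hΨt.eventually (hZ i s)
      filter_upwards [a1, a2, a3, a4, a5] with x b1 b2 b3 b4 b5
      rw [b1, hD.final, b2]
      refine Finset.sum_congr rfl fun i _ => ?_
      rw [b3, b4, b5, hh]
      congr 2
      funext s
      rw [hΨ]
    filter_upwards [Filter.eventually_all.2 e1, han.eventually_analyticAt] with x b1 b2
    apply Lm_inj hPN
    intro s
    rw [← fderiv_Lm b2.differentiableAt, b1, map_sum, Finset.sum_apply]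
    simp
  · intro k i l
    have a1 := ev_Lop_Lm hPN hNP hAP (f := fun x => ((h k i x : ℝ) : ℂ)) (hD.hh_conv k i)
        (Filter.Eventually.of_forall fun x => hh k i x) l
    filter_upwards [a1, (hhan k i).eventually_analyticAt] with x b1 b2
    rw [hD.hh_inv, ev_zero] at b1
    have : HasFDerivAt (fun x => (h k i x : ℂ)) (Complex.ofRealCLM.comp (fderiv ℝ (h k i) x)) x :=
      Complex.ofRealCLM.hasFDerivAt.comp x b2.differentiableAt.hasFDerivAt
    rw [this.fderiv] at b1
    exact Complex.ofReal_injective (by simpa using b1)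

end
end GeoLin

open scoped BigOperators
namespace GeoLin
noncomputable section
open MvPowerSeries
open scoped ENNReal NNReal Topology ComplexConjugate
variable {m p q : ℕ}

theorem analytic_det {y : Fin m → ℝ} {M : (Fin m → ℝ) → Matrix (Fin p) (Fin p) ℝ}
    (h : ∀ i j, AnalyticAt ℝ (fun x => M x i j) y) : AnalyticAt ℝ (fun x => (M x).det) y := by
  simp only [Matrix.det_apply]
  refine Finset.analyticAt_fun_sum _ fun τ _ => ?_
  have h1 : AnalyticAt ℝ (fun x => ∏ i, M x (τ i) i) y :=
    Finset.analyticAt_fun_prod _ fun i _ => h _ _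
  have h2 := (analyticAt_const (𝕜 := ℝ) (v := (((Equiv.Perm.sign τ : ℤˣ) : ℤ) : ℝ)) (x := y)).mul h1
  refine h2.congr (Filter.Eventually.of_forall fun x => ?_)
  simp [Units.smul_def]

theorem analytic_inv {y : Fin m → ℝ} {M : (Fin m → ℝ) → Matrix (Fin p) (Fin p) ℝ}
    (h : ∀ i j, AnalyticAt ℝ (fun x => M x i j) y) (hy : (M y).det ≠ 0) (i j) :
    AnalyticAt ℝ (fun x => (M x)⁻¹ i j) y := by
  have h1 := (analytic_det h).inv hy
  have h2 : AnalyticAt ℝ (fun x => (M x).adjugate i j) y := by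
    simp only [Matrix.adjugate_apply]
    refine analytic_det fun a b => ?_
    by_cases hab : a = j
    · subst hab; simp only [Matrix.updateRow_self]; exact analyticAt_const
    · simp only [Matrix.updateRow_ne hab]; exact h a b
  refine (h1.mul h2).congr (Filter.Eventually.of_forall fun x => ?_)
  simp [Matrix.inv_def]

theorem finish {U : Set (Fin m → ℝ)} (hUopen : IsOpen U) (hU0 : (0 : Fin m → ℝ) ∈ U)
    {Xv : Fin p → (Fin m → ℝ) → (Fin m → ℝ)} {A : Fin p → Matrix (Fin m) (Fin m) ℝ}
    {Ψ : (Fin m → ℝ) → (Fin m → ℝ)} {h : Fin p → Fin p → (Fin m → ℝ) → ℝ}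
    (han : AnalyticAt ℝ Ψ 0) (hhan : ∀ k i, AnalyticAt ℝ (h k i) 0) (hΨ0 : Ψ 0 = 0)
    (hd : fderiv ℝ Ψ 0 = ContinuousLinearMap.id ℝ _) (hh0 : ∀ k i, h k i 0 = if k = i then 1 else 0)
    (heq : ∀ k, ∀ᶠ x in 𝓝 0, fderiv ℝ Ψ x ((A k).mulVec x) = ∑ i, h k i x • Xv i (Ψ x))
    (hinv : ∀ k i l, ∀ᶠ x in 𝓝 0, fderiv ℝ (h k i) x ((A l).mulVec x) = 0) :
    ∃ V W : Set (Fin m → ℝ), IsOpen V ∧ V ⊆ U ∧ (0 : Fin m → ℝ) ∈ V ∧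
      IsOpen W ∧ (0 : Fin m → ℝ) ∈ W ∧
      ∃ φ ψ : (Fin m → ℝ) → (Fin m → ℝ),
        AnalyticOnNhd ℝ φ V ∧ AnalyticOnNhd ℝ ψ W ∧
        Set.MapsTo φ V W ∧ Set.MapsTo ψ W V ∧
        (∀ x ∈ V, ψ (φ x) = x) ∧ (∀ y ∈ W, φ (ψ y) = y) ∧ φ '' V = W ∧ φ 0 = 0 ∧
        ∃ f : Fin p → Fin p → (Fin m → ℝ) → ℝ,
          (∀ i j, AnalyticOnNhd ℝ (f i j) W) ∧
          (∀ y ∈ W, (Matrix.of fun i j => f i j y).det ≠ 0) ∧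
          (∀ i j l, ∀ y ∈ W, fderiv ℝ (f i j) y ((A l).mulVec y) = 0) ∧
          (∀ i, ∀ x ∈ V, fderiv ℝ φ x (Xv i x) =
            ∑ j, f i j (φ x) • (A j).mulVec (φ x)) := by
  have hs : HasStrictFDerivAt Ψ ((ContinuousLinearEquiv.refl ℝ (Fin m → ℝ) : (Fin m → ℝ) →L[ℝ] (Fin m → ℝ))) 0 := by
    have := han.hasStrictFDerivAt
    rwa [hd] at this
  let e := hs.toOpenPartialHomeomorph Ψ
  have hec : (e : (Fin m → ℝ) → (Fin m → ℝ)) = Ψ := hs.toOpenPartialHomeomorph_coe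
  have hsrc : (0 : Fin m → ℝ) ∈ e.source := hs.mem_toOpenPartialHomeomorph_source
  have hsym : AnalyticAt ℝ e.symm 0 := by
    have := e.analyticAt_symm' (i := ContinuousLinearEquiv.refl ℝ (Fin m → ℝ)) hsrc (by rw [hec]; exact han)
      (by rw [hec, hd]; rfl)
    rwa [hec, hΨ0] at this
  have hΨt : Filter.Tendsto Ψ (𝓝 0) (𝓝 0) := by
    have := han.continuousAt.tendsto
    rwa [hΨ0] at this
  let M : (Fin m → ℝ) → Matrix (Fin p) (Fin p) ℝ := fun x => Matrix.of fun k i => h k i x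
  have hdet : ∀ᶠ x in 𝓝 0, (M x).det ≠ 0 := by
    have hc : ContinuousAt (fun x => (M x).det) 0 := (analytic_det hhan).continuousAt
    refine hc.eventually_ne ?_
    have : M 0 = 1 := by
      ext k i
      simp [M, hh0, Matrix.one_apply]
    rw [this]; simp
  have hall : ∀ᶠ x in 𝓝 0, x ∈ e.source ∧ Ψ x ∈ U ∧ AnalyticAt ℝ Ψ x ∧ AnalyticAt ℝ e.symm (Ψ x) ∧
      (M x).det ≠ 0 ∧ (∀ k i, AnalyticAt ℝ (h k i) x) ∧
      (∀ k, fderiv ℝ Ψ x ((A k).mulVec x) = ∑ i, h k i x • Xv i (Ψ x)) ∧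
      (∀ k i l, fderiv ℝ (h k i) x ((A l).mulVec x) = 0) := by
    filter_upwards [e.open_source.mem_nhds hsrc, hΨt.eventually (hUopen.mem_nhds hU0),
      han.eventually_analyticAt, hΨt.eventually hsym.eventually_analyticAt, hdet,
      Filter.eventually_all.2 fun k => Filter.eventually_all.2 fun i => (hhan k i).eventually_analyticAt,
      Filter.eventually_all.2 heq,
      Filter.eventually_all.2 fun k => Filter.eventually_all.2 fun i => Filter.eventually_all.2 (hinv k i)]
      with x h1 h2 h3 h4 h5 h6 h7 h8 using ⟨h1, h2, h3, h4, h5, h6, h7, h8⟩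
  obtain ⟨W, hW, hWo, hW0⟩ := eventually_nhds_iff.1 hall
  have hWs : W ⊆ e.source := fun y hy => (hW y hy).1
  have hleft : ∀ y ∈ W, e.symm (Ψ y) = y := fun y hy => by
    rw [← hec]; exact e.left_inv (hWs hy)
  refine ⟨Ψ '' W, W, ?_, ?_, ⟨0, hW0, hΨ0⟩, hWo, hW0, e.symm, Ψ, ?_, ?_, ?_, ?_, ?_, hleft, ?_, ?_, ?_⟩
  · rw [← hec]; exact e.isOpen_image_of_subset_source hWo hWs
  · rintro _ ⟨y, hy, rfl⟩; exact (hW y hy).2.1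
  · rintro _ ⟨y, hy, rfl⟩; exact (hW y hy).2.2.2.1
  · intro y hy; exact (hW y hy).2.2.1
  · rintro _ ⟨y, hy, rfl⟩; rw [hleft y hy]; exact hy
  · exact Set.mapsTo_image _ _
  · rintro _ ⟨y, hy, rfl⟩; rw [hleft y hy]
  · rw [Set.image_image]
    exact (Set.image_congr hleft).trans (Set.image_id' W)
  · have := hleft 0 hW0
    rwa [hΨ0] at this
  · have hfan : ∀ i j, AnalyticOnNhd ℝ (fun y => (M y)⁻¹ i j) W := fun i j y hy =>
      analytic_inv (hW y hy).2.2.2.2.2.1 (hW y hy).2.2.2.2.1 i j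
    refine ⟨fun i j y => (M y)⁻¹ i j, hfan, ?_, ?_, ?_⟩
    · intro y hy
      have hu : IsUnit (M y).det := isUnit_iff_ne_zero.2 (hW y hy).2.2.2.2.1
      have : (Matrix.of fun i j => (M y)⁻¹ i j) = (M y)⁻¹ := rfl
      rw [this]
      exact ((Matrix.isUnit_nonsing_inv_det_iff).2 hu).ne_zero
    · intro i j l y hy
      obtain ⟨-, -, -, -, h5, h6, -, h8⟩ := hW y hy
      have key : (M y).mulVec (fun i => fderiv ℝ (fun y => (M y)⁻¹ i j) y ((A l).mulVec y)) = 0 := by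
        funext k
        have e1 : HasFDerivAt (fun x => ∑ i, h k i x * (M x)⁻¹ i j)
            (∑ i, (h k i y • fderiv ℝ (fun y => (M y)⁻¹ i j) y + (M y)⁻¹ i j • fderiv ℝ (h k i) y)) y :=
          HasFDerivAt.fun_sum fun i _ => (h6 k i).differentiableAt.hasFDerivAt.mul
            (hfan i j y hy).differentiableAt.hasFDerivAt
        have e2 : (fun x => ∑ i, h k i x * (M x)⁻¹ i j) =ᶠ[𝓝 y] fun _ => (1 : Matrix (Fin p) (Fin p) ℝ) k j := by
          filter_upwards [hWo.mem_nhds hy] with x hx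
          rw [← Matrix.mul_nonsing_inv (M x) (isUnit_iff_ne_zero.2 (hW x hx).2.2.2.2.1), Matrix.mul_apply]
          rfl
        have e3 := e1.unique ((hasFDerivAt_const _ y).congr_of_eventuallyEq e2)
        have e4 := congrArg (fun L => L ((A l).mulVec y)) e3
        simp only [_root_.sum_apply, _root_.add_apply, _root_.smul_apply, h8, smul_zero, add_zero,
          _root_.zero_apply] at e4
        exact e4
      exact congrFun (Matrix.eq_zero_of_mulVec_eq_zero h5 key) i
    · rintro i _ ⟨y, hy, rfl⟩
      obtain ⟨-, -, h3, h4, h5, h6, h7, h8⟩ := hW y hy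
      rw [hleft y hy]
      have e1 : HasFDerivAt (fun x => e.symm (Ψ x)) ((fderiv ℝ e.symm (Ψ y)).comp (fderiv ℝ Ψ y)) y :=
        h4.differentiableAt.hasFDerivAt.comp y h3.differentiableAt.hasFDerivAt
      have e2 : (fun x => e.symm (Ψ x)) =ᶠ[𝓝 y] id := by
        filter_upwards [hWo.mem_nhds hy] with x hx using hleft x hx
      have e3 := e1.unique ((hasFDerivAt_id y).congr_of_eventuallyEq e2)
      have e4 : ∀ k, (A k).mulVec y = ∑ j, h k j y • fderiv ℝ e.symm (Ψ y) (Xv j (Ψ y)) := by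
        intro k
        have := congrArg (fun L => L ((A k).mulVec y)) e3
        simp only [ContinuousLinearMap.comp_apply, h7, map_sum, map_smul, ContinuousLinearMap.id_apply] at this
        exact this.symm
      simp only [e4, Finset.smul_sum, smul_smul]
      rw [Finset.sum_comm]
      simp only [← Finset.sum_smul]
      have e5 : ∀ j, ∑ k, (M y)⁻¹ i k * h k j y = if i = j then 1 else 0 := by
        intro j
        rw [← Matrix.one_apply, ← Matrix.nonsing_inv_mul (M y) (isUnit_iff_ne_zero.2 h5), Matrix.mul_apply]
        rfl
      simp [e5]

end
end GeoLin

/-- Geometric linearization of a nondegenerate fixed point of a real analytic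
integrable system of type (p,q). -/
theorem geometric_linearization_real
    (p q m : ℕ) (hm : m = p + q)
    (U : Set (Fin m → ℝ)) (hUopen : IsOpen U) (hU0 : (0 : Fin m → ℝ) ∈ U)
    (X : Fin p → (Fin m → ℝ) → (Fin m → ℝ)) (F : Fin q → (Fin m → ℝ) → ℝ)
    (hXan : ∀ i, AnalyticOnNhd ℝ (X i) U)
    (hFan : ∀ j, AnalyticOnNhd ℝ (F j) U)
    -- the vector fields commute:  [X_i, X_j] = 0 on U
    (hcomm : ∀ i j, ∀ x ∈ U, fderiv ℝ (X j) x (X i x) - fderiv ℝ (X i) x (X j x) = 0)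
    -- the functions F_j are common first integrals
    (hFint : ∀ i j, ∀ x ∈ U, fderiv ℝ (F j) x (X i x) = 0)
    -- the X_i are linearly independent on a dense subset of U
    (hXind : U ⊆ closure {x ∈ U | LinearIndependent ℝ fun i => X i x})
    -- the differentials DF_j are linearly independent on a dense subset of U
    (hFind : U ⊆ closure {x ∈ U | LinearIndependent ℝ fun j => fderiv ℝ (F j) x})
    -- 0 is a fixed point
    (hfix : ∀ i, X i 0 = 0)
    -- A_i is the linear part of X_i at 0
    (A : Fin p → Matrix (Fin m) (Fin m) ℝ)
    (hA : ∀ i v, (A i).mulVec v = fderiv ℝ (X i) 0 v)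
    -- each A_i is semisimple (diagonalizable over ℂ)
    (hss : ∀ i, IsSemisimpleMatrixR (A i))
    -- the linear vector fields A_i x are independent on a dense subset of ℝ^m
    (hAind : Dense {x : Fin m → ℝ | LinearIndependent ℝ fun i => (A i).mulVec x})
    -- G_j is the lowest-degree nonzero homogeneous Taylor term of F_j at 0
    (k : Fin q → ℕ) (G : Fin q → (Fin m → ℝ) → ℝ)
    (hklow : ∀ j, ∀ l < k j, iteratedFDeriv ℝ l (F j) 0 = 0)
    (hG : ∀ j x, G j x = (((k j).factorial : ℝ))⁻¹ • iteratedFDeriv ℝ (k j) (F j) 0 (fun _ => x))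
    (hGne : ∀ j, G j ≠ 0)
    -- the differentials DG_j are linearly independent on a dense subset of ℝ^m
    (hGind : Dense {x : Fin m → ℝ | LinearIndependent ℝ fun j => fderiv ℝ (G j) x}) :
    ∃ V W : Set (Fin m → ℝ), IsOpen V ∧ V ⊆ U ∧ (0 : Fin m → ℝ) ∈ V ∧
      IsOpen W ∧ (0 : Fin m → ℝ) ∈ W ∧
      ∃ φ ψ : (Fin m → ℝ) → (Fin m → ℝ),
        AnalyticOnNhd ℝ φ V ∧ AnalyticOnNhd ℝ ψ W ∧
        Set.MapsTo φ V W ∧ Set.MapsTo ψ W V ∧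
        (∀ x ∈ V, ψ (φ x) = x) ∧ (∀ y ∈ W, φ (ψ y) = y) ∧ φ '' V = W ∧ φ 0 = 0 ∧
        ∃ f : Fin p → Fin p → (Fin m → ℝ) → ℝ,
          (∀ i j, AnalyticOnNhd ℝ (f i j) W) ∧
          (∀ y ∈ W, (Matrix.of fun i j => f i j y).det ≠ 0) ∧
          (∀ i j l, ∀ y ∈ W, fderiv ℝ (f i j) y ((A l).mulVec y) = 0) ∧
          (∀ i, ∀ x ∈ V, fderiv ℝ φ x (X i x) =
            ∑ j, f i j (φ x) • (A j).mulVec (φ x)) := by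
  have hUn := hUopen.mem_nhds hU0
  obtain ⟨P, N, σ, D, Fs, n, S, hPN, hNP, hP, hN, hAP, hD, hE, hZ⟩ :=
    GeoLin.assemble hm (fun i => hXan i 0 hU0) (fun j => hFan j 0 hU0)
      (fun i j => Filter.eventually_of_mem hUn (hcomm i j))
      (fun i j => Filter.eventually_of_mem hUn (hFint i j)) hfix hA hss hAind k G hklow hG hGind
  obtain ⟨Ψ, h, h1, h2, h3, h4, h5, h6, h7⟩ := GeoLin.normal_real hPN hNP hP hN hAP hD hE hZ
  exact GeoLin.finish hUopen hU0 h1 h2 h3 h4 h5 h6 h7
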